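/- h₂²(5) = 91/216. That is: (i) for every η > 0 there exists n₀ such that every 5-graph H on n ≥ n₀ vertices with 3 ∣ n and δ₂(H) ≥ (91/216 + η)·C(n,3) contains a Hamilton 2-cycle, and (ii) for every η > 0 and all sufficiently large n with 3 ∣ n there exists a 5-graph H on n vertices with δ₂(H) ≥ (91/216 − η)·C(n,3) containing no Hamilton 2-cycle. -/

import Mathlib

/-- `H` is a `k`-uniform hypergraph (a `k`-graph) on the vertex set `Fin n`. -/
def IsKGraph (n k : ℕ) (H : Finset (Finset (Fin n))) : Prop :=
  ∀ e ∈ H, e.card = k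

/-- The degree `deg_H(S)` of a vertex set `S` in the `k`-graph `H`: the number of
`(k - |S|)`-sets `T` disjoint from `S` with `S ∪ T ∈ H`. -/
noncomputable def hDeg (n k : ℕ) (H : Finset (Finset (Fin n))) (S : Finset (Fin n)) : ℕ :=
  Nat.card {T : Finset (Fin n) // T.card = k - S.card ∧ Disjoint S T ∧ S ∪ T ∈ H}

/-- The minimum `d`-degree `δ_d(H)` of a `k`-graph `H` on `Fin n`. -/
noncomputable def minDeg (n k d : ℕ) (H : Finset (Finset (Fin n))) : ℕ :=
  sInf { m : ℕ | ∃ S : Finset (Fin n), S.card = d ∧ hDeg n k H S = m }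

/-- `H` contains a Hamilton `ℓ`-cycle: there is a cyclic ordering of all the vertices such
that the `n / (k - ℓ)` segments of `k` consecutive vertices starting at the positions
divisible by `k - ℓ` are all edges of `H` (hence every two consecutive edges share
exactly `ℓ` vertices). -/
def HasHamiltonCycle (n k l : ℕ) (H : Finset (Finset (Fin n))) : Prop :=
  ∃ f : ZMod n → Fin n, Function.Bijective f ∧
    ∀ j < n / (k - l),
      ((Finset.range k).image (fun i => f ((j * (k - l) + i : ℕ) : ZMod n))) ∈ H

/-- `f` enumerates (the vertices, in order, of) an `ℓ`-path with `t` edges in `H`: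
the `j`-th edge consists of the `k` consecutive vertices starting at position `j * (k - ℓ)`,
so every two consecutive edges share exactly `ℓ` vertices. -/
def IsLPath (n k l t : ℕ) (H : Finset (Finset (Fin n))) (f : ℕ → Fin n) : Prop :=
  Set.InjOn f (Set.Iio (t * (k - l) + l)) ∧
  ∀ j < t, ((Finset.range k).image (fun i => f (j * (k - l) + i))) ∈ H

/-- The vertex set of the `ℓ`-path with `t` edges enumerated by `f`. -/
def pathVerts (n k l t : ℕ) (f : ℕ → Fin n) : Finset (Fin n) :=
  (Finset.range (t * (k - l) + l)).image f

/-- The first `ℓ` vertices (as an ordered `ℓ`-set) of the path enumerated by `f`. -/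
def pathBeg (n l : ℕ) (f : ℕ → Fin n) : Fin l → Fin n := fun i => f (i : ℕ)

/-- The last `ℓ` vertices (as an ordered `ℓ`-set) of an `ℓ`-path with `t` edges
enumerated by `f`. -/
def pathEnd (n k l t : ℕ) (f : ℕ → Fin n) : Fin l → Fin n := fun i => f (t * (k - l) + (i : ℕ))

/-- `T` is a reachable set for the pair `{u, v}` (with parameter `i`): there are
vertex-disjoint `ℓ`-paths `P₁, …, Pᵢ` of length two covering exactly `T ∪ {u}` and
vertex-disjoint `ℓ`-paths `P₁', …, Pᵢ'` of length two covering exactly `T ∪ {v}`,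
where `P_j` and `P_j'` have the same (ordered) ends for all `j`. -/
def ReachSet (n k l i : ℕ) (H : Finset (Finset (Fin n))) (u v : Fin n)
    (T : Finset (Fin n)) : Prop :=
  ∃ P P' : Fin i → ℕ → Fin n,
    (∀ j, IsLPath n k l 2 H (P j)) ∧ (∀ j, IsLPath n k l 2 H (P' j)) ∧
    (∀ j j', j ≠ j' → Disjoint (pathVerts n k l 2 (P j)) (pathVerts n k l 2 (P j'))) ∧
    (∀ j j', j ≠ j' → Disjoint (pathVerts n k l 2 (P' j)) (pathVerts n k l 2 (P' j'))) ∧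
    (Finset.univ.biUnion (fun j => pathVerts n k l 2 (P j)) = insert u T) ∧
    (Finset.univ.biUnion (fun j => pathVerts n k l 2 (P' j)) = insert v T) ∧
    (∀ j, pathBeg n l (P j) = pathBeg n l (P' j) ∧
      pathEnd n k l 2 (P j) = pathEnd n k l 2 (P' j))

/-- `u` and `v` are `(β, i)`-reachable in the `k`-graph `H` on `n` vertices: there are at
least `β * n ^ ((2k - ℓ) i - 1)` sets `T` of size `(2k - ℓ) i - 1` that are reachable sets
for `{u, v}`. -/
def Reachable (n k l : ℕ) (H : Finset (Finset (Fin n))) (β : ℝ) (i : ℕ) (u v : Fin n) : Prop :=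
  β * (n : ℝ) ^ ((2 * k - l) * i - 1) ≤
    (Nat.card {T : Finset (Fin n) // T.card = (2 * k - l) * i - 1 ∧
      ReachSet n k l i H u v T} : ℝ)

/-- `H` contains a `Y_{k,2ℓ}`-tiling (vertex-disjoint copies of the `k`-graph consisting of
two edges intersecting in exactly `2ℓ` vertices) covering all but at most `u` vertices. -/
def HasYTilingCover (n l : ℕ) (H : Finset (Finset (Fin n))) (u : ℝ) : Prop :=
  ∃ (m : ℕ) (e₁ e₂ : Fin m → Finset (Fin n)),
    (∀ j, e₁ j ∈ H ∧ e₂ j ∈ H ∧ ((e₁ j) ∩ (e₂ j)).card = 2 * l) ∧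
    (∀ j j', j ≠ j' → Disjoint ((e₁ j) ∪ (e₂ j)) ((e₁ j') ∪ (e₂ j'))) ∧
    (n : ℝ) - ((Finset.univ.biUnion fun j => (e₁ j) ∪ (e₂ j)).card : ℝ) ≤ u

/-- The tiling threshold `t_d^ℓ(k, n, ε)`: the minimum `t` such that every `k`-graph `H`
on `n` vertices with `δ_d(H) ≥ t` contains a `Y_{k,2ℓ}`-tiling covering all but at most
`ε n` vertices. -/
noncomputable def tThreshold (k d l n : ℕ) (ε : ℝ) : ℕ :=
  sInf { t : ℕ | ∀ H : Finset (Finset (Fin n)), IsKGraph n k H →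
    t ≤ minDeg n k d H → HasYTilingCover n l H (ε * n) }

/-- `t(k,d,ℓ) := limsup_{ε → 0⁺} limsup_{n → ∞} t_d^ℓ(k,n,ε) / C(n, k-d)`. -/
noncomputable def tVal (k d l : ℕ) : ℝ :=
  Filter.limsup
    (fun ε : ℝ => Filter.limsup
      (fun n : ℕ => (tThreshold k d l n ε : ℝ) / (n.choose (k - d) : ℝ)) Filter.atTop)
    (nhdsWithin (0 : ℝ) (Set.Ioi (0 : ℝ)))

/-- The Dirac threshold `h_d^ℓ(k, n)`: the smallest `h` such that every `k`-graph `H` on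
`n` vertices with `δ_d(H) ≥ h` contains a Hamilton `ℓ`-cycle. -/
noncomputable def hThreshold (k d l n : ℕ) : ℕ :=
  sInf { h : ℕ | ∀ H : Finset (Finset (Fin n)), IsKGraph n k H →
    h ≤ minDeg n k d H → HasHamiltonCycle n k l H }

/-- `h_d^ℓ(k) := limsup_{n → ∞, (k-ℓ) ∣ n} h_d^ℓ(k,n) / C(n, k-d)`. -/
noncomputable def hVal (k d l : ℕ) : ℝ :=
  Filter.limsup (fun n : ℕ => (hThreshold k d l n : ℝ) / (n.choose (k - d) : ℝ))
    (Filter.atTop ⊓ Filter.principal { m : ℕ | (k - l) ∣ m })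

/-- The generalized binomial coefficient `C(x, r)` for a real `x`. -/
noncomputable def genChoose (x : ℝ) (r : ℕ) : ℝ :=
  (∏ i ∈ Finset.range r, (x - (i : ℝ))) / (r.factorial : ℝ)

/-- The number of sets in the `ε`-robust `r`-shadow `∂_ε^r(G)` of the `K`-graph `G` on
`Fin n`: the number of `(K - r)`-sets lying in more than `ε * n ^ r` edges of `G`. -/
noncomputable def shadowCard (n K r : ℕ) (G : Finset (Finset (Fin n))) (ε : ℝ) : ℕ :=
  Nat.card {F : Finset (Fin n) // F.card = K - r ∧ ε * (n : ℝ) ^ r < (hDeg n K G F : ℝ)}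

/-- `g` is an `S`-absorber, given as a `b`-tuple of distinct vertices avoiding `S`: the
tuple spans a family of `2k - 2ℓ + 1` vertex-disjoint `ℓ`-paths, and there is another
family of `2k - 2ℓ + 1` vertex-disjoint `ℓ`-paths, with the same ordered ends, spanning
the tuple together with `S`. -/
def IsAbsorberTuple (n k l b : ℕ) (H : Finset (Finset (Fin n))) (S : Finset (Fin n))
    (g : Fin b → Fin n) : Prop :=
  Function.Injective g ∧ (∀ i, g i ∉ S) ∧
  ∃ (t t' : Fin (2 * k - 2 * l + 1) → ℕ) (Q Q' : Fin (2 * k - 2 * l + 1) → ℕ → Fin n),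
    (∀ j, IsLPath n k l (t j) H (Q j)) ∧ (∀ j, IsLPath n k l (t' j) H (Q' j)) ∧
    (∀ j j', j ≠ j' → Disjoint (pathVerts n k l (t j) (Q j)) (pathVerts n k l (t j') (Q j'))) ∧
    (∀ j j', j ≠ j' →
      Disjoint (pathVerts n k l (t' j) (Q' j)) (pathVerts n k l (t' j') (Q' j'))) ∧
    (∀ j, pathBeg n l (Q j) = pathBeg n l (Q' j) ∧
      pathEnd n k l (t j) (Q j) = pathEnd n k l (t' j) (Q' j)) ∧
    Finset.univ.biUnion (fun j => pathVerts n k l (t' j) (Q' j)) = Finset.image g Finset.univ ∧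
    Finset.univ.biUnion (fun j => pathVerts n k l (t j) (Q j)) = Finset.image g Finset.univ ∪ S

noncomputable section
open Finset Classical

namespace Dirac

section

/-- The average of a real function over a finite type. -/
def av {α : Type*} [Finite α] (f : α → ℝ) : ℝ :=
  (∑ a ∈ (Set.finite_univ (α := α)).toFinset, f a) / Nat.card α

/-- The probability of `P` under the uniform distribution. -/
def Pr {α : Type*} [Finite α] (P : α → Prop) : ℝ := av (fun a => if P a then 1 else 0)

section
variable {α β : Type*} [Finite α] [Finite β]

lemma av_eq {α : Type*} [Fintype α] (f : α → ℝ) : av f = (∑ a, f a) / Fintype.card α := by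
  unfold av
  rw [Nat.card_eq_fintype_card]
  congr 2
  ext a; simp

lemma av_mono {f g : α → ℝ} (h : ∀ a, f a ≤ g a) : av f ≤ av g := by
  cases nonempty_fintype α
  simp only [av_eq]; gcongr; exact h _

lemma av_nonneg {f : α → ℝ} (h : ∀ a, 0 ≤ f a) : 0 ≤ av f := by
  cases nonempty_fintype α
  simp only [av_eq]; exact div_nonneg (sum_nonneg fun a _ => h a) (by positivity)

lemma av_add (f g : α → ℝ) : av (fun a => f a + g a) = av f + av g := by
  cases nonempty_fintype α
  simp only [av_eq]; rw [sum_add_distrib, add_div]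

lemma av_sub (f g : α → ℝ) : av (fun a => f a - g a) = av f - av g := by
  cases nonempty_fintype α
  simp only [av_eq]; rw [sum_sub_distrib, sub_div]

lemma av_mul_left (c : ℝ) (f : α → ℝ) : av (fun a => c * f a) = c * av f := by
  cases nonempty_fintype α
  simp only [av_eq]; rw [← mul_sum, mul_div_assoc]

lemma av_const [Nonempty α] (c : ℝ) : av (fun _ : α => c) = c := by
  cases nonempty_fintype α
  simp only [av_eq]; simp

lemma av_prod (f : α × β → ℝ) : av f = av (fun a => av (fun b => f (a, b))) := by
  cases nonempty_fintype α
  cases nonempty_fintype β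
  simp only [av_eq]
  rw [Fintype.sum_prod_type, Fintype.card_prod, ← sum_div, div_div]
  push_cast; rw [mul_comm]

lemma av_equiv (e : α ≃ β) (f : β → ℝ) : av (fun a => f (e a)) = av f := by
  cases nonempty_fintype α
  cases nonempty_fintype β
  simp only [av_eq]; rw [Equiv.sum_comp e f, Fintype.card_congr e]

lemma av_le_of_le [Nonempty α] {f : α → ℝ} {c : ℝ} (h : ∀ a, f a ≤ c) : av f ≤ c :=
  (av_mono h).trans_eq (av_const c)

lemma Pr_eq {α : Type*} [Fintype α] (P : α → Prop) [DecidablePred P] :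
    Pr P = ((univ.filter P).card : ℝ) / Fintype.card α := by
  simp only [Pr, av_eq]
  congr 1
  rw [← sum_boole]
  exact sum_congr rfl fun a _ => by split_ifs <;> rfl

lemma Pr_nonneg (P : α → Prop) : 0 ≤ Pr P := av_nonneg fun a => by split_ifs <;> simp

lemma Pr_le_one (P : α → Prop) : Pr P ≤ 1 := by
  cases nonempty_fintype α
  rw [Pr_eq]
  exact div_le_one_of_le₀ (by exact_mod_cast card_le_univ _) (by positivity)

lemma Pr_mono {P Q : α → Prop} (h : ∀ a, P a → Q a) : Pr P ≤ Pr Q :=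
  av_mono fun a => by
    by_cases hp : P a
    · simp [hp, h a hp]
    · simp only [hp, if_false]; split_ifs <;> simp

lemma Pr_congr {P Q : α → Prop} (h : ∀ a, P a ↔ Q a) : Pr P = Pr Q := by
  have : P = Q := funext fun a => propext (h a)
  rw [this]

lemma Pr_le_add {P Q R : α → Prop} (h : ∀ a, P a → Q a ∨ R a) : Pr P ≤ Pr Q + Pr R := by
  unfold Pr; rw [← av_add]
  refine av_mono fun a => ?_
  by_cases hp : P a
  · rcases h a hp with hq | hr
    · simp only [hp, hq, if_true]; split_ifs <;> simp
    · simp only [hp, hr, if_true]; split_ifs <;> simp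
  · simp only [hp, if_false]; split_ifs <;> simp

lemma Pr_not [Nonempty α] (P : α → Prop) : Pr (fun a => ¬ P a) = 1 - Pr P := by
  have : Pr (fun a => ¬ P a) + Pr P = 1 := by
    unfold Pr; rw [← av_add]
    refine Eq.trans ?_ (av_const (α := α) 1)
    congr 1; funext a
    by_cases h : P a <;> simp [h]
  linarith

/-- Removing an unlikely event. -/
lemma Pr_and_ge {P Q : α → Prop} {c d : ℝ} (hP : c ≤ Pr P) (hQ : Pr (fun a => ¬ Q a) ≤ d) :
    c - d ≤ Pr (fun a => P a ∧ Q a) := by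
  have := Pr_le_add (P := P) (Q := fun a => P a ∧ Q a) (R := fun a => ¬ Q a)
    (fun a h => by by_cases q : Q a <;> simp [h, q])
  linarith

lemma Pr_prod (P : α × β → Prop) : Pr P = av (fun a => Pr (fun b => P (a, b))) := by
  unfold Pr; rw [av_prod]

lemma Pr_equiv (e : α ≃ β) (P : β → Prop) : Pr (fun a => P (e a)) = Pr P := by
  unfold Pr; exact av_equiv e (fun b => if P b then (1:ℝ) else 0)

lemma Pr_swap (P : α × β → Prop) : Pr (fun x : β × α => P (x.2, x.1)) = Pr P :=
  Pr_equiv (Equiv.prodComm β α) P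

lemma Pr_prod_ge {P : α → Prop} {Q : α → β → Prop} {c d : ℝ} (hd : 0 ≤ d) (hP : c ≤ Pr P)
    (hQ : ∀ a, P a → d ≤ Pr (Q a)) : c * d ≤ Pr (fun x : α × β => P x.1 ∧ Q x.1 x.2) := by
  rw [Pr_prod]
  calc c * d ≤ Pr P * d := by gcongr
    _ = av (fun a => d * if P a then 1 else 0) := by rw [av_mul_left, mul_comm]; rfl
    _ ≤ _ := av_mono fun a => by
      by_cases h : P a
      · simpa [h] using hQ a h
      · simpa [h] using Pr_nonneg _

lemma Pr_prod_le {P : α × β → Prop} {d : ℝ} [Nonempty α]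
    (hQ : ∀ a, Pr (fun b => P (a, b)) ≤ d) : Pr P ≤ d := by
  rw [Pr_prod]; exact av_le_of_le hQ

lemma Pr_indep (P : α → Prop) (Q : β → Prop) :
    Pr (fun x : α × β => P x.1 ∧ Q x.2) = Pr P * Pr Q := by
  rw [Pr_prod, mul_comm, show Pr P = av (fun a => if P a then (1:ℝ) else 0) from rfl,
    ← av_mul_left]
  congr 1; funext a
  by_cases h : P a
  · simp [h]
  · simp only [h, false_and, if_false, mul_zero]
    unfold Pr; simp [av]

lemma Pr_fst [Nonempty β] (P : α → Prop) : Pr (fun x : α × β => P x.1) = Pr P := by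
  rw [Pr_prod]
  unfold Pr
  congr 1; funext a
  exact av_const (α := β) (if P a then (1:ℝ) else 0)

lemma Pr_snd [Nonempty α] (P : β → Prop) : Pr (fun x : α × β => P x.2) = Pr P := by
  rw [Pr_prod]; exact av_const (α := α) (Pr P)

/-- Averaging: a likely event on a product has many likely fibres. -/
lemma Pr_fibre {P : α × β → Prop} {c : ℝ} [Nonempty α] (h : c ≤ Pr P) :
    c / 2 ≤ Pr (fun a => c / 2 ≤ Pr (fun b => P (a, b))) := by
  rw [Pr_prod] at h
  have h2 : av (fun a => Pr (fun b => P (a, b))) ≤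
      av (fun a => (if c / 2 ≤ Pr (fun b => P (a, b)) then (1:ℝ) else 0) + max (c/2) 0) := by
    refine av_mono fun a => ?_
    split_ifs with h1
    · linarith [Pr_le_one (fun b => P (a, b)), le_max_right (c/2) 0]
    · linarith [le_max_left (c/2) 0]
  rw [av_add, av_const] at h2
  rcases le_total (c/2) 0 with hc | hc
  · exact hc.trans (Pr_nonneg _)
  · rw [max_eq_left hc] at h2
    change _ ≤ Pr _ + _ at h2
    linarith

/-- Markov's inequality in deletion form. -/
lemma Pr_del {P : α × β → Prop} {θ : ℝ} [Nonempty α] (hθ : 0 ≤ θ) :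
    Pr (fun x : α × β => P x ∧ ¬ θ ≤ Pr (fun b => P (x.1, b))) ≤ θ := by
  refine Pr_prod_le fun a => ?_
  by_cases h : θ ≤ Pr (fun b => P (a, b))
  · simp only [h, not_true, and_false]
    unfold Pr; simp [av, hθ]
  · refine (Pr_mono (Q := fun b => P (a, b)) fun b hb => hb.1).trans ?_
    linarith

lemma Pr_mem {α : Type*} [Fintype α] (S : Finset α) : Pr (fun a => a ∈ S) = (S.card : ℝ) / Fintype.card α := by
  rw [Pr_eq]; simp

lemma Pr_eq_single {α : Type*} [Fintype α] (v : α) : Pr (fun a => a = v) = 1 / Fintype.card α := by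
  have : univ.filter (fun a => a = v) = {v} := by ext; simp
  rw [Pr_eq, this]; simp

lemma exists_of_Pr_pos {P : α → Prop} (h : 0 < Pr P) : ∃ a, P a := by
  by_contra! hc
  have : Pr P = 0 := by unfold Pr; simp [av, hc]
  linarith

/-- Union bound over a finite index type. -/
lemma Pr_exists_le {ι : Type*} [Fintype ι] (P : ι → α → Prop) :
    Pr (fun a => ∃ i, P i a) ≤ ∑ i, Pr (P i) := by
  have : ∑ i, Pr (P i) = av (fun a => ∑ i, if P i a then (1:ℝ) else 0) := by
    cases nonempty_fintype α
    unfold Pr; simp only [av_eq]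
    rw [sum_comm, sum_div]
  rw [this]
  refine av_mono fun a => ?_
  split_ifs with h
  · obtain ⟨i, hi⟩ := h
    calc (1:ℝ) = if P i a then 1 else 0 := by simp [hi]
      _ ≤ _ := single_le_sum (f := fun i => if P i a then (1:ℝ) else 0)
        (fun j _ => by split_ifs <;> simp) (mem_univ i)
  · exact sum_nonneg fun j _ => by split_ifs <;> simp

end

/-- Random functions restricted along an injection are uniformly distributed. -/
lemma av_comp_embedding {ι κ X : Type*} [Finite ι] [Finite κ] [Finite X] [Nonempty X]
    (e : ι ↪ κ) (F : (ι → X) → ℝ) : av (fun g : κ → X => F (fun i => g (e i))) = av F := by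
  let E1 : (κ → X) ≃ ({x // x ∈ Set.range e} → X) × ({x // x ∉ Set.range e} → X) :=
    Equiv.piEquivPiSubtypeProd _ _
  let E2 : (ι → X) ≃ ({x // x ∈ Set.range e} → X) :=
    Equiv.arrowCongr (Equiv.ofInjective e e.injective) (Equiv.refl X)
  have h1 := av_equiv E1 (fun p => F (E2.symm p.1))
  have h2 := av_equiv E2 (fun p => F (E2.symm p))
  simp only [Equiv.symm_apply_apply] at h2
  rw [h2, ← show av (fun p : ({x // x ∈ Set.range e} → X) × ({x // x ∉ Set.range e} → X) =>
    F (E2.symm p.1)) = av (fun p => F (E2.symm p)) from ?_, ← h1]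
  · rfl
  · rw [av_prod]; congr 1; funext a
    exact av_const (α := {x // x ∉ Set.range e} → X) (F (E2.symm a))

lemma Pr_comp_embedding {ι κ X : Type*} [Finite ι] [Finite κ] [Finite X] [Nonempty X]
    (e : ι ↪ κ) (F : (ι → X) → Prop) : Pr (fun g : κ → X => F (fun i => g (e i))) = Pr F :=
  av_comp_embedding e (fun h => if F h then (1:ℝ) else 0)

lemma Pr_apply {κ X : Type*} [Finite κ] [Finite X] [Nonempty X]
    (k : κ) (F : X → Prop) : Pr (fun g : κ → X => F (g k)) = Pr F := by
  have := Pr_comp_embedding (X := X) ⟨fun _ : Unit => k, fun _ _ _ => rfl⟩ (fun h => F (h ()))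
  refine Eq.trans this ?_
  exact Pr_equiv (Equiv.funUnique Unit X) F

end

section

lemma av_sum {A B : Type*} [Fintype A] [Fintype B] [Nonempty A]
    (h : Fintype.card B = 5 * Fintype.card A) (f : A ⊕ B → ℝ) :
    av f = 1 / 6 * av (fun a => f (Sum.inl a)) + 5 / 6 * av (fun b => f (Sum.inr b)) := by
  simp only [av_eq, Fintype.sum_sum_type, Fintype.card_sum, h]
  have : (Fintype.card A : ℝ) ≠ 0 := by exact_mod_cast Fintype.card_ne_zero
  push_cast
  field_simp
  ring

lemma av_comm {A B : Type*} [Finite A] [Finite B] (f : A → B → ℝ) :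
    av (fun a => av (f a)) = av (fun b => av (fun a => f a b)) := by
  cases nonempty_fintype A
  cases nonempty_fintype B
  simp only [av_eq, ← sum_div]
  rw [sum_comm, div_right_comm]

/-- Markov's inequality. -/
lemma markov {α : Type*} [Finite α] {f : α → ℝ} (h : ∀ a, 0 ≤ f a) (c : ℝ) :
    c * Pr (fun a => c ≤ f a) ≤ av f := by
  unfold Pr
  rw [← av_mul_left]
  refine av_mono fun a => ?_
  split_ifs with h1
  · linarith
  · simpa using h a

section Samuels
variable {A B : Type*} [Fintype A] [Fintype B]

lemma av_fst [Nonempty B] (f : A → ℝ) : av (fun x : A × B => f x.1) = av f := by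
  rw [av_prod]; congr 1; funext a; exact av_const (α := B) (f a)

lemma av_snd [Nonempty A] (f : B → ℝ) : av (fun x : A × B => f x.2) = av f := by
  rw [av_prod]; exact av_const (α := A) (av f)

variable [Nonempty A] [Nonempty B]

lemma samuels_aux (hc : Fintype.card B = 5 * Fintype.card A) (u : A → ℝ) (w : B → ℝ) (τ : ℝ)
    (hw0 : ∀ b, 0 ≤ w b) (hwτ : ∀ b, w b ≤ τ) (hu : ∀ a, τ ≤ u a)
    (hsum : ∑ a, u a + ∑ b, w b ≤ Fintype.card A) :
    Pr (fun t : B × B × B => 1 ≤ w t.1 + w t.2.1 + w t.2.2) ≤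
      3 / 5 * av (fun a => Pr (fun t : B × B => w t.1 + w t.2 < 1 - u a)) := by
  set y := av w with hy
  have hA : (0:ℝ) < Fintype.card A := by exact_mod_cast Fintype.card_pos
  have hmean : av u ≤ 1 - 5 * y := by
    rw [hy, av_eq, av_eq, hc]
    push_cast
    rw [← sub_nonneg]
    have : 1 - 5 * ((∑ b, w b) / (5 * (Fintype.card A : ℝ))) - (∑ a, u a) / (Fintype.card A : ℝ)
      = (Fintype.card A - (∑ a, u a + ∑ b, w b)) / Fintype.card A := by
      field_simp; ring
    rw [this]; exact div_nonneg (by linarith) hA.le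
  have hy0 : 0 ≤ y := av_nonneg hw0
  have hτ : τ ≤ av u := by
    rw [← av_const (α := A) τ]; exact av_mono hu
  obtain ⟨b0⟩ : Nonempty B := inferInstance
  have hτ0 : 0 ≤ τ := (hw0 b0).trans (hwτ b0)
  have hK0 : 0 ≤ av (fun a => Pr (fun t : B × B => w t.1 + w t.2 < 1 - u a)) :=
    av_nonneg fun a => Pr_nonneg _
  have h3 : av (fun t : B × B × B => w t.1 + w t.2.1 + w t.2.2) = 3 * y := by
    rw [av_add, av_add, av_fst, av_snd (fun t : B × B => w t.1), av_snd (fun t : B × B => w t.2),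
      av_fst, av_snd]
    ring
  have h2 : av (fun t : B × B => w t.1 + w t.2) = 2 * y := by
    rw [av_add, av_fst, av_snd]; ring
  have hP3 : Pr (fun t : B × B × B => 1 ≤ w t.1 + w t.2.1 + w t.2.2) ≤ 3 * y := by
    have := markov (f := fun t : B × B × B => w t.1 + w t.2.1 + w t.2.2)
      (fun t => by linarith [hw0 t.1, hw0 t.2.1, hw0 t.2.2]) 1
    rw [h3] at this; linarith
  rcases (show 0 ≤ 1 - τ by linarith).eq_or_lt with hD | hD
  · have : y = 0 := by linarith
    rw [this] at hP3
    linarith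
  have hK : 3 * y / (1 - τ) ≤ av (fun a => Pr (fun t : B × B => w t.1 + w t.2 < 1 - u a)) := by
    have e : ∀ a, (1 - τ)⁻¹ * (1 - u a - 2 * y) ≤ Pr (fun t : B × B => w t.1 + w t.2 < 1 - u a) := by
      intro a
      rw [inv_mul_le_iff₀ hD]
      have m := markov (f := fun t : B × B => w t.1 + w t.2)
        (fun t => by linarith [hw0 t.1, hw0 t.2]) (1 - u a)
      rw [h2] at m
      have n := Pr_not (fun t : B × B => 1 - u a ≤ w t.1 + w t.2)
      simp only [not_le] at n
      have p := Pr_nonneg (fun t : B × B => w t.1 + w t.2 < 1 - u a)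
      nlinarith [hu a]
    refine le_trans ?_ (av_mono e)
    rw [av_mul_left, av_sub, av_sub, av_const, av_const, div_eq_inv_mul]
    gcongr
    linarith
  refine le_trans ?_ (mul_le_mul_of_nonneg_left hK (by norm_num))
  rw [← mul_div_assoc, le_div_iff₀ hD]
  rcases lt_or_ge τ (1/3) with h | h
  · have : Pr (fun t : B × B × B => 1 ≤ w t.1 + w t.2.1 + w t.2.2) = 0 := by
      refine le_antisymm ?_ (Pr_nonneg _)
      by_contra! hc
      obtain ⟨t, ht⟩ := exists_of_Pr_pos hc
      linarith [hwτ t.1, hwτ t.2.1, hwτ t.2.2]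
    rw [this]; linarith
  rcases lt_or_ge τ (2/5) with h' | h'
  · have q : Pr (fun b => 1/5 ≤ w b) ≤ 5 * y := by
      have := markov hw0 (1/5)
      linarith
    have q0 := Pr_nonneg (fun b => 1/5 ≤ w b)
    have : Pr (fun t : B × B × B => 1 ≤ w t.1 + w t.2.1 + w t.2.2) ≤ (5 * y) ^ 3 := by
      calc _ ≤ Pr (fun t : B × B × B => 1/5 ≤ w t.1 ∧ 1/5 ≤ w t.2.1 ∧ 1/5 ≤ w t.2.2) :=
            Pr_mono fun t ht => ⟨by linarith [hwτ t.2.1, hwτ t.2.2], by linarith [hwτ t.1, hwτ t.2.2],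
              by linarith [hwτ t.2.1, hwτ t.1]⟩
        _ = Pr (fun b => 1/5 ≤ w b) ^ 3 := by
          rw [Pr_indep (fun b => 1/5 ≤ w b) (fun t : B × B => 1/5 ≤ w t.1 ∧ 1/5 ≤ w t.2),
            Pr_indep (fun b => 1/5 ≤ w b) (fun b => 1/5 ≤ w b)]
          ring
        _ ≤ _ := by gcongr
    have hy5 : 5 * y ≤ 1 - τ := by linarith
    have : (5 * y) ^ 3 * (1 - τ) ≤ 3/5 * (3 * y) := by
      have e1 : (5*y)^2 ≤ (2/3)^2 := by gcongr; linarith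
      have e2 : (5*y)^2 * (1-τ) ≤ (2/3)^2 * (2/3) := by gcongr; linarith
      nlinarith
    nlinarith
  · nlinarith

lemma samuels_split (hc : Fintype.card B = 5 * Fintype.card A) (w : A ⊕ B → ℝ) (τ : ℝ)
    (hw0 : ∀ x, 0 ≤ w x) (hB : ∀ b, w (Sum.inr b) ≤ τ)
    (hA : ∀ a, τ ≤ w (Sum.inl a)) (hsum : ∑ x, w x ≤ Fintype.card A) :
    Pr (fun t : (A ⊕ B) × (A ⊕ B) × (A ⊕ B) => 1 ≤ w t.1 + w t.2.1 + w t.2.2) ≤ 91 / 216 := by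
  have h1 := samuels_aux hc (fun a => w (Sum.inl a)) (fun b => w (Sum.inr b)) τ
    (fun b => hw0 _) hB hA (by rwa [Fintype.sum_sum_type] at hsum)
  have n := Pr_not (fun t : (A ⊕ B) × (A ⊕ B) × (A ⊕ B) => 1 ≤ w t.1 + w t.2.1 + w t.2.2)
  have n3 := Pr_not (fun t : B × B × B =>
    1 ≤ w (Sum.inr t.1) + w (Sum.inr t.2.1) + w (Sum.inr t.2.2))
  simp only [not_le] at n n3
  set K := av (fun a => Pr (fun t : B × B => w (Sum.inr t.1) + w (Sum.inr t.2) < 1 - w (Sum.inl a)))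
    with hK
  let I : A ⊕ B → A ⊕ B → A ⊕ B → ℝ := fun x y z => if w x + w y + w z < 1 then 1 else 0
  have hI : ∀ x y z, 0 ≤ I x y z := fun x y z => by simp only [I]; split_ifs <;> simp
  have e0 : Pr (fun t : (A ⊕ B) × (A ⊕ B) × (A ⊕ B) => w t.1 + w t.2.1 + w t.2.2 < 1) =
      av (fun x => av (fun y => av (fun z => I x y z))) := by
    unfold Pr; rw [av_prod]; congr 1; funext x; rw [av_prod]
  have e3 : Pr (fun t : B × B × B => w (Sum.inr t.1) + w (Sum.inr t.2.1) + w (Sum.inr t.2.2) < 1) =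
      av (fun x => av (fun y => av (fun z => I (Sum.inr x) (Sum.inr y) (Sum.inr z)))) := by
    unfold Pr; rw [av_prod]; congr 1; funext x; rw [av_prod]
  have k1 : K = av (fun a => av (fun y => av (fun z => I (Sum.inl a) (Sum.inr y) (Sum.inr z)))) := by
    rw [hK]; congr 1; funext a; unfold Pr; rw [av_prod]; congr 1; funext y; congr 1; funext z
    simp only [I]; congr 1; apply propext; constructor <;> intro h <;> linarith
  have k2 : K = av (fun x => av (fun y => av (fun z => I (Sum.inr x) (Sum.inl y) (Sum.inr z)))) := by
    rw [k1, av_comm]; congr 1; funext x; congr 1; funext y; congr 1; funext z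
    simp only [I]; congr 1; apply propext; constructor <;> intro h <;> linarith
  have k3 : K = av (fun x => av (fun y => av (fun z => I (Sum.inr x) (Sum.inr y) (Sum.inl z)))) := by
    rw [k2]; congr 1; funext x; rw [av_comm]; congr 1; funext y; congr 1; funext z
    simp only [I]; congr 1; apply propext; constructor <;> intro h <;> linarith
  have c1 : ∀ x y, av (fun z => I x y z) = 1/6 * av (fun z => I x y (Sum.inl z)) +
    5/6 * av (fun z => I x y (Sum.inr z)) := fun x y => av_sum hc _
  have c2 : ∀ x, av (fun y => av (fun z => I x y z)) ≥
      5/36 * av (fun y => av (fun z => I x (Sum.inl y) (Sum.inr z))) +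
      5/36 * av (fun y => av (fun z => I x (Sum.inr y) (Sum.inl z))) +
      25/36 * av (fun y => av (fun z => I x (Sum.inr y) (Sum.inr z))) := by
    intro x
    rw [av_sum hc]
    simp only [c1]
    rw [av_add, av_add, av_mul_left, av_mul_left, av_mul_left, av_mul_left]
    have := av_nonneg (fun y : A => av_nonneg (fun z : A => hI x (Sum.inl y) (Sum.inl z)))
    linarith
  have c3 : av (fun x => av (fun y => av (fun z => I x y z))) ≥
      25/216 * K + 25/216 * K + 25/216 * K + 125/216 *
      av (fun x => av (fun y => av (fun z => I (Sum.inr x) (Sum.inr y) (Sum.inr z)))) := by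
    nth_rewrite 1 [k1]
    nth_rewrite 1 [k2]
    rw [k3, av_sum hc]
    have b1 := av_mono (fun x : A => c2 (Sum.inl x))
    have b2 := av_mono (fun x : B => c2 (Sum.inr x))
    rw [av_add, av_add, av_mul_left, av_mul_left, av_mul_left] at b1 b2
    have z1 := av_nonneg (fun x : A => av_nonneg (fun y : A => av_nonneg (fun z : B =>
      hI (Sum.inl x) (Sum.inl y) (Sum.inr z))))
    have z2 := av_nonneg (fun x : A => av_nonneg (fun y : B => av_nonneg (fun z : A =>
      hI (Sum.inl x) (Sum.inr y) (Sum.inl z))))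
    linarith
  rw [e0] at n
  rw [e3] at n3
  linarith

end Samuels

lemma exists_top_set {W : Type*} [Fintype W] (w : W → ℝ) (k : ℕ) (hk : k ≤ Fintype.card W) :
    ∃ A : Finset W, A.card = k ∧ ∀ a ∈ A, ∀ b ∉ A, w b ≤ w a := by
  induction k with
  | zero => exact ⟨∅, by simp, by simp⟩
  | succ k ih =>
    obtain ⟨A, hA, h⟩ := ih (by omega)
    have hne : (Aᶜ).Nonempty := by
      rw [← card_pos, card_compl]; omega
    obtain ⟨x, hx, hm⟩ := exists_max_image Aᶜ w hne
    rw [mem_compl] at hx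
    refine ⟨insert x A, by rw [card_insert_of_notMem hx, hA], ?_⟩
    intro a ha b hb
    rw [mem_insert, not_or] at hb
    rcases mem_insert.1 ha with rfl | ha
    · exact hm b (mem_compl.2 hb.2)
    · exact h a ha b hb.2

/-- The case `k = 3` of Samuels' inequality, with mean `1 / 6`. -/
theorem samuels {W : Type*} [Fintype W] [Nonempty W] (h6 : 6 ∣ Fintype.card W) (w : W → ℝ)
    (hw0 : ∀ x, 0 ≤ w x) (hsum : 6 * ∑ x, w x ≤ Fintype.card W) :
    Pr (fun t : W × W × W => 1 ≤ w t.1 + w t.2.1 + w t.2.2) ≤ 91 / 216 := by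
  obtain ⟨k, hk⟩ := h6
  have hpos : 0 < Fintype.card W := Fintype.card_pos
  obtain ⟨A, hA, htop⟩ := exists_top_set w k (by omega)
  have hne : (Aᶜ).Nonempty := by rw [← card_pos, card_compl]; omega
  have hAne : A.Nonempty := by rw [← card_pos]; omega
  obtain ⟨b, hb, hm⟩ := exists_max_image Aᶜ w hne
  have : Nonempty {x // x ∈ A} := hAne.to_subtype
  have : Nonempty {x // x ∉ A} := ⟨⟨b, mem_compl.1 hb⟩⟩
  let e := Equiv.sumCompl (fun x => x ∈ A)
  have hcA : Fintype.card {x // x ∈ A} = k := by simp [hA]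
  have hcB : Fintype.card {x // x ∉ A} = 5 * k := by
    rw [Fintype.card_subtype_compl, hk]
    simp [hA]; omega
  have := samuels_split (A := {x // x ∈ A}) (B := {x // x ∉ A}) (by rw [hcA, hcB])
    (fun x => w (e x)) (w b) (fun x => hw0 _)
    (fun x => hm _ (mem_compl.2 x.2)) (fun x => htop _ x.2 _ (mem_compl.1 hb))
    (by
      rw [Equiv.sum_comp e w, hcA]
      rw [hk] at hsum; push_cast at hsum; linarith)
  rw [← Pr_equiv (e.prodCongr (e.prodCongr e))]
  exact this

end

section

/-- The load of a tile `t` at a vertex: the first vertex of a tile is counted twice. -/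
def load {W : Type*} (t : W × W × W × W × W) (w : W) : ℝ :=
  2 * (if w = t.1 then 1 else 0) + (if w = t.2.1 then 1 else 0) + (if w = t.2.2.1 then 1 else 0) +
    (if w = t.2.2.2.1 then 1 else 0) + (if w = t.2.2.2.2 then 1 else 0)

/-- There is a fractional tiling of total weight at least `(1 - γ) |W|`. -/
def FracTiling {W : Type*} [Fintype W] (E : W → W → W → W → W → Prop) (γ : ℝ) : Prop :=
  ∃ y : W × W × W × W × W → ℝ, (∀ t, 0 ≤ y t) ∧
    (∀ t, ¬ E t.1 t.2.1 t.2.2.1 t.2.2.2.1 t.2.2.2.2 → y t = 0) ∧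
    (∀ w, ∑ t, y t * load t w ≤ 1) ∧ (1 - γ) * Fintype.card W ≤ 6 * ∑ t, y t

section
variable {W : Type*} [Fintype W]

lemma sum_mul_load (g : W → ℝ) (t : W × W × W × W × W) :
    ∑ w, g w * load t w =
      2 * g t.1 + g t.2.1 + g t.2.2.1 + g t.2.2.2.1 + g t.2.2.2.2 := by
  have : ∀ w, g w * load t w = 2 * (if w = t.1 then g w else 0) + (if w = t.2.1 then g w else 0) +
      (if w = t.2.2.1 then g w else 0) + (if w = t.2.2.2.1 then g w else 0) +
      (if w = t.2.2.2.2 then g w else 0) := by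
    intro w; unfold load; split_ifs <;> ring
  simp only [this, sum_add_distrib, ← mul_sum, sum_ite_eq', mem_univ, if_true]

/-- Linear programming duality for fractional tilings. -/
lemma exists_cover_of_not_fracTiling [Nonempty W] {E : W → W → W → W → W → Prop} {γ : ℝ}
    (hγ1 : γ < 1) (h : ¬ FracTiling E γ) :
    ∃ g : W → ℝ, (∀ w, 0 ≤ g w) ∧ 6 * ∑ w, g w ≤ (1 - γ) * Fintype.card W ∧
      ∀ x a b c d, E x a b c d → 1 ≤ 2 * g x + g a + g b + g c + g d := by
  set N : ℝ := (Fintype.card W : ℝ) with hN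
  have hNpos : 0 < N := by rw [hN]; exact_mod_cast Fintype.card_pos
  set lam : ℝ := 6 / ((1 - γ) * N) with hlam
  have hden : 0 < (1 - γ) * N := mul_pos (by linarith) hNpos
  have hl : 0 < lam := by positivity
  let T : Finset (W × W × W × W × W) :=
    univ.filter fun t => E t.1 t.2.1 t.2.2.1 t.2.2.2.1 t.2.2.2.2
  let s : Set (W → ℝ) := convexHull ℝ ((T.image load : Finset (W → ℝ)) : Set (W → ℝ))
  let B : Set (W → ℝ) := Set.Iic (fun _ => lam)
  have hdisj : Disjoint s B := by
    rw [Set.disjoint_left]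
    intro v hv hvB
    apply h
    rw [show s = convexHull ℝ (load '' (T : Set (W × W × W × W × W))) by simp [s]] at hv
    rw [show (load '' (T : Set (W × W × W × W × W))) =
      Set.range (fun t : T => load (t : W × W × W × W × W)) by ext; simp] at hv
    rw [convexHull_range_eq_exists_affineCombination] at hv
    obtain ⟨S, c, hc0, hc1, hv⟩ := hv
    rw [Finset.affineCombination_eq_linear_combination _ _ _ hc1] at hv
    refine ⟨fun t => ∑ i ∈ S, if (i : W × W × W × W × W) = t then c i / lam else 0, ?_, ?_, ?_, ?_⟩
    · intro t
      refine sum_nonneg fun i hi => ?_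
      split_ifs
      · exact div_nonneg (hc0 i hi) hl.le
      · exact le_rfl
    · intro t ht
      refine sum_eq_zero fun i hi => if_neg ?_
      rintro rfl
      exact ht (mem_filter.1 i.2).2
    · intro w
      have := hvB w
      rw [← hv] at this
      simp only [sum_mul]
      rw [sum_comm]
      simp only [ite_mul, zero_mul, sum_ite_eq, mem_univ, if_true]
      simp only [Finset.sum_apply, Pi.smul_apply, smul_eq_mul] at this
      calc ∑ i ∈ S, c i / lam * load (i : W × W × W × W × W) w
          = (∑ i ∈ S, c i * load (i : W × W × W × W × W) w) / lam := by
            rw [sum_div]; exact sum_congr rfl fun i _ => by ring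
        _ ≤ 1 := by rw [div_le_one hl]; exact this
    · rw [sum_comm]
      simp only [sum_ite_eq, mem_univ, if_true]
      rw [← sum_div, hc1, hlam]
      apply le_of_eq
      field_simp; rw [hN]
  have hcomp : IsCompact s := (Finset.finite_toSet _).isCompact_convexHull ℝ
  obtain ⟨f, u, v, h1, h2, h3⟩ := geometric_hahn_banach_compact_closed
    (convex_convexHull ℝ _) hcomp (convex_Iic _) (isClosed_Iic : IsClosed B) hdisj
  let g : W → ℝ := fun w => - f (Pi.single w 1)
  have hf : ∀ z : W → ℝ, f z = - ∑ w, g w * z w := by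
    intro z
    conv_lhs => rw [← Finset.univ_sum_single z]
    rw [map_sum, ← sum_neg_distrib]
    refine sum_congr rfl fun w _ => ?_
    have : (Pi.single w (z w) : W → ℝ) = z w • Pi.single w 1 := by
      rw [← Pi.single_smul]; simp
    rw [this, map_smul]; simp only [g, smul_eq_mul]; ring
  have hg : ∀ w, 0 ≤ g w := by
    intro w
    by_contra! hneg
    obtain ⟨M, hM0, hM⟩ : ∃ M : ℝ, 0 ≤ M ∧ M * g w ≤ v := by
      refine ⟨|v| / (-g w), by apply div_nonneg (abs_nonneg _); linarith, ?_⟩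
      have : |v| / (-g w) * g w = -|v| := by
        have : g w ≠ 0 := hneg.ne
        field_simp
      rw [this]; exact neg_abs_le v
    have := h3 (Pi.single w (-M)) (by
      intro x
      by_cases hx : x = w
      · subst hx; simp; linarith
      · simp [hx]; linarith)
    rw [hf] at this
    simp only [Pi.single_apply, mul_ite, mul_zero, sum_ite_eq', mem_univ, if_true] at this
    linarith
  have hs0 : 0 ≤ ∑ w, g w := sum_nonneg fun w _ => hg w
  have h4 := h3 (fun _ => lam) (fun _ => le_rfl)
  rw [hf, ← sum_mul] at h4
  have h5 : 0 ≤ (∑ w, g w) * lam := mul_nonneg hs0 hl.le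
  have hu : 0 < -u := by linarith
  refine ⟨fun w => g w / (-u), fun w => div_nonneg (hg w) hu.le, ?_, ?_⟩
  · rw [← sum_div, ← mul_div_assoc, div_le_iff₀ hu]
    have : (∑ w, g w) * lam ≤ -u := by linarith
    rw [hlam, ← mul_div_assoc, div_le_iff₀ hden] at this
    linarith
  · intro x a b c d he
    have := h1 (load (x, a, b, c, d)) (subset_convexHull ℝ _ (by
      simp only [coe_image, T]
      exact ⟨(x, a, b, c, d), by simpa using he, rfl⟩))
    rw [hf, sum_mul_load] at this
    simp only at this
    have e : 2 * (g x / -u) + g a / -u + g b / -u + g c / -u + g d / -u =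
      (2 * g x + g a + g b + g c + g d) / (-u) := by ring
    rw [e, le_div_iff₀ hu]; linarith

/-- If almost all pairs have degree above `91 / 216` then there is an almost perfect fractional
tiling. -/
theorem fracTiling_of_degree [Nonempty W] (h6 : 6 ∣ Fintype.card W)
    {E : W → W → W → W → W → Prop} {γ : ℝ} (hγ0 : 0 < γ) (hγ1 : γ < 1)
    (hN : 2 < γ * Fintype.card W)
    (hbad : Pr (fun p : W × W => ¬ 91 / 216 < Pr (fun t : W × W × W =>
      E p.1 p.2 t.1 t.2.1 t.2.2)) < γ ^ 2 / 4) : FracTiling E γ := by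
  by_contra hno
  obtain ⟨g, hg0, hgs, hg⟩ := exists_cover_of_not_fracTiling hγ1 hno
  set N : ℝ := (Fintype.card W : ℝ) with hNdef
  have hNpos : 0 < N := by rw [hNdef]; exact_mod_cast Fintype.card_pos
  set l := ⌈γ * N / 2⌉₊ with hl
  have hl1 : γ * N / 2 ≤ l := Nat.le_ceil _
  have hl2 : (l : ℝ) < γ * N := by
    have := Nat.ceil_lt_add_one (a := γ * N / 2) (by positivity)
    linarith
  have hlN : l ≤ Fintype.card W := by
    have : (l : ℝ) ≤ N := by nlinarith
    rw [hNdef] at this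
    exact_mod_cast this
  obtain ⟨L, hLc, hL⟩ := exists_top_set (fun w => - g w) l hlN
  have hLne : L.Nonempty := by
    rw [← card_pos, hLc]
    have : (0:ℝ) < l := by linarith [mul_pos hγ0 hNpos]
    exact_mod_cast this
  obtain ⟨m, hm, hmax⟩ := exists_max_image L g hLne
  set μ := g m with hμ
  have hout : ∀ b ∉ L, μ ≤ g b := fun b hb => by linarith [hL m hm b hb]
  have hμ0 : 0 ≤ μ := hg0 m
  have hcompl : ((Lᶜ).card : ℝ) = N - l := by
    rw [card_compl, hLc, Nat.cast_sub hlN]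
  have hmin : μ * (N - l) ≤ ∑ w, min (g w) μ := by
    rw [← hcompl, mul_comm, ← nsmul_eq_mul, ← sum_const]
    calc ∑ _x ∈ Lᶜ, μ ≤ ∑ x ∈ Lᶜ, min (g x) μ :=
          sum_le_sum fun x hx => le_min (hout x (mem_compl.1 hx)) le_rfl
      _ ≤ _ := sum_le_sum_of_subset_of_nonneg (subset_univ _) fun x _ _ => le_min (hg0 x) hμ0
  have hmin2 : ∑ w, min (g w) μ ≤ ∑ w, g w := sum_le_sum fun w _ => min_le_left _ _
  have hμ6 : 6 * μ < 1 := by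
    by_contra! hc
    nlinarith
  obtain ⟨u, hu, v, hv, huv⟩ : ∃ u ∈ L, ∃ v ∈ L, 91 / 216 < Pr (fun t : W × W × W =>
      E u v t.1 t.2.1 t.2.2) := by
    by_contra! hc
    have h1 : Pr (fun p : W × W => p ∈ L ×ˢ L) ≤ Pr (fun p : W × W => ¬ 91 / 216 <
        Pr (fun t : W × W × W => E p.1 p.2 t.1 t.2.1 t.2.2)) :=
      Pr_mono fun p hp => by
        rw [mem_product] at hp
        exact not_lt.2 (hc _ hp.1 _ hp.2)
    rw [Pr_mem, card_product, hLc, Fintype.card_prod] at h1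
    push_cast at h1
    rw [← hNdef] at h1
    have h2 : γ ^ 2 / 4 ≤ (l : ℝ) * l / (N * N) := by
      rw [le_div_iff₀ (by positivity)]
      calc γ ^ 2 / 4 * (N * N) = (γ * N / 2) * (γ * N / 2) := by ring
        _ ≤ _ := by gcongr
    linarith
  have hS := samuels h6 (fun w => (g w - min (g w) μ) / (1 - 6 * μ))
    (fun w => div_nonneg (by linarith [min_le_left (g w) μ]) (by linarith)) (by
      rw [← sum_div, ← mul_div_assoc, div_le_iff₀ (by linarith), sum_sub_distrib]
      nlinarith)
  refine absurd (huv.trans_le ((Pr_mono fun t ht => ?_).trans hS)) (lt_irrefl _)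
  have := hg _ _ _ _ _ ht
  rw [← add_div, ← add_div, le_div_iff₀ (by linarith)]
  linarith [hmax u hu, hmax v hv, min_le_right (g t.1) μ, min_le_right (g t.2.1) μ,
    min_le_right (g t.2.2) μ]

end

end

section

section
variable {X : Type*} [Finite X]

lemma Pr_pair [Nonempty X] {κ : Type*} [Finite κ] {i j : κ} (hij : i ≠ j) (F : X → X → Prop) :
    Pr (fun g : κ → X => F (g i) (g j)) = Pr (fun p : X × X => F p.1 p.2) := by
  have := Pr_comp_embedding (X := X) (ι := Bool) (κ := κ)
    ⟨fun b => if b then i else j, fun a b h => by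
      cases a <;> cases b <;> simp_all [eq_comm]⟩ (fun h => F (h true) (h false))
  refine Eq.trans this ?_
  refine Eq.trans ?_ (Pr_equiv (Equiv.boolArrowEquivProd X) (fun p => F p.2 p.1)) |>.trans ?_
  · rfl
  · exact Pr_swap (fun p : X × X => F p.1 p.2)

lemma Pr_pi {s : ℕ} (P : X → Prop) : Pr (fun x : Fin s → X => ∀ a, P (x a)) = Pr P ^ s := by
  cases nonempty_fintype X
  rw [Pr_eq, Pr_eq]
  have : (univ.filter fun x : Fin s → X => ∀ a, P (x a)) =
      Fintype.piFinset fun _ => univ.filter P := by ext; simp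
  rw [this, Fintype.card_piFinset]
  simp [div_pow]

variable [Nonempty X]

lemma Pr_eq_pair : Pr (fun p : X × X => p.1 = p.2) = 1 / Nat.card X := by
  cases nonempty_fintype X
  rw [Pr_prod, Nat.card_eq_fintype_card]
  refine Eq.trans ?_ (av_const (α := X) (1 / (Fintype.card X : ℝ)))
  congr 1; funext a
  rw [← Pr_eq_single a]
  exact Pr_congr fun b => eq_comm

lemma Pr_not_injective {κ : Type*} [Fintype κ] :
    Pr (fun g : κ → X => ¬ Function.Injective g) ≤ (Fintype.card κ : ℝ) ^ 2 / Nat.card X := by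
  calc _ ≤ Pr (fun g : κ → X => ∃ p : κ × κ, p.1 ≠ p.2 ∧ g p.1 = g p.2) :=
        Pr_mono fun g hg => by
          simp only [Function.Injective, not_forall] at hg
          obtain ⟨a, b, h, hne⟩ := hg
          exact ⟨(a, b), hne, h⟩
    _ ≤ ∑ p : κ × κ, Pr (fun g : κ → X => p.1 ≠ p.2 ∧ g p.1 = g p.2) :=
        Pr_exists_le _
    _ ≤ ∑ _p : κ × κ, (1 / Nat.card X : ℝ) := by
        refine sum_le_sum fun p _ => ?_
        by_cases h : p.1 = p.2
        · simp only [h, ne_eq, not_true, false_and]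
          unfold Pr; simp [av]
        · rw [← Pr_eq_pair (X := X), ← Pr_pair h]
          exact Pr_mono fun g hg => hg.2
    _ = _ := by simp; ring

lemma Pr_hit {κ : Type*} [Fintype κ] (S : Finset X) :
    Pr (fun g : κ → X => ∃ k, g k ∈ S) ≤ (Fintype.card κ : ℝ) * S.card / Nat.card X := by
  cases nonempty_fintype X
  calc _ ≤ ∑ k : κ, Pr (fun g : κ → X => g k ∈ S) := Pr_exists_le _
    _ = ∑ _k : κ, ((S.card : ℝ) / Nat.card X) := by
      refine sum_congr rfl fun k _ => ?_
      rw [Pr_apply k (fun x => x ∈ S), Pr_mem, Nat.card_eq_fintype_card]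
    _ = _ := by simp; ring

end

/-- Erdős' theorem: a dense `q`-partite-type relation contains a complete blow-up. -/
theorem exists_blowup (q s : ℕ) {δ : ℝ} (hδ : 0 < δ) : ∃ M₀ : ℕ, ∀ (X : Type) [Finite X],
    M₀ ≤ Nat.card X → ∀ R : (Fin q → X) → Prop, δ ≤ Pr R →
    ∃ h : Fin q → Fin s → X, (∀ i a j b, h i a = h j b → i = j ∧ a = b) ∧
      ∀ c : Fin q → Fin s, R fun i => h i (c i) := by
  induction q generalizing δ with
  | zero =>
    refine ⟨0, fun X _ _ R hR => ⟨fun i => i.elim0, fun i => i.elim0, fun c => ?_⟩⟩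
    obtain ⟨g, hg⟩ := exists_of_Pr_pos (hδ.trans_le hR)
    convert hg
  | succ q ih =>
    set δ' : ℝ := (δ / 2) * (δ / 2) ^ s with hδ'
    have hδ'0 : 0 < δ' := by positivity
    obtain ⟨M₁, hM₁⟩ := ih (δ := δ' / 4) (by positivity)
    obtain ⟨M₂, hM₂⟩ := exists_nat_gt ((4 * s ^ 2 + 4 * (q * s) : ℝ) / δ')
    refine ⟨max M₁ (M₂ + 1), fun X _ hX R hR => ?_⟩
    have hXne : Nonempty X := (Nat.card_pos_iff.1 (by omega)).1
    have hM : (0:ℝ) < Nat.card X := by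
      exact_mod_cast (show 0 < Nat.card X by omega)
    have hMb : (4 * s ^ 2 + 4 * (q * s) : ℝ) < δ' * Nat.card X := by
      rw [div_lt_iff₀ hδ'0] at hM₂
      have : (M₂ : ℝ) ≤ Nat.card X := by exact_mod_cast (by omega)
      nlinarith
    have h1 : δ ≤ Pr (fun p : (Fin q → X) × X => R (Fin.cons p.2 p.1)) := by
      have := Pr_equiv (Fin.consEquiv (fun _ : Fin (q + 1) => X)) R
      rw [← this, ← Pr_swap] at hR
      exact hR
    have h2 := Pr_fibre h1
    have h3 := Pr_prod_ge (Q := fun (g : Fin q → X) (x : Fin s → X) => ∀ a, R (Fin.cons (x a) g))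
      (d := (δ / 2) ^ s) (by positivity) h2 (fun g hg => by
        rw [Pr_pi (fun y => R (Fin.cons y g))]
        gcongr)
    have h4 : δ' ≤ Pr (fun p : (Fin s → X) × (Fin q → X) => ∀ a, R (Fin.cons (p.1 a) p.2)) := by
      rw [← Pr_swap]
      exact h3.trans (Pr_mono fun p hp => hp.2)
    have h5 := Pr_fibre h4
    have h6 := Pr_and_ge h5 (Q := fun x : Fin s → X => Function.Injective x)
      (d := (s : ℝ) ^ 2 / Nat.card X) (by
      have := Pr_not_injective (X := X) (κ := Fin s)
      rw [Fintype.card_fin] at this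
      exact this)
    have h7 : 0 < δ' / 2 - (s : ℝ) ^ 2 / Nat.card X := by
      rw [sub_pos, div_lt_iff₀ hM]
      have : (0:ℝ) ≤ q * s := by positivity
      nlinarith [sq_nonneg (s:ℝ)]
    obtain ⟨x, hx, hinj⟩ := exists_of_Pr_pos (h7.trans_le h6)
    have h8 := Pr_and_ge hx (Q := fun g : Fin q → X => ∀ k, g k ∉ univ.image x)
      (d := (q * s : ℝ) / Nat.card X) (by
        have := Pr_hit (κ := Fin q) (univ.image x)
        simp only [not_forall, not_not]
        refine this.trans ?_
        rw [Fintype.card_fin, card_image_of_injective _ hinj]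
        simp)
    have h9 : δ' / 4 ≤ δ' / 2 - (q * s : ℝ) / Nat.card X := by
      have : (q * s : ℝ) / Nat.card X ≤ δ' / 4 := by
        rw [div_le_iff₀ hM]; nlinarith [sq_nonneg (s:ℝ)]
      linarith
    obtain ⟨h, hhinj, hh⟩ := hM₁ X (by omega) _ (h9.trans h8)
    have hne : ∀ i a b, h i a ≠ x b := fun i a b he =>
      (hh (fun _ => a)).2 i (mem_image.2 ⟨b, mem_univ _, he.symm⟩)
    refine ⟨Fin.cons x h, ?_, ?_⟩
    · intro i a j b
      refine Fin.cases ?_ (fun i => ?_) i <;> refine Fin.cases ?_ (fun j => ?_) j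
      · simp only [Fin.cons_zero, true_and]; exact fun e => hinj e
      · simp only [Fin.cons_zero, Fin.cons_succ]; exact fun e => absurd e.symm (hne _ _ _)
      · simp only [Fin.cons_zero, Fin.cons_succ]; exact fun e => absurd e (hne _ _ _)
      · simp only [Fin.cons_succ, Fin.succ_inj]; exact hhinj i a j b
    · intro c
      have := (hh (fun i => c i.succ)).1 (c 0)
      convert this using 1
      funext i
      refine Fin.cases ?_ (fun i => ?_) i <;> simp

end

section

lemma av_sumArrow {ι κ X : Type*} [Finite ι] [Finite κ] [Finite X] (F : (ι → X) → (κ → X) → ℝ) :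
    av (fun h : ι ⊕ κ → X => F (fun i => h (Sum.inl i)) (fun k => h (Sum.inr k))) =
      av (fun x => av (fun y => F x y)) := by
  rw [← av_prod (fun p : (ι → X) × (κ → X) => F p.1 p.2),
    ← av_equiv (Equiv.sumArrowEquivProdArrow ι κ X)]
  rfl

lemma Pr_sumArrow {ι κ X : Type*} [Finite ι] [Finite κ] [Finite X] (F : (ι → X) → (κ → X) → Prop) :
    Pr (fun h : ι ⊕ κ → X => F (fun i => h (Sum.inl i)) (fun k => h (Sum.inr k))) =
      Pr (fun p : (ι → X) × (κ → X) => F p.1 p.2) := by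
  rw [← Pr_equiv (Equiv.sumArrowEquivProdArrow ι κ X)]
  rfl

lemma av_mul_self {α : Type*} [Finite α] (f : α → ℝ) :
    av f ^ 2 = av (fun a => av (fun b => f a * f b)) := by
  simp only [av_mul_left]
  rw [sq, ← av_mul_left]
  congr 1; funext a; ring

section
variable {X : Type*} [Finite X] [Nonempty X]

/-- Pointwise bound on the average of a bounded function which vanishes outside `P` on average. -/
lemma sampling_variance (φ : X → X → (Fin 3 → X) → ℝ) (hφ : ∀ x y z, |φ x y z| ≤ 1)
    (h0 : ∀ x y, av (φ x y) = 0) {q : ℕ} {i j : Fin q} (hij : i ≠ j) :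
    av (fun g : Fin q → X => av (fun k : Fin 3 → Fin q => φ (g i) (g j) (fun m => g (k m))) ^ 2)
      ≤ 48 / q := by
  have : Nonempty (Fin q) := ⟨i⟩
  simp only [av_mul_self]
  rw [av_comm]
  simp only [av_comm (A := Fin q → X)]
  let T : (Fin 3 → Fin q) → (Fin 3 → Fin q) → ℝ := fun k k' => av (fun g : Fin q → X =>
    φ (g i) (g j) (fun m => g (k m)) * φ (g i) (g j) (fun m => g (k' m)))
  change av (fun k => av (fun k' => T k k')) ≤ _
  rw [← av_sumArrow]
  let good : (Fin 3 ⊕ Fin 3 → Fin q) → Prop := fun K =>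
    Function.Injective K ∧ ¬ ∃ s, K s ∈ ({i, j} : Finset (Fin q))
  have key : ∀ K : Fin 3 ⊕ Fin 3 → Fin q,
      T (fun s => K (Sum.inl s)) (fun s => K (Sum.inr s)) ≤ if ¬ good K then 1 else 0 := by
    intro K
    by_cases hK : ¬ good K
    · rw [if_pos hK]
      refine av_le_of_le fun g => ?_
      have := hφ (g i) (g j) (fun m => g (K (Sum.inl m)))
      have := hφ (g i) (g j) (fun m => g (K (Sum.inr m)))
      refine (le_abs_self _).trans ?_
      rw [abs_mul]
      exact mul_le_one₀ (hφ _ _ _) (abs_nonneg _) (hφ _ _ _)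
    · rw [if_neg hK]
      rw [not_not] at hK
      obtain ⟨hinj, hno⟩ := hK
      push Not at hno
      have hi : ∀ s, K s ≠ i := fun s e => hno s (by simp [e])
      have hj : ∀ s, K s ≠ j := fun s e => hno s (by simp [e])
      let e : Bool ⊕ (Fin 3 ⊕ Fin 3) ↪ Fin q :=
        ⟨Sum.elim (fun b => if b then i else j) K, by
          rintro (a | a) (b | b) h
          · cases a <;> cases b <;> simp_all [eq_comm]
          · cases a
            · exact absurd h.symm (hj b)
            · exact absurd h.symm (hi b)
          · cases b
            · exact absurd h (hj a)
            · exact absurd h (hi a)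
          · simpa using hinj h⟩
      have h1 := av_comp_embedding e (fun h : Bool ⊕ (Fin 3 ⊕ Fin 3) → X =>
        φ (h (Sum.inl true)) (h (Sum.inl false)) (fun m => h (Sum.inr (Sum.inl m))) *
        φ (h (Sum.inl true)) (h (Sum.inl false)) (fun m => h (Sum.inr (Sum.inr m))))
      refine le_of_eq (h1.trans ?_)
      rw [av_sumArrow (fun (p : Bool → X) (z : Fin 3 ⊕ Fin 3 → X) =>
        φ (p true) (p false) (fun m => z (Sum.inl m)) *
        φ (p true) (p false) (fun m => z (Sum.inr m)))]
      refine Eq.trans ?_ (av_const (α := Bool → X) 0)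
      congr 1; funext p
      rw [av_sumArrow (fun z z' => φ (p true) (p false) z * φ (p true) (p false) z'),
        ← av_mul_self, h0]
      simp
  refine (av_mono key).trans ?_
  have e : av (fun K => if ¬ good K then (1:ℝ) else 0) = Pr (fun K => ¬ good K) := by
    unfold Pr; congr 1; funext K; congr
  rw [e]
  refine (Pr_le_add (Q := fun K : Fin 3 ⊕ Fin 3 → Fin q => ¬ Function.Injective K)
    (R := fun K => ∃ s, K s ∈ ({i, j} : Finset (Fin q))) fun K hK => ?_).trans ?_
  · by_cases h : Function.Injective K
    · right; by_contra h'; exact hK ⟨h, h'⟩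
    · exact Or.inl h
  · refine (add_le_add Pr_not_injective (Pr_hit _)).trans ?_
    rw [card_pair hij]
    simp only [Fintype.card_sum, Fintype.card_fin, Nat.card_eq_fintype_card]
    rw [← add_div]
    gcongr; norm_num

/-- Chebyshev's inequality. -/
lemma chebyshev {α : Type*} [Finite α] (f : α → ℝ) {θ c : ℝ} (hθ : 0 < θ)
    (h : av (fun a => f a ^ 2) ≤ c) : Pr (fun a => f a ≤ -θ) ≤ c / θ ^ 2 := by
  rw [le_div_iff₀ (by positivity), mul_comm]
  refine le_trans ?_ ((markov (fun a => sq_nonneg (f a)) (θ ^ 2)).trans h)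
  gcongr
  refine Pr_mono fun a ha => ?_
  nlinarith

/-- The structure induced on sampled supervertices. -/
def Samp {V : Type*} {b q : ℕ} (E : V → V → V → V → V → Prop) (σ : X × Fin b → V) (g : Fin q → X) :
    Fin q × Fin b → Fin q × Fin b → Fin q × Fin b → Fin q × Fin b → Fin q × Fin b → Prop :=
  fun t1 t2 t3 t4 t5 => [t1.1, t2.1, t3.1, t4.1, t5.1].Nodup ∧
    E (σ (g t1.1, t1.2)) (σ (g t2.1, t2.2)) (σ (g t3.1, t3.2)) (σ (g t4.1, t4.2)) (σ (g t5.1, t5.2))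

/-- Triples of pairs as pairs of triples. -/
def tripleEquiv (A B : Type*) : ((A × B) × (A × B) × (A × B)) ≃ (Fin 3 → A) × (Fin 3 → B) where
  toFun t := (![t.1.1, t.2.1.1, t.2.2.1], ![t.1.2, t.2.1.2, t.2.2.2])
  invFun p := ((p.1 0, p.2 0), (p.1 1, p.2 1), (p.1 2, p.2 2))
  left_inv t := rfl
  right_inv p := by
    ext i
    · fin_cases i <;> rfl
    · fin_cases i <;> rfl

lemma sampling_pair {V : Type*} {b q : ℕ} (hb : 0 < b) {E : V → V → V → V → V → Prop}
    {σ : X × Fin b → V} {η : ℝ} (hη : 0 < η) (hq : 30 < η * q)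
    (hdeg : ∀ x y, x ≠ y → ∀ a a', 91 / 216 + η ≤ Pr (fun t : (X × Fin b) × (X × Fin b) × (X × Fin b) =>
      E (σ (x, a)) (σ (y, a')) (σ t.1) (σ t.2.1) (σ t.2.2)))
    {i j : Fin q} (hij : i ≠ j) (a a' : Fin b) :
    Pr (fun g : Fin q → X => ¬ 91 / 216 < Pr (fun t : (Fin q × Fin b) × (Fin q × Fin b) × (Fin q × Fin b) =>
      Samp E σ g (i, a) (j, a') t.1 t.2.1 t.2.2)) ≤ 1 / Nat.card X + 192 / (η ^ 2 * q) := by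
  have : Nonempty (Fin q) := ⟨i⟩
  have : Nonempty (Fin b) := ⟨a⟩
  have hq0 : (0:ℝ) < q := by exact_mod_cast i.pos
  let F : X → X → (Fin 3 → X) → ℝ := fun x y z => Pr (fun c : Fin 3 → Fin b =>
    E (σ (x, a)) (σ (y, a')) (σ (z 0, c 0)) (σ (z 1, c 1)) (σ (z 2, c 2)))
  have hF0 : ∀ x y z, 0 ≤ F x y z := fun x y z => Pr_nonneg _
  have hF1 : ∀ x y z, F x y z ≤ 1 := fun x y z => Pr_le_one _
  have hd : ∀ x y, x ≠ y → 91 / 216 + η ≤ av (F x y) := by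
    intro x y hxy
    refine (hdeg x y hxy a a').trans_eq ?_
    rw [← Pr_equiv (tripleEquiv X (Fin b)).symm, Pr_prod]
    rfl
  have hc := chebyshev (fun g : Fin q → X => av (fun k : Fin 3 → Fin q =>
    (fun x y z => F x y z - av (F x y)) (g i) (g j) (fun m => g (k m)))) (θ := η / 2) (by positivity)
    (sampling_variance (fun x y z => F x y z - av (F x y)) (fun x y z => by
      rw [abs_le]
      have h1 : 0 ≤ av (F x y) := av_nonneg (hF0 x y)
      have h2 : av (F x y) ≤ 1 := av_le_of_le (hF1 x y)
      constructor <;> linarith [hF0 x y z, hF1 x y z])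
      (fun x y => by rw [av_sub, av_const]; ring) hij)
  refine (Pr_le_add (Q := fun g : Fin q → X => g i = g j) (R := _) (fun g hg => ?_)).trans
    (add_le_add ?_ (hc.trans_eq ?_))
  · by_cases hgij : g i = g j
    · exact Or.inl hgij
    right
    simp only
    rw [av_sub, av_const]
    rw [not_lt] at hg
    have h1 : av (fun k : Fin 3 → Fin q => F (g i) (g j) (fun m => g (k m))) ≤
        Pr (fun t : (Fin q × Fin b) × (Fin q × Fin b) × (Fin q × Fin b) =>
          Samp E σ g (i, a) (j, a') t.1 t.2.1 t.2.2) + 15 / q := by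
      rw [← Pr_equiv (tripleEquiv (Fin q) (Fin b)).symm]
      have e1 : av (fun k : Fin 3 → Fin q => F (g i) (g j) (fun m => g (k m))) =
          Pr (fun p : (Fin 3 → Fin q) × (Fin 3 → Fin b) => E (σ (g i, a)) (σ (g j, a'))
            (σ (g (p.1 0), p.2 0)) (σ (g (p.1 1), p.2 1)) (σ (g (p.1 2), p.2 2))) := by
        rw [Pr_prod]
      rw [e1]
      refine (Pr_le_add (R := fun p : (Fin 3 → Fin q) × (Fin 3 → Fin b) => ¬ Function.Injective p.1 ∨
        ∃ s, p.1 s ∈ ({i, j} : Finset (Fin q))) fun p hp => ?_).trans (add_le_add_right ?_ _)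
      · by_cases h : ¬ Function.Injective p.1 ∨ ∃ s, p.1 s ∈ ({i, j} : Finset (Fin q))
        · exact Or.inr h
        · left
          push Not at h
          obtain ⟨hi, hn⟩ := h
          have n0 := hn 0
          have n1 := hn 1
          have n2 := hn 2
          have i1 := hi.ne (show (0 : Fin 3) ≠ 1 by decide)
          have i2 := hi.ne (show (0 : Fin 3) ≠ 2 by decide)
          have i3 := hi.ne (show (1 : Fin 3) ≠ 2 by decide)
          simp only [mem_insert, mem_singleton, not_or] at n0 n1 n2
          refine ⟨?_, hp⟩
          change [i, j, p.1 0, p.1 1, p.1 2].Nodup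
          simp [hij, i1, i2, i3, Ne.symm n0.1, Ne.symm n0.2, Ne.symm n1.1, Ne.symm n1.2,
            Ne.symm n2.1, Ne.symm n2.2]
      · rw [Pr_fst (β := Fin 3 → Fin b) (fun k : Fin 3 → Fin q => ¬ Function.Injective k ∨
          ∃ s, k s ∈ ({i, j} : Finset (Fin q)))]
        refine (Pr_le_add fun k hk => hk).trans ((add_le_add Pr_not_injective (Pr_hit _)).trans ?_)
        rw [card_pair hij]
        simp only [Fintype.card_fin, Nat.card_eq_fintype_card]
        rw [← add_div]
        gcongr; norm_num
    have h2 := hd (g i) (g j) hgij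
    have h3 : 15 / (q : ℝ) ≤ η / 2 := by
      rw [div_le_iff₀ hq0]; linarith
    linarith
  · rw [Pr_pair hij (fun x y => x = y), Pr_eq_pair]
  · field_simp; norm_num

/-- Most samples of supervertices have almost all pair degrees above the threshold. -/
theorem sampling {V : Type*} {b q : ℕ} (hb : 0 < b) {E : V → V → V → V → V → Prop}
    {σ : X × Fin b → V} {η δ : ℝ} (hη : 0 < η) (hq : 30 < η * q)
    (hdeg : ∀ x y, x ≠ y → ∀ a a', 91 / 216 + η ≤ Pr (fun t : (X × Fin b) × (X × Fin b) × (X × Fin b) =>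
      E (σ (x, a)) (σ (y, a')) (σ t.1) (σ t.2.1) (σ t.2.2))) :
    δ * Pr (fun g : Fin q → X => δ ≤ Pr (fun p : (Fin q × Fin b) × (Fin q × Fin b) =>
      ¬ 91 / 216 < Pr (fun t : (Fin q × Fin b) × (Fin q × Fin b) × (Fin q × Fin b) =>
      Samp E σ g p.1 p.2 t.1 t.2.1 t.2.2))) ≤ 1 / q + (1 / Nat.card X + 192 / (η ^ 2 * q)) := by
  have hq0 : 0 < q := by
    rcases Nat.eq_zero_or_pos q with h | h
    · subst h; simp at hq; linarith
    · exact h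
  have : Nonempty (Fin q) := ⟨⟨0, hq0⟩⟩
  have : Nonempty (Fin b) := ⟨⟨0, hb⟩⟩
  let bad : (Fin q → X) → (Fin q × Fin b) × (Fin q × Fin b) → Prop := fun g p =>
    ¬ 91 / 216 < Pr (fun t : (Fin q × Fin b) × (Fin q × Fin b) × (Fin q × Fin b) =>
      Samp E σ g p.1 p.2 t.1 t.2.1 t.2.2)
  refine (markov (f := fun g => Pr (bad g)) (fun g => Pr_nonneg _) δ).trans ?_
  have e : av (fun g => Pr (bad g)) = av (fun p => Pr (fun g => bad g p)) := av_comm _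
  rw [e]
  set ε := 1 / (Nat.card X : ℝ) + 192 / (η ^ 2 * q) with hε
  have hε0 : 0 ≤ ε := by positivity
  refine (av_mono (g := fun p : (Fin q × Fin b) × (Fin q × Fin b) =>
    (if p.1.1 = p.2.1 then (1:ℝ) else 0) + ε) fun p => ?_).trans ?_
  · by_cases h : p.1.1 = p.2.1
    · rw [if_pos h]; linarith [Pr_le_one (fun g => bad g p)]
    · rw [if_neg h, zero_add]
      exact sampling_pair hb hη hq hdeg h _ _
  · rw [av_add, av_const]
    refine add_le_add_left (le_of_eq ?_) _
    refine Eq.trans (b := Pr (fun p : (Fin q × Fin b) × (Fin q × Fin b) => p.1.1 = p.2.1))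
      (by unfold Pr; congr 1; funext p; congr) ?_
    rw [← Pr_equiv (Equiv.prodProdProdComm (Fin q) (Fin q) (Fin b) (Fin b))]
    refine (Pr_fst (β := Fin b × Fin b) (fun p : Fin q × Fin q => p.1 = p.2)).trans ?_
    rw [Pr_eq_pair, Nat.card_eq_fintype_card, Fintype.card_fin]

end

end

section

/-- Symmetric 5-ary relations whose related entries are distinct, i.e. 5-graphs. -/
structure Sym5 {V : Type*} (E : V → V → V → V → V → Prop) : Prop where
  s1 : ∀ {a b c d e}, E a b c d e → E b a c d e
  s2 : ∀ {a b c d e}, E a b c d e → E a c b d e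
  s3 : ∀ {a b c d e}, E a b c d e → E a b d c e
  s4 : ∀ {a b c d e}, E a b c d e → E a b c e d
  ne : ∀ {a b c d e}, E a b c d e → a ≠ b

/-- There is a 2-path from the pair `p` to the pair `q` with list of internal vertices `L`. -/
inductive Conn {V : Type*} (E : V → V → V → V → V → Prop) : V × V → V × V → List V → Prop
  | edge {p q : V × V} {s : V} : E p.1 p.2 s q.1 q.2 → Conn E p q [s]
  | step {p q r : V × V} {s : V} {L : List V} : E p.1 p.2 s r.1 r.2 → Conn E r q L →
      Conn E p q (s :: r.1 :: r.2 :: L)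

/-- The vertices of a path with ends `p`, `q` and internal vertices `L`. -/
def verts {V : Type*} (p q : V × V) (L : List V) : List V := p.1 :: p.2 :: q.1 :: q.2 :: L

section
variable {V : Type*} {E : V → V → V → V → V → Prop}

lemma Conn.append {p r q : V × V} {L₁ L₂ : List V} (h₁ : Conn E p r L₁) (h₂ : Conn E r q L₂) :
    Conn E p q (L₁ ++ r.1 :: r.2 :: L₂) := by
  induction h₁ with
  | edge h => exact Conn.step h h₂
  | step h _ ih => exact Conn.step h (ih h₂)

lemma Conn.length {p q : V × V} {L : List V} (h : Conn E p q L) : L.length % 3 = 1 := by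
  induction h with
  | edge h => rfl
  | step h _ ih => simp only [List.length_cons]; omega

lemma Conn.mono {E' : V → V → V → V → V → Prop} (hE : ∀ a b c d e, E a b c d e → E' a b c d e)
    {p q : V × V} {L : List V} (h : Conn E p q L) : Conn E' p q L := by
  induction h with
  | edge h => exact Conn.edge (hE _ _ _ _ _ h)
  | step h _ ih => exact Conn.step (hE _ _ _ _ _ h) ih

/-- The image of a path. -/
lemma Conn.map {U : Type*} {F : U → U → U → U → U → Prop} (f : U → V)
    (hE : ∀ a b c d e, F a b c d e → E (f a) (f b) (f c) (f d) (f e))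
    {p q : U × U} {L : List U} (h : Conn F p q L) :
    Conn E (f p.1, f p.2) (f q.1, f q.2) (L.map f) := by
  induction h with
  | edge h => exact Conn.edge (hE _ _ _ _ _ h)
  | @step p q r s L h _ ih => exact Conn.step (r := (f r.1, f r.2)) (hE _ _ _ _ _ h) ih

/-- `S` is the vertex set of a path. -/
def IsPathSet (E : V → V → V → V → V → Prop) (S : Finset V) : Prop :=
  ∃ p q L, Conn E p q L ∧ (verts p q L).Nodup ∧ (verts p q L).toFinset = S

/-- The vertices used by the path in a blow-up of an edge with six classes of size `t + 1`. -/
def blockIdx : ℕ → List (Fin 6 × ℕ)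
  | 0 => [(0, 0), (1, 0), (2, 0), (3, 0), (4, 0)]
  | t + 1 => (5, t) :: (0, t + 1) :: (1, t + 1) :: (2, t + 1) :: (3, t + 1) :: (4, t + 1) :: blockIdx t

lemma blockIdx_length (t : ℕ) : (blockIdx t).length = 6 * t + 5 := by
  induction t with
  | zero => rfl
  | succ t ih => simp only [blockIdx, List.length_cons, ih]; omega

lemma blockIdx_le (t : ℕ) : ∀ x ∈ blockIdx t, x.2 ≤ t ∧ (x.1 = 5 → x.2 < t) := by
  induction t with
  | zero => simp [blockIdx]
  | succ t ih =>
    intro x hx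
    simp only [blockIdx, List.mem_cons] at hx
    rcases hx with rfl | rfl | rfl | rfl | rfl | rfl | hx
    · simp
    any_goals exact ⟨le_rfl, fun h => absurd h (by simp)⟩
    · have := ih x hx
      exact ⟨by omega, fun h => by have := this.2 h; omega⟩

lemma blockIdx_nodup (t : ℕ) : (blockIdx t).Nodup := by
  induction t with
  | zero => simp [blockIdx]
  | succ t ih =>
    have h1 : ∀ r : Fin 6, (r, t + 1) ∉ blockIdx t := fun r h => by
      have := (blockIdx_le t _ h).1; simp at this
    have h2 : ((5 : Fin 6), t) ∉ blockIdx t := fun h => by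
      have := (blockIdx_le t _ h).2 rfl; simp at this
    simp only [blockIdx, List.nodup_cons, List.mem_cons, not_or, h1, h2, ih]
    simp

lemma block_path (hE : Sym5 E) (t : ℕ) (v : Fin 6 → ℕ → V)
    (h4 : ∀ i j k l m, i ≤ t → j ≤ t → k ≤ t → l ≤ t → m ≤ t →
      E (v 4 m) (v 0 i) (v 1 j) (v 2 k) (v 3 l))
    (h5 : ∀ i j k l m, i ≤ t → j ≤ t → k ≤ t → l ≤ t → m ≤ t →
      E (v 5 m) (v 0 i) (v 1 j) (v 2 k) (v 3 l)) :
    ∃ L, Conn E (v 0 0, v 1 0) (v 2 t, v 3 t) L ∧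
      (verts (v 0 0, v 1 0) (v 2 t, v 3 t) L).Perm ((blockIdx t).map fun x => v x.1 x.2) := by
  induction t with
  | zero =>
    refine ⟨[v 4 0], Conn.edge (hE.s2 (hE.s1 (h4 0 0 0 0 0 le_rfl le_rfl le_rfl le_rfl le_rfl))), ?_⟩
    simp [verts, blockIdx]
  | succ t ih =>
    obtain ⟨L, hL, hp⟩ := ih
      (fun i j k l m hi hj hk hl hm => h4 i j k l m (by omega) (by omega) (by omega) (by omega) (by omega))
      (fun i j k l m hi hj hk hl hm => h5 i j k l m (by omega) (by omega) (by omega) (by omega) (by omega))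
    refine ⟨_, hL.append (Conn.step (r := (v 0 (t+1), v 1 (t+1))) (s := v 5 t) ?_
      (Conn.edge (s := v 4 (t+1)) ?_)), ?_⟩
    · have := h5 (t+1) (t+1) t t t le_rfl le_rfl (by omega) (by omega) (by omega)
      -- move `v 5` and the first pair
      have := hE.s2 (hE.s1 this)
      have := hE.s3 this
      have := hE.s2 this
      have := hE.s1 this
      have := hE.s4 this
      have := hE.s3 this
      have := hE.s2 this
      exact hE.s3 (hE.s4 this)
    · exact hE.s2 (hE.s1 (h4 _ _ _ _ _ le_rfl le_rfl le_rfl le_rfl le_rfl))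
    · rw [← Multiset.coe_eq_coe] at hp ⊢
      simp only [verts, blockIdx, List.map_cons, ← Multiset.cons_coe, ← Multiset.coe_add,
        ← Multiset.singleton_add, Multiset.coe_singleton, ← hp, Multiset.coe_nil] at hp ⊢
      abel_nf

end

end

/-- The vertex of a tile playing the role of the `ρ`-th class of a blow-up. -/
def tileVert {W : Type*} (t : W × W × W × W × W) : Fin 6 → W :=
  ![t.2.1, t.2.2.1, t.2.2.2.1, t.2.2.2.2, t.1, t.1]

lemma sum_tileVert {W : Type*} (t : W × W × W × W × W) (w : W) :
    ∑ ρ, (if tileVert t ρ = w then (1:ℝ) else 0) = load t w := by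
  let φ : W → ℝ := fun u => if u = w then 1 else 0
  have hφ : ∀ u, (if w = u then (1:ℝ) else 0) = φ u := fun u => by
    simp only [φ]; split_ifs <;> simp_all
  unfold load
  simp only [hφ]
  change ∑ ρ, φ (tileVert t ρ) = _
  rw [Fin.sum_univ_six]
  change φ t.2.1 + φ t.2.2.1 + φ t.2.2.2.1 + φ t.2.2.2.2 + φ t.1 + φ t.1 = _
  ring

/-- An assignment of positions which is injective on the fibres of `f`. -/
lemma exists_position {α W : Type*} [Fintype α] (f : α → W) (s : ℕ)
    (h : ∀ w, (univ.filter fun a => f a = w).card ≤ s) :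
    ∃ pos : α → Fin s, ∀ a b, f a = f b → pos a = pos b → a = b := by
  have : ∀ w, Nonempty ({a // f a = w} ↪ Fin s) := fun w => by
    apply Function.Embedding.nonempty_of_card_le
    rw [Fintype.card_subtype, Fintype.card_fin]; exact h w
  let e := fun w => (this w).some
  refine ⟨fun a => e (f a) ⟨a, rfl⟩, fun a b hab hp => ?_⟩
  have h2 : e (f a) ⟨a, rfl⟩ = e (f a) ⟨b, hab.symm⟩ := by
    have h3 : ∀ w (hw : f b = w), e (f b) ⟨b, rfl⟩ = e w ⟨b, hw⟩ := fun w hw => by subst hw; rfl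
    exact Eq.trans (show _ = e (f b) ⟨b, rfl⟩ from hp) (h3 _ _)
  exact congrArg Subtype.val ((e (f a)).injective h2)

/-- A blow-up of a fractional tiling contains many disjoint paths of a fixed length. -/
theorem exists_packing {V W : Type*} [Fintype W] {E : V → V → V → V → V → Prop}
    {F : W → W → W → W → W → Prop} (hE : Sym5 E) {γ : ℝ} (hF : FracTiling F γ) {s : ℕ}
    (x : W → Fin s → V) (hx : ∀ w a w' a', x w a = x w' a' → w = w' ∧ a = a')
    (hxE : ∀ w₁ w₂ w₃ w₄ w₅, F w₁ w₂ w₃ w₄ w₅ → ∀ c₁ c₂ c₃ c₄ c₅,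
      E (x w₁ c₁) (x w₂ c₂) (x w₃ c₃) (x w₄ c₄) (x w₅ c₅)) (t : ℕ) :
    ∃ Q : Finset (Finset V), (∀ S ∈ Q, IsPathSet E S ∧ S.card = 6 * t + 5 ∧
      ∀ v ∈ S, ∃ w a, v = x w a) ∧ (∀ S ∈ Q, ∀ T ∈ Q, S ≠ T → Disjoint S T) ∧
      (1 - γ) * Fintype.card W * s / (6 * (t + 1)) - (Fintype.card W : ℝ) ^ 5 ≤ Q.card := by
  obtain ⟨y, hy0, hyE, hyl, hyt⟩ := hF
  let z : W × W × W × W × W → ℕ := fun τ => ⌊y τ * s / (t + 1)⌋₊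
  let Slot := Σ τ : W × W × W × W × W, Fin (z τ) × Fin 6 × Fin (t + 1)
  let cls : Slot → W := fun a => tileVert a.1 a.2.2.1
  have hfib : ∀ w, (univ.filter fun a : Slot => cls a = w).card ≤ s := by
    intro w
    have h1 : ((univ.filter fun a : Slot => cls a = w).card : ℝ) =
        ∑ τ, (z τ : ℝ) * (t + 1) * load τ w := by
      rw [card_filter, Nat.cast_sum]
      simp only [Nat.cast_ite, Nat.cast_one, Nat.cast_zero]
      let φ : W → ℝ := fun u => if u = w then 1 else 0
      refine (Fintype.sum_sigma (α := fun τ => Fin (z τ) × Fin 6 × Fin (t + 1))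
        (fun a => φ (cls a))).trans ?_
      refine sum_congr rfl fun τ _ => ?_
      have hl : ∑ ρ, φ (tileVert τ ρ) = load τ w := sum_tileVert τ w
      rw [← hl]
      simp only [Fintype.sum_prod_type, cls, sum_const, card_univ, Fintype.card_fin, nsmul_eq_mul,
        mul_sum (s := (univ : Finset (Fin 6)))]
      push_cast
      exact sum_congr rfl fun ρ _ => by ring
    have h2 : ((univ.filter fun a : Slot => cls a = w).card : ℝ) ≤ s := by
      rw [h1]
      calc _ ≤ ∑ τ, (y τ * load τ w) * s := by
            refine sum_le_sum fun τ _ => ?_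
            have hz : (z τ : ℝ) ≤ y τ * s / (t + 1) :=
              Nat.floor_le (div_nonneg (mul_nonneg (hy0 _) (Nat.cast_nonneg _)) (by positivity))
            rw [le_div_iff₀ (by positivity)] at hz
            have hl : 0 ≤ load τ w := by unfold load; positivity
            nlinarith
        _ ≤ s := by
            rw [← sum_mul]
            exact mul_le_of_le_one_left (Nat.cast_nonneg _) (hyl w)
    exact_mod_cast h2
  obtain ⟨pos, hpos⟩ := exists_position cls s hfib
  let vtx : Slot → V := fun a => x (cls a) (pos a)
  have hinj : Function.Injective vtx := fun a b h => by
    obtain ⟨h1, h2⟩ := hx _ _ _ _ h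
    exact hpos a b h1 h2
  let Blk := Σ τ : W × W × W × W × W, Fin (z τ)
  let v : Blk → Fin 6 → ℕ → V := fun B ρ m => vtx ⟨B.1, B.2, ρ, ⟨min m t, by omega⟩⟩
  have hF : ∀ B : Blk, F B.1.1 B.1.2.1 B.1.2.2.1 B.1.2.2.2.1 B.1.2.2.2.2 := by
    intro B
    by_contra h
    have := hyE _ h
    have hz : z B.1 = 0 := by simp [z, this]
    exact (hz ▸ B.2 : Fin 0).elim0
  let bs : Blk → Finset V := fun B => ((blockIdx t).map fun p => v B p.1 p.2).toFinset
  have hmem : ∀ B a, a ∈ bs B → ∃ ρ m, a = vtx ⟨B.1, B.2, ρ, m⟩ := by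
    intro B a ha
    simp only [bs, List.mem_toFinset, List.mem_map] at ha
    obtain ⟨p, hp, rfl⟩ := ha
    exact ⟨_, _, rfl⟩
  have hnd : ∀ B, ((blockIdx t).map fun p => v B p.1 p.2).Nodup := by
    intro B
    refine (List.nodup_map_iff_inj_on (blockIdx_nodup t)).2 fun p hp p' hp' h => ?_
    have := hinj h
    have h1 := (blockIdx_le t p hp).1
    have h2 := (blockIdx_le t p' hp').1
    have : (p.1, (⟨min p.2 t, by omega⟩ : Fin (t + 1))) = (p'.1, ⟨min p'.2 t, by omega⟩) :=
      (Prod.ext_iff.1 (eq_of_heq (Sigma.mk.inj this).2)).2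
    simp only [Prod.mk.injEq, Fin.mk.injEq] at this
    rw [min_eq_left h1, min_eq_left h2] at this
    exact Prod.ext this.1 this.2
  have hcard : ∀ B, (bs B).card = 6 * t + 5 := fun B => by
    rw [List.toFinset_card_of_nodup (hnd B), List.length_map, blockIdx_length]
  have hdisj : ∀ B B', B ≠ B' → Disjoint (bs B) (bs B') := by
    intro B B' hne
    rw [Finset.disjoint_left]
    intro a ha ha'
    obtain ⟨ρ, m, rfl⟩ := hmem _ _ ha
    obtain ⟨ρ', m', h⟩ := hmem _ _ ha'
    have := hinj h
    apply hne
    rcases B with ⟨τ, j⟩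
    rcases B' with ⟨τ', j'⟩
    obtain ⟨h1, h2⟩ := Sigma.mk.inj this
    obtain rfl : τ = τ' := h1
    have h3 := eq_of_heq h2
    have h4 : j = j' := congrArg Prod.fst h3
    rw [h4]
  have hpath : ∀ B, IsPathSet E (bs B) := by
    intro B
    obtain ⟨L, hL, hp⟩ := block_path hE t (v B)
      (fun i j k l m _ _ _ _ _ => hxE _ _ _ _ _ (hF B) _ _ _ _ _)
      (fun i j k l m _ _ _ _ _ => hxE _ _ _ _ _ (hF B) _ _ _ _ _)
    exact ⟨_, _, L, hL, hp.nodup_iff.2 (hnd B), List.toFinset_eq_of_perm _ _ hp⟩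
  have hbinj : Function.Injective bs := by
    intro B B' h
    by_contra hne
    have := hdisj _ _ hne
    rw [h, disjoint_self, Finset.bot_eq_empty] at this
    have h2 := hcard B'
    rw [this] at h2
    simp at h2
  refine ⟨univ.image bs, ?_, ?_, ?_⟩
  · simp only [mem_image, mem_univ, true_and, forall_exists_index, forall_apply_eq_imp_iff]
    refine fun B => ⟨hpath B, hcard B, fun a ha => ?_⟩
    obtain ⟨ρ, m, rfl⟩ := hmem _ _ ha
    exact ⟨_, _, rfl⟩
  · simp only [mem_image, mem_univ, true_and, forall_exists_index, forall_apply_eq_imp_iff]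
    exact fun B B' h => hdisj _ _ fun e => h (by rw [e])
  · rw [card_image_of_injective _ hbinj, card_univ, Fintype.card_sigma]
    push_cast
    simp only [Fintype.card_fin]
    have hz : ∀ τ, y τ * s / (t + 1) - 1 ≤ z τ := fun τ => (Nat.sub_one_lt_floor _).le
    calc _ ≤ ∑ τ : W × W × W × W × W, (y τ * s / (t + 1) - 1) := by
          rw [sum_sub_distrib, ← sum_div, ← sum_mul]
          simp only [sum_const, card_univ, Fintype.card_prod, nsmul_eq_mul, mul_one]
          push_cast
          have : (1 - γ) * Fintype.card W * s / (6 * (t + 1)) ≤ (∑ τ, y τ) * s / (t + 1) := by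
            rw [div_le_div_iff₀ (by positivity) (by positivity)]
            have : (0:ℝ) ≤ s * (t + 1) := by positivity
            nlinarith
          nlinarith
      _ ≤ _ := sum_le_sum fun τ _ => hz τ

section

section
variable {A B : Type*} [Finite A] [Finite B]

lemma Pr_le_of_injective {σ : A → B} (hσ : Function.Injective σ) (P : B → Prop) :
    Pr P ≤ Pr (fun a => P (σ a)) + Pr (fun b => b ∉ Set.range σ) := by
  cases nonempty_fintype A
  cases nonempty_fintype B
  refine (Pr_le_add (Q := fun b => b ∈ Set.range σ ∧ P b) (R := fun b => b ∉ Set.range σ)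
    fun b hb => by tauto).trans ?_
  gcongr
  rw [Pr_eq, Pr_eq]
  have h1 : (univ.filter fun b => b ∈ Set.range σ ∧ P b) = (univ.filter fun a => P (σ a)).image σ := by
    ext b
    simp only [mem_filter, mem_univ, true_and, mem_image, Set.mem_range]
    constructor
    · rintro ⟨⟨a, rfl⟩, h⟩; exact ⟨a, h, rfl⟩
    · rintro ⟨a, h, rfl⟩; exact ⟨⟨a, rfl⟩, h⟩
  rw [h1, card_image_of_injective _ hσ]
  rcases Nat.eq_zero_or_pos (Fintype.card A) with h | h
  · have : (univ.filter fun a => P (σ a)) = ∅ := by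
      rw [Fintype.card_eq_zero_iff] at h
      exact Finset.eq_empty_of_isEmpty _
    simp [this]
  · gcongr
    exact Fintype.card_le_of_injective σ hσ

lemma Pr_not_range [Nonempty B] {σ : A → B} (hσ : Function.Injective σ) :
    Pr (fun b => b ∉ Set.range σ) = 1 - (Nat.card A : ℝ) / Nat.card B := by
  cases nonempty_fintype A
  cases nonempty_fintype B
  rw [Pr_not]
  have := Pr_mem (univ.image σ)
  rw [card_image_of_injective _ hσ, card_univ] at this
  rw [Nat.card_eq_fintype_card, Nat.card_eq_fintype_card, ← this]
  congr 1
  exact Pr_congr fun b => by simp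

lemma Pr_le_cube [Nonempty B] {σ : A → B} (hσ : Function.Injective σ) (P : B × B × B → Prop) :
    Pr P ≤ Pr (fun t : A × A × A => P (σ t.1, σ t.2.1, σ t.2.2)) +
      3 * Pr (fun b => b ∉ Set.range σ) := by
  have hinj : Function.Injective (fun t : A × A × A => (σ t.1, σ t.2.1, σ t.2.2)) := by
    rintro ⟨a, b, c⟩ ⟨a', b', c'⟩ h
    simp only [Prod.mk.injEq] at h
    rw [hσ h.1, hσ h.2.1, hσ h.2.2]
  refine (Pr_le_of_injective hinj P).trans ?_
  gcongr
  set r := Pr (fun b => b ∉ Set.range σ) with hr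
  have h1 : Pr (fun t : B × B × B => t.1 ∉ Set.range σ) = r := Pr_fst (fun b => b ∉ Set.range σ)
  have h2 : Pr (fun t : B × B × B => t.2.1 ∉ Set.range σ) = r :=
    (Pr_snd (fun t : B × B => t.1 ∉ Set.range σ)).trans (Pr_fst (fun b => b ∉ Set.range σ))
  have h3 : Pr (fun t : B × B × B => t.2.2 ∉ Set.range σ) = r :=
    (Pr_snd (fun t : B × B => t.2 ∉ Set.range σ)).trans (Pr_snd (fun b => b ∉ Set.range σ))
  have h4 : Pr (fun t : B × B × B => t ∉ Set.range (fun t : A × A × A => (σ t.1, σ t.2.1, σ t.2.2))) ≤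
      Pr (fun t : B × B × B => t.1 ∉ Set.range σ) +
        Pr (fun t : B × B × B => t.2.1 ∉ Set.range σ ∨ t.2.2 ∉ Set.range σ) := by
    refine Pr_le_add fun t ht => ?_
    by_contra hcon
    simp only [not_or, not_not] at hcon
    obtain ⟨⟨a, ha⟩, ⟨b, hb⟩, ⟨c, hc⟩⟩ := hcon
    exact ht ⟨(a, b, c), by simp [ha, hb, hc]⟩
  have h5 : Pr (fun t : B × B × B => t.2.1 ∉ Set.range σ ∨ t.2.2 ∉ Set.range σ) ≤
      Pr (fun t : B × B × B => t.2.1 ∉ Set.range σ) + Pr (fun t : B × B × B => t.2.2 ∉ Set.range σ) :=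
    Pr_le_add fun t ht => ht
  linarith

lemma Pr_pigeonhole {T : Type*} [Finite T] (P : A → Prop) (f : A → T) {c : ℝ} (hc : 0 < c)
    (h : c ≤ Pr P) : ∃ τ, c / Nat.card T ≤ Pr (fun a => P a ∧ f a = τ) := by
  cases nonempty_fintype T
  by_contra hcon
  push Not at hcon
  have h1 := (Pr_mono (Q := fun a => ∃ τ, P a ∧ f a = τ) fun a ha => ⟨f a, ha, rfl⟩).trans
    (Pr_exists_le (fun τ a => P a ∧ f a = τ))
  obtain ⟨a, _⟩ := exists_of_Pr_pos (hc.trans_le h)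
  have : Nonempty T := ⟨f a⟩
  have h2 : ∑ τ : T, Pr (fun a => P a ∧ f a = τ) < ∑ _τ : T, c / Nat.card T :=
    sum_lt_sum_of_nonempty univ_nonempty fun τ _ => hcon τ
  rw [sum_const, card_univ, nsmul_eq_mul, ← Nat.card_eq_fintype_card, mul_div_cancel₀] at h2
  · linarith
  · have := Nat.card_pos (α := T); positivity

end

/-- A random sample of chunks can be found in many places simultaneously. -/
theorem exists_uniform_blowup {b q s : ℕ} (hb : 0 < b) (hq0 : 0 < q) (h6 : 6 ∣ q) (hs : 0 < s)
    {η γ γ₁ : ℝ} (hη : 0 < η)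
    (hγ : 0 < γ) (hγ₁ : 0 < γ₁) (hγ₁' : γ₁ < 1) (hq : 30 < η * q) (hq2 : 2 < γ₁ * (q * b))
    (hq3 : 1 / q + 192 / (η ^ 2 * q) ≤ γ₁ ^ 2 / 4 * γ / 16) :
    ∃ M₀ : ℕ, ∀ (V X : Type) [Finite X], M₀ ≤ Nat.card X → ∀ (E : V → V → V → V → V → Prop)
      (σ : X × Fin b → V), Function.Injective σ →
      (∀ x y, x ≠ y → ∀ a a', 91 / 216 + η ≤ Pr (fun t : (X × Fin b) × (X × Fin b) × (X × Fin b) =>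
        E (σ (x, a)) (σ (y, a')) (σ t.1) (σ t.2.1) (σ t.2.2))) →
      ∀ N : X → Prop, γ / 2 ≤ Pr N →
      ∃ (F : Fin q × Fin b → Fin q × Fin b → Fin q × Fin b → Fin q × Fin b → Fin q × Fin b → Prop)
        (Z : Fin q → Prop) (h : Fin q → Fin s → X), (∀ i a j c, h i a = h j c → i = j ∧ a = c) ∧
        (∀ i a, N (h i a) ↔ Z i) ∧ γ / 4 ≤ Pr Z ∧ FracTiling F γ₁ ∧
        ∀ w₁ w₂ w₃ w₄ w₅, F w₁ w₂ w₃ w₄ w₅ → ∀ c₁ c₂ c₃ c₄ c₅,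
          E (σ (h w₁.1 c₁, w₁.2)) (σ (h w₂.1 c₂, w₂.2)) (σ (h w₃.1 c₃, w₃.2))
            (σ (h w₄.1 c₄, w₄.2)) (σ (h w₅.1 c₅, w₅.2)) := by
  let W := Fin q × Fin b
  let T := (W → W → W → W → W → Prop) × (Fin q → Prop)
  have hfin : ∀ A : Type, Finite A → Finite (W → A) := fun A _ => inferInstance
  have hfT : Finite T := @Finite.instProd _ _
    (hfin _ (hfin _ (hfin _ (hfin _ (hfin _ inferInstance))))) inferInstance
  have hT : 0 < Nat.card T := Nat.card_pos
  obtain ⟨M₁, hM₁⟩ := exists_blowup q s (δ := γ / 8 / Nat.card T) (by positivity)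
  set δ := γ₁ ^ 2 / 4 with hδ
  have hδ0 : 0 < δ := by positivity
  obtain ⟨M₂, hM₂⟩ := exists_nat_gt (16 / (δ * γ))
  refine ⟨max M₁ (M₂ + 1), fun V X _ hX E σ hσ hdeg N hN => ?_⟩
  have hXne : Nonempty X := (Nat.card_pos_iff.1 (by omega)).1
  have : Nonempty (Fin q) := ⟨⟨0, hq0⟩⟩
  have : Nonempty (Fin b) := ⟨⟨0, hb⟩⟩
  have hMM : 1 / (Nat.card X : ℝ) ≤ δ * γ / 16 := by
    have : (M₂ : ℝ) ≤ Nat.card X := by exact_mod_cast (by omega)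
    have h1 : 16 / (δ * γ) ≤ Nat.card X := by linarith
    calc _ ≤ 1 / (16 / (δ * γ)) := one_div_le_one_div_of_le (by positivity) h1
      _ = _ := by rw [one_div_div]
  have hsamp := sampling (δ := δ) hb hη hq hdeg
  have hbad : Pr (fun g : Fin q → X => δ ≤ Pr (fun p : W × W =>
      ¬ 91 / 216 < Pr (fun t : W × W × W => Samp E σ g p.1 p.2 t.1 t.2.1 t.2.2))) ≤ γ / 8 := by
    have h1 : 1 / (q:ℝ) + (1 / Nat.card X + 192 / (η ^ 2 * q)) ≤ δ * (γ / 8) := by linarith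
    exact le_of_mul_le_mul_left (hsamp.trans h1) hδ0
  have hunr : γ / 2 ≤ Pr (fun p : (Fin q → X) × Fin q => N (p.1 p.2)) := by
    rw [← Pr_swap, Pr_prod]
    have : ∀ i : Fin q, Pr (fun g : Fin q → X => N (g i)) = Pr N := fun i => Pr_apply i N
    simp only [this, av_const, hN]
  have h2 := Pr_fibre hunr
  have h3 := Pr_and_ge h2 (Q := fun g : Fin q → X => ¬ δ ≤ Pr (fun p : W × W =>
      ¬ 91 / 216 < Pr (fun t : W × W × W => Samp E σ g p.1 p.2 t.1 t.2.1 t.2.2)))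
      (d := γ / 8) (by simp only [not_not]; exact hbad)
  obtain ⟨τ, hτ⟩ := Pr_pigeonhole _ (fun g : Fin q → X => ((Samp E σ g, fun i => N (g i)) : T))
    (by positivity : (0:ℝ) < γ / 8) (le_trans (by linarith) h3)
  obtain ⟨h, hinj, hh⟩ := hM₁ X (by omega) _ hτ
  have hF : ∀ c : Fin q → Fin s, Samp E σ (fun i => h i (c i)) = τ.1 := fun c => congrArg Prod.fst (hh c).2
  have hZ : ∀ c : Fin q → Fin s, (fun i => N (h i (c i))) = τ.2 := fun c => congrArg Prod.snd (hh c).2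
  let c₀ : Fin q → Fin s := fun _ => ⟨0, hs⟩
  refine ⟨τ.1, τ.2, h, hinj, fun i a => ?_, ?_, ?_, ?_⟩
  · rw [← hZ (fun _ => a)]
  · have := (hh c₀).1.1
    rw [← hZ c₀]
    linarith
  · have := (hh c₀).1.2
    rw [not_le] at this
    rw [← hF c₀]
    refine fracTiling_of_degree ?_ hγ₁ hγ₁' ?_ this
    · rw [Fintype.card_prod, Fintype.card_fin]; exact Dvd.dvd.mul_right h6 _
    · rw [Fintype.card_prod, Fintype.card_fin, Fintype.card_fin]; push_cast; exact hq2
  · intro w₁ w₂ w₃ w₄ w₅ hw c₁ c₂ c₃ c₄ c₅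
    have hnd : [w₁.1, w₂.1, w₃.1, w₄.1, w₅.1].Nodup := by
      rw [← hF c₀] at hw
      exact hw.1
    simp only [List.nodup_cons, List.mem_cons, List.not_mem_nil, or_false, not_or] at hnd
    obtain ⟨⟨h12, h13, h14, h15⟩, ⟨h23, h24, h25⟩, ⟨h34, h35⟩, h45, -⟩ := hnd
    let c : Fin q → Fin s := fun i => if i = w₁.1 then c₁ else if i = w₂.1 then c₂ else
      if i = w₃.1 then c₃ else if i = w₄.1 then c₄ else c₅
    rw [← hF c] at hw
    have := hw.2
    have e1 : c w₁.1 = c₁ := by simp [c]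
    have e2 : c w₂.1 = c₂ := by simp [c, Ne.symm h12]
    have e3 : c w₃.1 = c₃ := by simp [c, Ne.symm h13, Ne.symm h23]
    have e4 : c w₄.1 = c₄ := by simp [c, Ne.symm h14, Ne.symm h24, Ne.symm h34]
    have e5 : c w₅.1 = c₅ := by simp [c, Ne.symm h15, Ne.symm h25, Ne.symm h35, Ne.symm h45]
    simp only [e1, e2, e3, e4, e5] at this
    exact this

end

/-- Cutting the vertices outside a family of disjoint `b`-sets into further `b`-sets. -/
lemma exists_chunks {V : Type} [Fintype V] {b : ℕ} (hb : 0 < b) (P : Finset (Finset V))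
    (hP : ∀ S ∈ P, S.card = b) (hd : ∀ S ∈ P, ∀ T ∈ P, S ≠ T → Disjoint S T) :
    ∃ (u : ℕ) (σ : ({S // S ∈ P} ⊕ Fin u) × Fin b → V), Function.Injective σ ∧
      (∀ S m, σ (Sum.inl S, m) ∈ S.1) ∧ (∀ j m, ∀ S ∈ P, σ (Sum.inr j, m) ∉ S) ∧
      Fintype.card V < b * (P.card + u) + b := by
  let U : Finset V := univ \ P.biUnion id
  have hU : U.card + P.card * b = Fintype.card V := by
    have h1 : (P.biUnion id).card = P.card * b := by
      exact (card_biUnion (t := id) (fun S hS T hT h => hd S hS T hT h)).trans (sum_const_nat hP)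
    rw [← h1, ← card_univ (α := V)]
    exact card_sdiff_add_card_eq_card (subset_univ _)
  let u := U.card / b
  have hub : u * b ≤ U.card := Nat.div_mul_le_self _ _
  let e : ∀ S : {S // S ∈ P}, S.1 ≃ Fin b := fun S => S.1.equivFinOfCardEq (hP S.1 S.2)
  let f : Fin u × Fin b → U := fun p => U.equivFin.symm (Fin.castLE hub (finProdFinEquiv p))
  have hf : Function.Injective f := fun p p' h => by
    have := U.equivFin.symm.injective h
    exact finProdFinEquiv.injective (Fin.castLE_injective hub this)
  have hUn : ∀ v ∈ U, ∀ S ∈ P, v ∉ S := fun v hv S hS hvS => by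
    simp only [U, mem_sdiff, mem_biUnion, id, not_exists, not_and] at hv
    exact hv.2 S hS hvS
  refine ⟨u, fun p => Sum.elim (fun S => ((e S).symm p.2 : V)) (fun j => (f (j, p.2) : V)) p.1,
    ?_, fun S m => ((e S).symm m).2, fun j m => hUn _ (f (j, m)).2, ?_⟩
  · rintro ⟨S | j, m⟩ ⟨T | k, m'⟩ h
    · simp only [Sum.elim_inl] at h
      have hST : S = T := by
        by_contra hne
        refine Finset.disjoint_left.1 (hd S.1 S.2 T.1 T.2 fun h => hne (Subtype.ext h))
          ((e S).symm m).2 ?_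
        rw [h]; exact ((e T).symm m').2
      subst hST
      have := (e S).symm.injective (Subtype.ext h)
      rw [this]
    · simp only [Sum.elim_inl, Sum.elim_inr] at h
      exact absurd ((e S).symm m).2 (h ▸ hUn _ (f (k, m')).2 S.1 S.2)
    · simp only [Sum.elim_inl, Sum.elim_inr] at h
      exact absurd ((e T).symm m').2 (h ▸ hUn _ (f (j, m)).2 T.1 T.2)
    · simp only [Sum.elim_inr] at h
      have := hf (Subtype.ext h)
      simp only [Prod.mk.injEq] at this
      rw [this.1, this.2]
  · rw [← hU]
    have := Nat.lt_div_mul_add hb (a := U.card)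
    simp only [u]
    nlinarith

set_option maxHeartbeats 1000000 in
/-- One step of the construction of an almost spanning family of disjoint paths. -/
theorem exists_larger_family {η γ : ℝ} (hη : 0 < η) (hγ : 0 < γ) (hγ1 : γ < 1) :
    ∃ b n₀ : ℕ, 0 < b ∧ 1 ≤ γ * b ∧ ∀ (V : Type) [Fintype V], n₀ ≤ Fintype.card V →
      ∀ E : V → V → V → V → V → Prop, Sym5 E →
      (∀ x y, x ≠ y → 91 / 216 + η ≤ Pr (fun t : V × V × V => E x y t.1 t.2.1 t.2.2)) →
      ∀ P : Finset (Finset V), (∀ S ∈ P, IsPathSet E S ∧ S.card = b) →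
      (∀ S ∈ P, ∀ T ∈ P, S ≠ T → Disjoint S T) → (b * P.card : ℝ) < (1 - γ) * Fintype.card V →
      ∃ Q : Finset (Finset V), (∀ S ∈ Q, IsPathSet E S ∧ S.card = b) ∧
        (∀ S ∈ Q, ∀ T ∈ Q, S ≠ T → Disjoint S T) ∧ P.card < Q.card := by
  set γ₁ := γ / 16 with hγ₁
  have hγ₁0 : 0 < γ₁ := by positivity
  obtain ⟨t, ht⟩ := exists_nat_gt (16 / γ)
  have ht0 : (0:ℝ) < t := lt_trans (by positivity) ht
  rw [div_lt_iff₀ hγ] at ht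
  set b := 6 * t + 5 with hbdef
  have hb : 0 < b := by omega
  have hbR : (b : ℝ) = 6 * t + 5 := by rw [hbdef]; push_cast; ring
  set δ := γ₁ ^ 2 / 4 * γ / 16 with hδ
  have hδ0 : 0 < δ := by positivity
  set η' := η / 2 with hη'
  have hη'0 : 0 < η' := by positivity
  obtain ⟨q', hq'⟩ := exists_nat_gt (30 / η' + 2 / γ₁ + (1 + 192 / η' ^ 2) / δ)
  set q := 6 * (q' + 1) with hq
  have hqq : (30 / η' + 2 / γ₁ + (1 + 192 / η' ^ 2) / δ) < q := by
    have : (q' : ℝ) ≤ q := by exact_mod_cast (by omega)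
    linarith
  have hq0 : 0 < q := by omega
  have hq0R : (0:ℝ) < q := by exact_mod_cast hq0
  have hp1 : 0 < 30 / η' := by positivity
  have hp2 : 0 < 2 / γ₁ := by positivity
  have hp3 : 0 < (1 + 192 / η' ^ 2) / δ := by positivity
  obtain ⟨s, hs⟩ := exists_nat_gt (8 * ((q : ℝ) * b) ^ 5 / (q * γ))
  have hs0R : (0:ℝ) < s := lt_of_le_of_lt (by positivity) hs
  have hs0 : 0 < s := by exact_mod_cast hs0R
  obtain ⟨M₀, hM₀⟩ := exists_uniform_blowup (s := s) hb hq0 (Dvd.intro _ rfl) hs0 hη'0 hγ hγ₁0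
    (by linarith) (by
      have : 30 / η' < q := by linarith
      rw [div_lt_iff₀ hη'0] at this; linarith) (by
      have : 2 / γ₁ < q := by linarith
      rw [div_lt_iff₀ hγ₁0] at this
      have hb1 : (1:ℝ) ≤ b := by exact_mod_cast hb
      have : γ₁ * q ≤ γ₁ * (q * b) := by gcongr; nlinarith
      linarith) (by
      have : (1 + 192 / η' ^ 2) / δ < q := by linarith
      rw [div_lt_iff₀ hδ0] at this
      have e : 1 / (q:ℝ) + 192 / (η' ^ 2 * q) = (1 + 192 / η' ^ 2) / q := by
        field_simp
      rw [e, div_le_iff₀ hq0R, ← hδ]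
      linarith)
  obtain ⟨n₁, hn₁⟩ := exists_nat_gt (6 * b / η + 2 * b / γ)
  refine ⟨b, max n₁ (b * (M₀ + 1)), hb, by rw [hbR]; nlinarith, fun V _ hn E hE hdeg P hP hd hPn => ?_⟩
  have hnR : 6 * b / η + 2 * b / γ < Fintype.card V := by
    refine hn₁.trans_le ?_
    exact_mod_cast (le_max_left _ _).trans hn
  set n := Fintype.card V with hndef
  have hbpos : (0:ℝ) < b := by exact_mod_cast hb
  have hn1 : 6 * b / η < n := by
    have : (0:ℝ) < 2 * b / γ := by positivity
    linarith
  have hn2 : 2 * b / γ < n := by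
    have : (0:ℝ) < 6 * b / η := by positivity
    linarith
  rw [div_lt_iff₀ hη] at hn1
  rw [div_lt_iff₀ hγ] at hn2
  have hn0 : (0:ℝ) < n := by
    by_contra h
    have : (n:ℝ) * γ ≤ 0 := mul_nonpos_of_nonpos_of_nonneg (not_lt.1 h) hγ.le
    linarith
  have hVne : Nonempty V := Fintype.card_pos_iff.1 (by exact_mod_cast hn0)
  obtain ⟨u, σ, hσ, hσl, hσr, hu⟩ := exists_chunks hb P (fun S hS => (hP S hS).2) hd
  let X := {S // S ∈ P} ⊕ Fin u
  have hXc : Nat.card X = P.card + u := by simp [X]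
  have huR : (n : ℝ) < b * (P.card + u) + b := by exact_mod_cast hu
  have hle : b * (P.card + u : ℝ) ≤ n := by
    have := Fintype.card_le_of_injective σ hσ
    rw [Fintype.card_prod, Fintype.card_fin, ← Nat.card_eq_fintype_card, hXc] at this
    have : ((P.card + u) * b : ℝ) ≤ n := by exact_mod_cast this
    linarith
  have hXM : M₀ ≤ Nat.card X := by
    have h1 : b * (M₀ + 1) < b * (P.card + u) + b := lt_of_le_of_lt ((le_max_right _ _).trans hn) hu
    have h2 : b * (M₀ + 1) < b * (P.card + u + 1) := by linarith
    have := lt_of_mul_lt_mul_left h2 (Nat.zero_le b)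
    omega
  let N : X → Prop := fun x => Sum.isRight x = true
  have hXpos : 0 < (P.card + u : ℝ) := by
    by_contra h
    have : (b * (P.card + u) : ℝ) ≤ 0 := mul_nonpos_of_nonneg_of_nonpos hbpos.le (not_lt.1 h)
    nlinarith
  have hN : γ / 2 ≤ Pr N := by
    have h1 : Pr N = u / (P.card + u) := by
      have : Fintype X := inferInstance
      rw [Pr_eq, ← Nat.card_eq_fintype_card (α := X), hXc]
      congr 1
      · norm_cast
        rw [show (univ.filter fun x : X => N x) = (univ : Finset (Fin u)).image Sum.inr by
          ext x; cases x <;> simp [N]]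
        rw [card_image_of_injective _ Sum.inr_injective]; simp
      · push_cast; rfl
    rw [h1, le_div_iff₀ hXpos]
    have := mul_le_mul_of_nonneg_left hle (by positivity : 0 ≤ γ / 2)
    have : γ / 2 * (P.card + u) * b ≤ u * b := by linarith
    exact le_of_mul_le_mul_right this hbpos
  have hdegX : ∀ x y : X, x ≠ y → ∀ a a', 91 / 216 + η' ≤
      Pr (fun t : (X × Fin b) × (X × Fin b) × (X × Fin b) =>
        E (σ (x, a)) (σ (y, a')) (σ t.1) (σ t.2.1) (σ t.2.2)) := by
    intro x y hxy a a'
    have h1 := hdeg (σ (x, a)) (σ (y, a')) (fun h => hxy (Prod.ext_iff.1 (hσ h)).1)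
    have h2 := Pr_le_cube hσ (fun t : V × V × V => E (σ (x, a)) (σ (y, a')) t.1 t.2.1 t.2.2)
    rw [Pr_not_range hσ] at h2
    have h3 : 1 - (Nat.card (X × Fin b) : ℝ) / Nat.card V ≤ η / 6 := by
      rw [Nat.card_prod, hXc, Nat.card_eq_fintype_card (α := V), sub_le_iff_le_add,
        ← sub_le_iff_le_add', le_div_iff₀ hn0]
      push_cast
      simp only [Nat.card_eq_fintype_card, Fintype.card_fin]
      linarith
    simp only [hη']
    linarith
  obtain ⟨F, Z, h, hinj, hNZ, hZ, hF, hFE⟩ := hM₀ V X hXM E σ hσ hdegX N hN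
  obtain ⟨Q, hQ1, hQ2, hQ3⟩ := exists_packing hE hF (fun (w : Fin q × Fin b) a => σ (h w.1 a, w.2))
    (fun w a w' a' e => by
      have h1 := Prod.ext_iff.1 (hσ e)
      obtain ⟨h2, h3⟩ := hinj _ _ _ _ h1.1
      exact ⟨Prod.ext h2 h1.2, h3⟩) hFE t
  let R : Finset (Finset V) := P.filter fun S => ∃ i a, ∃ hS, h i a = Sum.inl ⟨S, hS⟩
  have hRc : (R.card : ℝ) ≤ (1 - γ / 4) * q * s := by
    have h1 : R ⊆ (((univ.filter fun i => ¬ Z i) ×ˢ (univ : Finset (Fin s))).image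
        fun p => Sum.elim (fun S => S.1) (fun _ => ∅) (h p.1 p.2)) := by
      intro S hS
      simp only [R, mem_filter] at hS
      obtain ⟨-, i, a, hS, hi⟩ := hS
      simp only [mem_image, mem_product, mem_filter, mem_univ, true_and, and_true]
      refine ⟨(i, a), ?_, by simp only [hi, Sum.elim_inl]⟩
      rw [← hNZ i a, hi]
      simp [N]
    have h2 := (card_le_card h1).trans card_image_le
    rw [card_product, card_univ, Fintype.card_fin] at h2
    have : Nonempty (Fin q) := ⟨⟨0, hq0⟩⟩
    have h3 : Pr (fun i => ¬ Z i) ≤ 1 - γ / 4 := by rw [Pr_not]; linarith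
    rw [Pr_eq, Fintype.card_fin, div_le_iff₀ hq0R] at h3
    have h4 : (R.card : ℝ) ≤ ((univ.filter fun i => ¬ Z i).card : ℝ) * s := by exact_mod_cast h2
    nlinarith
  have hRdisj : ∀ S ∈ P \ R, ∀ T ∈ Q, Disjoint S T := by
    intro S hS T hT
    simp only [R, mem_sdiff, mem_filter, not_and] at hS
    rw [Finset.disjoint_right]
    intro v hvT hvS
    obtain ⟨w, a, rfl⟩ := (hQ1 T hT).2.2 v hvT
    rcases hx : h w.1 a with S' | j
    · simp only [hx] at hvS
      have hSS : S ≠ S'.1 := fun e => hS.2 hS.1 ⟨w.1, a, hS.1, by rw [hx]; congr 1; exact Subtype.ext e.symm⟩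
      exact Finset.disjoint_left.1 (hd S hS.1 S'.1 S'.2 hSS) hvS (hσl _ _)
    · simp only [hx] at hvS
      exact hσr j w.2 S hS.1 hvS
  refine ⟨(P \ R) ∪ Q, ?_, ?_, ?_⟩
  · intro S hS
    rcases mem_union.1 hS with h1 | h1
    · exact hP S (mem_sdiff.1 h1).1
    · exact ⟨(hQ1 S h1).1, (hQ1 S h1).2.1⟩
  · intro S hS T hT hne
    rcases mem_union.1 hS with h1 | h1 <;> rcases mem_union.1 hT with h2 | h2
    · exact hd S (mem_sdiff.1 h1).1 T (mem_sdiff.1 h2).1 hne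
    · exact hRdisj S h1 T h2
    · exact (hRdisj T h2 S h1).symm
    · exact hQ2 S h1 T h2 hne
  · have hdj : Disjoint (P \ R) Q := by
      rw [Finset.disjoint_left]
      intro S h1 h2
      have := hRdisj S h1 S h2
      rw [disjoint_self, Finset.bot_eq_empty] at this
      have h3 := (hQ1 S h2).2.1
      rw [this] at h3
      simp at h3
    rw [card_union_of_disjoint hdj]
    have h1 : P.card ≤ (P \ R).card + R.card := by
      have := le_card_sdiff R P
      omega
    have h1R : (P.card : ℝ) ≤ (P \ R).card + R.card := by exact_mod_cast h1
    have h2 : (R.card : ℝ) < Q.card := by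
      refine hRc.trans_lt (lt_of_lt_of_le ?_ hQ3)
      rw [Fintype.card_prod, Fintype.card_fin, Fintype.card_fin]
      push_cast
      rw [div_lt_iff₀ (by positivity)] at hs
      have e1 : (1 - γ / 16) * (6 * (t + 1)) ≤ (b:ℝ) := by rw [hbR]; nlinarith
      have e2 : (1 - γ / 16) * ((1 - γ / 16) * (q * s)) ≤ (1 - γ₁) * (q * b) * s / (6 * (t + 1)) := by
        rw [le_div_iff₀ (by positivity)]
        have : 0 ≤ (1 - γ / 16) * (q * s) := mul_nonneg (by linarith) (by positivity)
        calc _ = (1 - γ / 16) * (q * s) * ((1 - γ / 16) * (6 * (t + 1))) := by ring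
          _ ≤ (1 - γ / 16) * (q * s) * b := by gcongr
          _ = _ := by rw [hγ₁]; ring
      have e3 : 0 ≤ (γ / 16) ^ 2 * (q * s) := by positivity
      linarith
    have : (P.card : ℝ) < (P \ R).card + Q.card := by linarith
    exact_mod_cast this

/-- Almost all vertices can be covered by disjoint paths of bounded length. -/
theorem exists_path_cover {η γ : ℝ} (hη : 0 < η) (hγ : 0 < γ) (hγ1 : γ < 1) :
    ∃ b n₀ : ℕ, 0 < b ∧ 1 ≤ γ * b ∧ ∀ (V : Type) [Fintype V], n₀ ≤ Fintype.card V →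
      ∀ E : V → V → V → V → V → Prop, Sym5 E →
      (∀ x y, x ≠ y → 91 / 216 + η ≤ Pr (fun t : V × V × V => E x y t.1 t.2.1 t.2.2)) →
      ∃ P : Finset (Finset V), (∀ S ∈ P, IsPathSet E S ∧ S.card = b) ∧
      (∀ S ∈ P, ∀ T ∈ P, S ≠ T → Disjoint S T) ∧ (1 - γ) * Fintype.card V ≤ (b * P.card : ℝ) := by
  obtain ⟨b, n₀, hb, hbγ, h⟩ := exists_larger_family hη hγ hγ1
  refine ⟨b, n₀, hb, hbγ, fun V _ hn E hE hdeg => ?_⟩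
  let C : Finset (Finset (Finset V)) := univ.filter fun P => (∀ S ∈ P, IsPathSet E S ∧ S.card = b) ∧
      (∀ S ∈ P, ∀ T ∈ P, S ≠ T → Disjoint S T)
  have hC : C.Nonempty := ⟨∅, by simp [C]⟩
  obtain ⟨P, hP, hmax⟩ := C.exists_max_image card hC
  simp only [C, mem_filter, mem_univ, true_and] at hP hmax
  refine ⟨P, hP.1, hP.2, ?_⟩
  by_contra hcon
  obtain ⟨Q, hQ1, hQ2, hQ3⟩ := h V hn E hE hdeg P hP.1 hP.2 (not_le.1 hcon)
  exact absurd (hmax Q ⟨hQ1, hQ2⟩) (not_le.2 hQ3)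

section

lemma Sym5.rev {V : Type*} {E : V → V → V → V → V → Prop} (hE : Sym5 E) {a b c d e : V}
    (h : E a b c d e) : E d e c a b :=
  hE.s3 <| hE.s4 <| hE.s2 <| hE.s3 <| hE.s1 <| hE.s2 <| hE.s4 <| hE.s3 h

section
variable {V : Type*} [Finite V] [Nonempty V]

/-- A graph of density at most `ω²` has triangle density at most `ω³`. -/
lemma triangle_density (R : V → V → Prop) {ω : ℝ} (hω : 0 ≤ ω)
    (hR : Pr (fun p : V × V => R p.1 p.2) ≤ ω ^ 2) :
    Pr (fun t : V × V × V => R t.1 t.2.1 ∧ R t.1 t.2.2 ∧ R t.2.1 t.2.2) ≤ ω ^ 3 := by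
  rw [Pr_prod]
  have h1 : ∀ x, Pr (fun b : V × V => R x b.1 ∧ R x b.2 ∧ R b.1 b.2) ≤ ω * Pr (R x) := by
    intro x
    rcases le_total (Pr (R x)) ω with h | h
    · calc _ ≤ Pr (fun b : V × V => R x b.1 ∧ R x b.2) := Pr_mono fun b hb => ⟨hb.1, hb.2.1⟩
        _ = Pr (R x) * Pr (R x) := Pr_indep _ _
        _ ≤ ω * Pr (R x) := mul_le_mul_of_nonneg_right h (Pr_nonneg _)
    · calc _ ≤ Pr (fun b : V × V => R b.1 b.2) := Pr_mono fun b hb => hb.2.2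
        _ ≤ ω * ω := by rw [← sq]; exact hR
        _ ≤ _ := mul_le_mul_of_nonneg_left h hω
  calc _ ≤ av (fun x => ω * Pr (R x)) := av_mono h1
    _ = ω * Pr (fun p : V × V => R p.1 p.2) := by rw [av_mul_left, Pr_prod]
    _ ≤ ω * ω ^ 2 := by gcongr
    _ = _ := by ring

/-- The robust shadow of a dense symmetric ternary relation contains most pairs. -/
lemma shadow_large (T : V → V → V → Prop) (h12 : ∀ {a b c}, T a b c → T b a c)
    (h23 : ∀ {a b c}, T a b c → T a c b)
    (hT : 91 / 216 ≤ Pr (fun t : V × V × V => T t.1 t.2.1 t.2.2)) :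
    11 / 20 ≤ Pr (fun r : V × V => 1 / 250 ≤ Pr (fun s => T s r.1 r.2)) := by
  set R : V → V → Prop := fun a b => 1 / 250 ≤ Pr (fun s => T s a b) with hR
  have hsymm : ∀ a b, R a b → R b a := fun a b h => h.trans (Pr_mono fun s => h23)
  by_contra hcon
  rw [not_le] at hcon
  have htri := triangle_density R (ω := 371 / 500) (by norm_num) (by
    refine (le_of_lt hcon).trans (by norm_num))
  have hdel : Pr (fun x : (V × V) × V => T x.2 x.1.1 x.1.2 ∧ ¬ R x.1.1 x.1.2) ≤ 1 / 250 :=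
    Pr_del (P := fun x : (V × V) × V => T x.2 x.1.1 x.1.2) (by norm_num)
  let e1 : V × V × V ≃ (V × V) × V := (Equiv.prodAssoc V V V).symm
  let e2 : V × V × V ≃ (V × V) × V :=
    ⟨fun t => ((t.1, t.2.2), t.2.1), fun x => (x.1.1, x.2, x.1.2), fun _ => rfl, fun _ => rfl⟩
  let e3 : V × V × V ≃ (V × V) × V :=
    ⟨fun t => ((t.2.1, t.2.2), t.1), fun x => (x.2, x.1.1, x.1.2), fun _ => rfl, fun _ => rfl⟩
  have d1 := (Pr_equiv e1 _).trans_le hdel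
  have d2 := (Pr_equiv e2 _).trans_le hdel
  have d3 := (Pr_equiv e3 _).trans_le hdel
  have s1 : Pr (fun t : V × V × V => T t.1 t.2.1 t.2.2) ≤
      Pr (fun t : V × V × V => R t.1 t.2.1 ∧ R t.1 t.2.2 ∧ R t.2.1 t.2.2) +
      Pr (fun t : V × V × V => T t.1 t.2.1 t.2.2 ∧
        (¬ R t.1 t.2.1 ∨ ¬ R t.1 t.2.2 ∨ ¬ R t.2.1 t.2.2)) :=
    Pr_le_add fun t ht => by tauto
  have s2 : Pr (fun t : V × V × V => T t.1 t.2.1 t.2.2 ∧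
        (¬ R t.1 t.2.1 ∨ ¬ R t.1 t.2.2 ∨ ¬ R t.2.1 t.2.2)) ≤
      Pr (fun t : V × V × V => T t.2.2 t.1 t.2.1 ∧ ¬ R t.1 t.2.1) +
      Pr (fun t : V × V × V => T t.1 t.2.1 t.2.2 ∧ (¬ R t.1 t.2.2 ∨ ¬ R t.2.1 t.2.2)) :=
    Pr_le_add fun t ht => by
      have := h12 (h23 ht.1)
      tauto
  have s3 : Pr (fun t : V × V × V => T t.1 t.2.1 t.2.2 ∧ (¬ R t.1 t.2.2 ∨ ¬ R t.2.1 t.2.2)) ≤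
      Pr (fun t : V × V × V => T t.2.1 t.1 t.2.2 ∧ ¬ R t.1 t.2.2) +
      Pr (fun t : V × V × V => T t.1 t.2.1 t.2.2 ∧ ¬ R t.2.1 t.2.2) :=
    Pr_le_add fun t ht => by
      have := h12 ht.1
      tauto
  change Pr (fun t : V × V × V => T t.2.2 t.1 t.2.1 ∧ ¬ R t.1 t.2.1) ≤ _ at d1
  change Pr (fun t : V × V × V => T t.2.1 t.1 t.2.2 ∧ ¬ R t.1 t.2.2) ≤ _ at d2
  change Pr (fun t : V × V × V => T t.1 t.2.1 t.2.2 ∧ ¬ R t.2.1 t.2.2) ≤ _ at d3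
  norm_num at htri
  linarith

/-- Any two pairs are joined by many paths with two edges. -/
theorem connecting {E : V → V → V → V → V → Prop} (hE : Sym5 E)
    (hdeg : ∀ x y, x ≠ y → 91 / 216 ≤ Pr (fun t : V × V × V => E x y t.1 t.2.1 t.2.2))
    {p q : V × V} (hp : p.1 ≠ p.2) (hq : q.1 ≠ q.2) :
    1 / 625000 ≤ Pr (fun x : (V × V) × V × V =>
      E p.1 p.2 x.2.1 x.1.1 x.1.2 ∧ E x.1.1 x.1.2 x.2.2 q.1 q.2) := by
  have h1 := shadow_large (fun a b c => E p.1 p.2 a b c) hE.s3 hE.s4 (hdeg _ _ hp)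
  have h2 := shadow_large (fun a b c => E q.1 q.2 a b c) hE.s3 hE.s4 (hdeg _ _ hq)
  have h3 := Pr_and_ge h1 (Q := fun r : V × V => 1 / 250 ≤ Pr (fun s => E q.1 q.2 s r.1 r.2))
    (d := 9 / 20) (by rw [Pr_not]; linarith)
  have h4 := Pr_prod_ge (Q := fun (r : V × V) (x : V × V) =>
      E p.1 p.2 x.1 r.1 r.2 ∧ E q.1 q.2 x.2 r.1 r.2) (d := 1 / 250 * (1 / 250)) (by norm_num) h3
      (fun r hr => by
        rw [Pr_indep (fun s => E p.1 p.2 s r.1 r.2) (fun s => E q.1 q.2 s r.1 r.2)]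
        exact mul_le_mul hr.1 hr.2 (by norm_num) (Pr_nonneg _))
  refine le_trans (by norm_num) (h4.trans (Pr_mono fun x hx => ⟨hx.2.1, ?_⟩))
  exact hE.rev hx.2.2

end

end

section

/-- Two families of paths with the same ends, given by the ends and the two lists of internal
vertices. -/
abbrev Seg (V : Type*) := (V × V) × (V × V) × List V × List V

section
variable {V : Type*}

def segEnds (D : List (Seg V)) : Multiset V :=
  (D.map fun d => ({d.1.1, d.1.2, d.2.1.1, d.2.1.2} : Multiset V)).sum

def segOld (D : List (Seg V)) : Multiset V := (D.map fun d => (d.2.2.1 : Multiset V)).sum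

def segNew (D : List (Seg V)) : Multiset V := (D.map fun d => (d.2.2.2 : Multiset V)).sum

lemma segEnds_append (D D' : List (Seg V)) : segEnds (D ++ D') = segEnds D + segEnds D' := by
  simp [segEnds]

lemma segOld_append (D D' : List (Seg V)) : segOld (D ++ D') = segOld D + segOld D' := by
  simp [segOld]

lemma segNew_append (D D' : List (Seg V)) : segNew (D ++ D') = segNew D + segNew D' := by
  simp [segNew]

/-- With the help of the vertices in `R`, a family of paths using `A` can be replaced by one with
the same ends using `B`. -/
def Tr (E : V → V → V → V → V → Prop) (R : Set V) (A B : Multiset V) : Prop :=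
  ∃ D : List (Seg V), (∀ d ∈ D, Conn E d.1 d.2.1 d.2.2.1 ∧ Conn E d.1 d.2.1 d.2.2.2) ∧
    segNew D + A = segOld D + B ∧
    ((segEnds D + segOld D).Nodup ∧ ∀ v ∈ segEnds D + segOld D, v ∈ R ∨ v ∈ A) ∧
    ((segEnds D + segNew D).Nodup ∧ ∀ v ∈ segEnds D + segNew D, v ∈ R ∨ v ∈ B)

variable {E : V → V → V → V → V → Prop}

lemma Tr.refl (R : Set V) (A : Multiset V) : Tr E R A A :=
  ⟨[], by simp, by simp [segNew, segOld], by simp [segEnds, segOld], by simp [segEnds, segNew]⟩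

lemma Tr.mono {R R' : Set V} (h : R ⊆ R') {A B : Multiset V} (ht : Tr E R A B) : Tr E R' A B := by
  obtain ⟨D, h1, h2, ⟨h3, h4⟩, h5, h6⟩ := ht
  exact ⟨D, h1, h2, ⟨h3, fun v hv => (h4 v hv).imp_left fun x => h x⟩, h5,
    fun v hv => (h6 v hv).imp_left fun x => h x⟩

lemma Tr.symm {R : Set V} {A B : Multiset V} (ht : Tr E R A B) : Tr E R B A := by
  obtain ⟨D, h1, h2, h3, h4⟩ := ht
  have e1 : segEnds (D.map fun d => (d.1, d.2.1, d.2.2.2, d.2.2.1)) = segEnds D := by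
    simp [segEnds, Function.comp_def]
  have e2 : segOld (D.map fun d => (d.1, d.2.1, d.2.2.2, d.2.2.1)) = segNew D := by
    simp [segOld, segNew, Function.comp_def]
  have e3 : segNew (D.map fun d => (d.1, d.2.1, d.2.2.2, d.2.2.1)) = segOld D := by
    simp [segOld, segNew, Function.comp_def]
  refine ⟨D.map fun d => (d.1, d.2.1, d.2.2.2, d.2.2.1), ?_, ?_, ?_, ?_⟩
  · intro d hd
    obtain ⟨d', hd', rfl⟩ := List.mem_map.1 hd
    exact (h1 d' hd').symm
  · rw [e2, e3, h2]
  · rw [e1, e2]; exact h4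
  · rw [e1, e3]; exact h3

lemma Tr.comp {R₁ R₂ : Set V} {A₁ A₂ B₁ B₂ M N : Multiset V} (h₁ : Tr E R₁ (A₁ + M) (B₁ + N))
    (h₂ : Tr E R₂ (A₂ + N) (B₂ + M)) (hR : ∀ v ∈ R₁, v ∉ R₂)
    (hR₁ : ∀ v ∈ R₁, v ∉ A₂ + N ∧ v ∉ B₂ + M) (hR₂ : ∀ v ∈ R₂, v ∉ A₁ + M ∧ v ∉ B₁ + N)
    (hA : ∀ v ∈ A₁ + M, v ∉ A₂ + N) (hB : ∀ v ∈ B₁ + N, v ∉ B₂ + M) {R : Set V}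
    (hRR : ∀ v, v ∈ R₁ ∨ v ∈ R₂ ∨ v ∈ M ∨ v ∈ N → v ∈ R) :
    Tr E R (A₁ + A₂) (B₁ + B₂) := by
  obtain ⟨D, h1, h2, ⟨h3, h4⟩, h5, h6⟩ := h₁
  obtain ⟨D', h1', h2', ⟨h3', h4'⟩, h5', h6'⟩ := h₂
  refine ⟨D ++ D', ?_, ?_, ⟨?_, ?_⟩, ?_, ?_⟩
  · intro d hd
    rcases List.mem_append.1 hd with h | h
    · exact h1 d h
    · exact h1' d h
  · rw [segOld_append, segNew_append]
    have : (segNew D + (A₁ + M)) + (segNew D' + (A₂ + N)) =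
        (segOld D + (B₁ + N)) + (segOld D' + (B₂ + M)) := by rw [h2, h2']
    have h7 : segNew D + segNew D' + (A₁ + A₂) + (M + N) =
        segOld D + segOld D' + (B₁ + B₂) + (M + N) := by
      calc _ = (segNew D + (A₁ + M)) + (segNew D' + (A₂ + N)) := by abel
        _ = _ := this
        _ = _ := by abel
    exact add_right_cancel h7
  · rw [segEnds_append, segOld_append, add_add_add_comm, Multiset.nodup_add]
    refine ⟨h3, h3', Multiset.disjoint_left.2 fun {v} hv hv' => ?_⟩
    rcases h4 v hv with h | h <;> rcases h4' v hv' with h' | h'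
    · exact hR v h h'
    · exact (hR₁ v h).1 h'
    · exact (hR₂ v h').1 h
    · exact hA v h h'
  · rw [segEnds_append, segOld_append, add_add_add_comm]
    intro v hv
    rcases Multiset.mem_add.1 hv with hv | hv
    · rcases h4 v hv with h | h
      · exact Or.inl (hRR v (Or.inl h))
      · rcases Multiset.mem_add.1 h with h | h
        · exact Or.inr (Multiset.mem_add.2 (Or.inl h))
        · exact Or.inl (hRR v (by tauto))
    · rcases h4' v hv with h | h
      · exact Or.inl (hRR v (by tauto))
      · rcases Multiset.mem_add.1 h with h | h
        · exact Or.inr (Multiset.mem_add.2 (Or.inr h))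
        · exact Or.inl (hRR v (by tauto))
  · rw [segEnds_append, segNew_append, add_add_add_comm, Multiset.nodup_add]
    refine ⟨h5, h5', Multiset.disjoint_left.2 fun {v} hv hv' => ?_⟩
    rcases h6 v hv with h | h <;> rcases h6' v hv' with h' | h'
    · exact hR v h h'
    · exact (hR₁ v h).2 h'
    · exact (hR₂ v h').2 h
    · exact hB v h h'
  · rw [segEnds_append, segNew_append, add_add_add_comm]
    intro v hv
    rcases Multiset.mem_add.1 hv with hv | hv
    · rcases h6 v hv with h | h
      · exact Or.inl (hRR v (Or.inl h))
      · rcases Multiset.mem_add.1 h with h | h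
        · exact Or.inr (Multiset.mem_add.2 (Or.inl h))
        · exact Or.inl (hRR v (by tauto))
    · rcases h6' v hv with h | h
      · exact Or.inl (hRR v (by tauto))
      · rcases Multiset.mem_add.1 h with h | h
        · exact Or.inr (Multiset.mem_add.2 (Or.inr h))
        · exact Or.inl (hRR v (by tauto))

/-- Many sets of `c` vertices allow replacing `A` by `B`. -/
def TrP [Finite V] (E : V → V → V → V → V → Prop) (β : ℝ) (c : ℕ) (A B : Multiset V) : Prop :=
  β ≤ Pr (fun g : Fin c → V => Tr E (Set.range g) A B)

variable [Finite V]

lemma TrP.symm {β : ℝ} {c : ℕ} {A B : Multiset V} (h : TrP E β c A B) : TrP E β c B A :=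
  le_trans h (Pr_mono fun g => Tr.symm)

lemma TrP_of_card [Nonempty V] {β : ℝ} {c : ℕ} {A B : Multiset V} {ι : Type*} [Fintype ι]
    (hc : Fintype.card ι ≤ c) (h : β ≤ Pr (fun g : ι → V => Tr E (Set.range g) A B)) :
    TrP E β c A B := by
  obtain ⟨e⟩ := Function.Embedding.nonempty_of_card_le (α := ι) (β := Fin c) (by simpa using hc)
  have := Pr_comp_embedding (X := V) e (fun g : ι → V => Tr E (Set.range g) A B)
  refine h.trans (this.symm.trans_le (Pr_mono fun g hg => hg.mono ?_))
  rintro _ ⟨i, rfl⟩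
  exact ⟨e i, rfl⟩

lemma TrP.mono [Nonempty V] {β β' : ℝ} {c c' : ℕ} {A B : Multiset V} (hβ : β' ≤ β) (hc : c ≤ c')
    (h : TrP E β c A B) : TrP E β' c' A B :=
  TrP_of_card (by simpa using hc) (hβ.trans h)

lemma TrP.refl [Nonempty V] {β : ℝ} (hβ : β ≤ 1) (c : ℕ) (A : Multiset V) : TrP E β c A A := by
  refine hβ.trans (le_of_eq ?_)
  rw [Pr_congr (Q := fun _ => True) fun g => iff_of_true (Tr.refl _ _) trivial]
  unfold Pr; simp [av_const]

end

/-- Composition of replacements. -/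
theorem TrP.comp {δ β : ℝ} (hδ : 0 < δ) (hβ : 0 < β) (c k a : ℕ) :
    ∃ n₀ : ℕ, ∀ (V : Type) [Finite V], n₀ ≤ Nat.card V → ∀ (E : V → V → V → V → V → Prop)
      (A₁ A₂ B₁ B₂ : Multiset V) (M N : Multiset (Fin k)),
      (A₁ + A₂ + B₁ + B₂).card ≤ a → Disjoint A₁ A₂ → Disjoint B₁ B₂ → Disjoint M N →
      δ ≤ Pr (fun v : Fin k → V => TrP E β c (A₁ + M.map v) (B₁ + N.map v) ∧
        TrP E β c (A₂ + N.map v) (B₂ + M.map v)) →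
      TrP E (δ * β ^ 2 / 2) (k + (c + c)) (A₁ + A₂) (B₁ + B₂) := by
  set m := k + (c + c) with hm
  obtain ⟨n₁, hn₁⟩ := exists_nat_gt (((m : ℝ) ^ 2 + m * a) / (δ * β ^ 2 / 2))
  refine ⟨n₁ + 1, fun V _ hn E A₁ A₂ B₁ B₂ M N hcard hA hB hMN h => ?_⟩
  have hV : Nonempty V := (Nat.card_pos_iff.1 (by omega)).1
  have hVpos : (0:ℝ) < Nat.card V := by exact_mod_cast (by omega)
  let ι := Fin k ⊕ (Fin c ⊕ Fin c)
  have hι : Fintype.card ι = m := by simp [ι, hm]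
  let S := (A₁ + A₂ + B₁ + B₂).toFinset
  have hS : S.card ≤ a := (Multiset.toFinset_card_le _).trans hcard
  have h1 := Pr_prod_ge (Q := fun (v : Fin k → V) (g : (Fin c → V) × (Fin c → V)) =>
      Tr E (Set.range g.1) (A₁ + M.map v) (B₁ + N.map v) ∧
      Tr E (Set.range g.2) (A₂ + N.map v) (B₂ + M.map v)) (d := β ^ 2) (by positivity) h
      (fun v hv => by
        rw [Pr_indep (fun g : Fin c → V => Tr E (Set.range g) (A₁ + M.map v) (B₁ + N.map v))
          (fun g : Fin c → V => Tr E (Set.range g) (A₂ + N.map v) (B₂ + M.map v)), sq]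
        exact mul_le_mul hv.1 hv.2 hβ.le (Pr_nonneg _))
  have h2 : δ * β ^ 2 ≤ Pr (fun w : ι → V =>
      Tr E (Set.range fun i => w (Sum.inr (Sum.inl i))) (A₁ + M.map fun i => w (Sum.inl i))
        (B₁ + N.map fun i => w (Sum.inl i)) ∧
      Tr E (Set.range fun i => w (Sum.inr (Sum.inr i))) (A₂ + N.map fun i => w (Sum.inl i))
        (B₂ + M.map fun i => w (Sum.inl i))) := by
    have e1 := Pr_sumArrow (X := V) (fun (v : Fin k → V) (g : Fin c ⊕ Fin c → V) =>
      Tr E (Set.range fun i => g (Sum.inl i)) (A₁ + M.map v) (B₁ + N.map v) ∧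
      Tr E (Set.range fun i => g (Sum.inr i)) (A₂ + N.map v) (B₂ + M.map v))
    refine le_trans ?_ e1.symm.le
    refine (h1.trans (Pr_mono fun x hx => hx.2)).trans (le_of_eq ?_)
    rw [Pr_prod, Pr_prod]
    congr 1; funext v
    exact (Pr_sumArrow (X := V) (fun (g g' : Fin c → V) =>
      Tr E (Set.range g) (A₁ + M.map v) (B₁ + N.map v) ∧
      Tr E (Set.range g') (A₂ + N.map v) (B₂ + M.map v))).symm
  have hinj := Pr_not_injective (X := V) (κ := ι)
  have hhit := Pr_hit (κ := ι) S
  rw [hι] at hinj hhit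
  have h3 := Pr_and_ge h2 (Q := fun w : ι → V => Function.Injective w ∧ ¬ ∃ i, w i ∈ S)
    (d := (m : ℝ) ^ 2 / Nat.card V + m * S.card / Nat.card V)
    ((Pr_le_add fun w hw => by tauto).trans (add_le_add hinj hhit))
  refine TrP_of_card hι.le (le_trans ?_ (h3.trans (Pr_mono fun w hw => ?_)))
  · have hle : (m : ℝ) ^ 2 / Nat.card V + m * S.card / Nat.card V ≤ δ * β ^ 2 / 2 := by
      rw [← add_div, div_le_iff₀ hVpos]
      have h4 : (n₁ : ℝ) ≤ Nat.card V := by exact_mod_cast (by omega)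
      rw [div_lt_iff₀ (by positivity)] at hn₁
      have h5 : (S.card : ℝ) ≤ a := by exact_mod_cast hS
      have h6 : (m : ℝ) * S.card ≤ m * a := by gcongr
      have h7 : (n₁ : ℝ) * (δ * β ^ 2 / 2) ≤ Nat.card V * (δ * β ^ 2 / 2) := by gcongr
      linarith
    linarith
  · obtain ⟨⟨ht1, ht2⟩, hi, hno⟩ := hw
    have hno' : ∀ i, w i ∉ A₁ ∧ w i ∉ A₂ ∧ w i ∉ B₁ ∧ w i ∉ B₂ := fun i => by
      have := fun h => hno ⟨i, h⟩
      simp only [S, Multiset.mem_toFinset, Multiset.mem_add, not_or] at this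
      tauto
    have hmap : ∀ (P : Multiset (Fin k)) v, v ∈ P.map (fun i => w (Sum.inl i)) →
        ∃ i ∈ P, v = w (Sum.inl i) := fun P v hv => by
      obtain ⟨i, hi, rfl⟩ := Multiset.mem_map.1 hv
      exact ⟨i, hi, rfl⟩
    have hne : ∀ {i j}, i ≠ j → w i ≠ w j := fun h e => h (hi e)
    refine ht1.comp ht2 ?_ ?_ ?_ ?_ ?_ ?_
    · rintro _ ⟨i, rfl⟩ ⟨j, hj⟩
      exact absurd (Sum.inr_injective (@hi (Sum.inr (Sum.inr j)) (Sum.inr (Sum.inl i)) hj)) Sum.inr_ne_inl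
    · rintro _ ⟨i, rfl⟩
      simp only [Multiset.mem_add, not_or]
      refine ⟨⟨(hno' _).2.1, fun h => ?_⟩, (hno' _).2.2.2, fun h => ?_⟩ <;>
      · obtain ⟨j, -, hj⟩ := hmap _ _ h
        exact absurd (hi hj) (by simp)
    · rintro _ ⟨i, rfl⟩
      simp only [Multiset.mem_add, not_or]
      refine ⟨⟨(hno' _).1, fun h => ?_⟩, (hno' _).2.2.1, fun h => ?_⟩ <;>
      · obtain ⟨j, -, hj⟩ := hmap _ _ h
        exact absurd (hi hj) (by simp)
    · intro v hv hv'
      rcases Multiset.mem_add.1 hv with h | h <;> rcases Multiset.mem_add.1 hv' with h' | h'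
      · exact Multiset.disjoint_left.1 hA h h'
      · obtain ⟨j, -, rfl⟩ := hmap _ _ h'
        exact (hno' _).1 h
      · obtain ⟨j, -, rfl⟩ := hmap _ _ h
        exact (hno' _).2.1 h'
      · obtain ⟨j, hj, rfl⟩ := hmap _ _ h
        obtain ⟨j', hj', e⟩ := hmap _ _ h'
        have := Sum.inl_injective (hi e)
        subst this
        exact Multiset.disjoint_left.1 hMN hj hj'
    · intro v hv hv'
      rcases Multiset.mem_add.1 hv with h | h <;> rcases Multiset.mem_add.1 hv' with h' | h'
      · exact Multiset.disjoint_left.1 hB h h'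
      · obtain ⟨j, -, rfl⟩ := hmap _ _ h'
        exact (hno' _).2.2.1 h
      · obtain ⟨j, -, rfl⟩ := hmap _ _ h
        exact (hno' _).2.2.2 h'
      · obtain ⟨j, hj, rfl⟩ := hmap _ _ h
        obtain ⟨j', hj', e⟩ := hmap _ _ h'
        have := Sum.inl_injective (hi e)
        subst this
        exact Multiset.disjoint_left.1 hMN hj' hj
    · rintro v (⟨i, rfl⟩ | ⟨i, rfl⟩ | h | h)
      · exact ⟨_, rfl⟩
      · exact ⟨_, rfl⟩
      · obtain ⟨j, -, rfl⟩ := hmap _ _ h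
        exact ⟨_, rfl⟩
      · obtain ⟨j, -, rfl⟩ := hmap _ _ h
        exact ⟨_, rfl⟩

end

lemma Pr_true {α : Type*} [Finite α] [Nonempty α] {P : α → Prop} (h : ∀ a, P a) : Pr P = 1 := by
  rw [Pr_congr (Q := fun _ => True) fun g => iff_of_true (h g) trivial]
  unfold Pr; simp [av_const]

/-- Several independent replacements of single vertices. -/
theorem TrP.swaps {β : ℝ} (hβ : 0 < β) (c m : ℕ) : ∃ (β' : ℝ) (c' n₀ : ℕ), 0 < β' ∧
    ∀ (V : Type) [Finite V], n₀ ≤ Nat.card V → ∀ (E : V → V → V → V → V → Prop) (l l' : List V),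
      l.length = m → List.Forall₂ (fun x y => TrP E β c {x} {y}) l l' → l.Nodup → l'.Nodup →
      TrP E β' c' (l : Multiset V) (l' : Multiset V) := by
  induction m with
  | zero =>
    refine ⟨1, 0, 1, one_pos, fun V _ hn E l l' hl h _ _ => ?_⟩
    have hV : Nonempty V := (Nat.card_pos_iff.1 (by omega)).1
    obtain rfl := List.length_eq_zero_iff.1 hl
    cases h
    exact TrP.refl le_rfl _ _
  | succ m ih =>
    obtain ⟨β₁, c₁, n₁, hβ₁, H⟩ := ih
    obtain ⟨n₂, H₂⟩ := TrP.comp one_pos (lt_min hβ hβ₁) (max c c₁) 0 (2 * m + 2)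
    refine ⟨1 * min β β₁ ^ 2 / 2, 0 + (max c c₁ + max c c₁), max n₁ (n₂ + 1),
      by have := lt_min hβ hβ₁; positivity, fun V _ hn E l l' hl h hd hd' => ?_⟩
    have hV : Nonempty V := (Nat.card_pos_iff.1 (by omega)).1
    obtain _ | ⟨hx, ht⟩ := h
    · simp at hl
    rename_i x y l l'
    have hl' := ht.length_eq
    simp only [List.length_cons] at hl
    rw [List.nodup_cons] at hd hd'
    have h1 := H V (by omega) E l l' (by omega) ht hd.2 hd'.2
    have := H₂ V (by omega) E {x} l {y} l' 0 0 (by simp; omega) (by simpa using hd.1)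
      (by simpa using hd'.1) (by simp) (by
        rw [Pr_true]
        intro v
        simp only [Multiset.map_zero, add_zero]
        exact ⟨hx.mono (min_le_left _ _) (le_max_left _ _),
          h1.mono (min_le_right _ _) (le_max_right _ _)⟩)
    simpa using this

/-- A dense family of local configurations gives replacements. -/
theorem gadget {δ : ℝ} (hδ : 0 < δ) (k r a : ℕ) : ∃ n₀ : ℕ, ∀ (V : Type) [Finite V],
    n₀ ≤ Nat.card V → ∀ (E : V → V → V → V → V → Prop) (S : Finset V) (A B : Multiset V)
      (M N : Multiset (Fin k)) (G : (Fin k → V) → (Fin r → V) → Prop), S.card ≤ a →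
      δ ≤ Pr (fun x : (Fin k → V) × (Fin r → V) => G x.1 x.2) →
      (∀ v w, G v w → Function.Injective (Sum.elim v w) → (∀ i, v i ∉ S) → (∀ i, w i ∉ S) →
        Tr E (Set.range w) (A + M.map v) (B + N.map v)) →
      δ / 4 ≤ Pr (fun v : Fin k → V => TrP E (δ / 4) r (A + M.map v) (B + N.map v) ∧
        Function.Injective v ∧ (∀ i, v i ∉ S) ∧ ∃ w, G v w) := by
  obtain ⟨n₁, hn₁⟩ := exists_nat_gt ((((k + r : ℕ) : ℝ) ^ 2 + (k + r : ℕ) * a) / (δ / 2))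
  refine ⟨n₁ + 1, fun V _ hn E S A B M N G hS hG hTr => ?_⟩
  have hV : Nonempty V := (Nat.card_pos_iff.1 (by omega)).1
  have hVpos : (0:ℝ) < Nat.card V := by exact_mod_cast (by omega)
  set Bad : (Fin k → V) × (Fin r → V) → Prop := fun x =>
    ¬ (Function.Injective (Sum.elim x.1 x.2) ∧ ¬ ∃ i, Sum.elim x.1 x.2 i ∈ S) with hBad
  have h1 : Pr Bad ≤ δ / 2 := by
    have e := Pr_sumArrow (X := V) (fun (v : Fin k → V) (w : Fin r → V) => Bad (v, w))
    have e' : Pr (fun h : Fin k ⊕ Fin r → V => Bad (fun i => h (Sum.inl i), fun i => h (Sum.inr i))) ≤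
        δ / 2 := by
      have he : ∀ h : Fin k ⊕ Fin r → V, Sum.elim (fun i => h (Sum.inl i)) (fun i => h (Sum.inr i)) = h :=
        fun h => by ext i; cases i <;> rfl
      simp only [hBad, he]
      refine (Pr_le_add fun h hh => by tauto).trans ((add_le_add (Pr_not_injective (X := V))
        (Pr_hit S)).trans ?_)
      simp only [Fintype.card_sum, Fintype.card_fin]
      rw [← add_div, div_le_iff₀ hVpos]
      rw [div_lt_iff₀ (by positivity)] at hn₁
      have h4 : (n₁ : ℝ) ≤ Nat.card V := by exact_mod_cast (by omega)
      have h5 : (S.card : ℝ) ≤ a := by exact_mod_cast hS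
      have h6 : ((k + r : ℕ) : ℝ) * S.card ≤ (k + r : ℕ) * a := by gcongr
      have h7 : (n₁ : ℝ) * (δ / 2) ≤ Nat.card V * (δ / 2) := by gcongr
      linarith
    exact e.symm.trans_le e'
  have h2 := Pr_fibre (Pr_and_ge hG (Q := fun x : (Fin k → V) × (Fin r → V) =>
    Function.Injective (Sum.elim x.1 x.2) ∧ ¬ ∃ i, Sum.elim x.1 x.2 i ∈ S) h1)
  rw [show (δ - δ / 2) / 2 = δ / 4 by ring] at h2
  refine h2.trans (Pr_mono fun v hv => ?_)
  obtain ⟨w, hw⟩ := exists_of_Pr_pos (lt_of_lt_of_le (by positivity) hv)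
  refine ⟨hv.trans (Pr_mono fun w hw => hTr v w hw.1 hw.2.1 (fun i hi => hw.2.2 ⟨Sum.inl i, hi⟩)
    (fun i hi => hw.2.2 ⟨Sum.inr i, hi⟩)), fun i j h => ?_, fun i hi => hw.2.2 ⟨Sum.inl i, hi⟩, w, hw.1⟩
  exact Sum.inl_injective (hw.2.1 (a₁ := Sum.inl i) (a₂ := Sum.inl j) h)

lemma Sym5.nodup {V : Type*} {E : V → V → V → V → V → Prop} (hE : Sym5 E) {a b c d e : V}
    (h : E a b c d e) : [a, b, c, d, e].Nodup := by
  have h1 := hE.s4 (hE.s3 (hE.s2 (hE.s1 h)))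
  have h2 := hE.s4 (hE.s3 (hE.s2 (hE.s1 h1)))
  have h3 := hE.s4 (hE.s3 (hE.s2 (hE.s1 h2)))
  have h4 := hE.s4 (hE.s3 (hE.s2 (hE.s1 h3)))
  simp only [List.nodup_cons, List.mem_cons, List.not_mem_nil, not_or, or_false, not_false_eq_true,
    List.nodup_nil, and_true]
  exact ⟨⟨hE.ne h, hE.ne (hE.s2 h), (hE.ne (hE.s2 h3)).symm, (hE.ne h4).symm⟩,
    ⟨hE.ne h1, hE.ne (hE.s2 h1), (hE.ne (hE.s2 h4)).symm⟩, ⟨hE.ne h2, hE.ne (hE.s2 h2)⟩, hE.ne h3⟩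

section

lemma Tr.single {V : Type*} {E : V → V → V → V → V → Prop} {R : Set V} {A B : Multiset V}
    {p q : V × V} {L L' : List V} (h : Conn E p q L) (h' : Conn E p q L')
    (hAB : (L' : Multiset V) + A = L + B) (hn : (verts p q L).Nodup)
    (hm : ∀ v ∈ verts p q L, v ∈ R ∨ v ∈ A) (hn' : (verts p q L').Nodup)
    (hm' : ∀ v ∈ verts p q L', v ∈ R ∨ v ∈ B) : Tr E R A B := by
  have e : ∀ L'' : List V, ({p.1, p.2, q.1, q.2} : Multiset V) + L'' = (verts p q L'' : Multiset V) :=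
    fun L'' => by simp [verts]
  refine ⟨[(p, q, L, L')], by simpa using ⟨h, h'⟩, by simpa [segOld, segNew] using hAB, ?_, ?_⟩
  · simp only [segEnds, segOld, List.map_cons, List.map_nil, List.sum_cons, List.sum_nil, add_zero]
    rw [e]
    exact ⟨by simpa using hn, by simpa using hm⟩
  · simp only [segEnds, segNew, List.map_cons, List.map_nil, List.sum_cons, List.sum_nil, add_zero]
    rw [e]
    exact ⟨by simpa using hn', by simpa using hm'⟩

/-- Composition through many intermediate vertices. -/
theorem TrP.through {δ β : ℝ} (hδ : 0 < δ) (hβ : 0 < β) (c : ℕ) : ∃ (β' : ℝ) (c' n₀ : ℕ), 0 < β' ∧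
    ∀ (V : Type) [Finite V], n₀ ≤ Nat.card V → ∀ (E : V → V → V → V → V → Prop) (x y : V),
      δ ≤ Pr (fun z => TrP E β c {x} {z} ∧ TrP E β c {z} {y}) → TrP E β' c' {x} {y} := by
  obtain ⟨n₀, H⟩ := TrP.comp hδ hβ c 1 2
  refine ⟨δ * β ^ 2 / 2, 1 + (c + c), n₀ + 1, by positivity, fun V _ hn E x y h => ?_⟩
  have hV : Nonempty V := (Nat.card_pos_iff.1 (by omega)).1
  have := H V (by omega) E {x} 0 0 {y} 0 {0} (by simp) (by simp) (by simp) (by simp) (by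
    rw [← Pr_apply (κ := Fin 1) (0 : Fin 1)] at h
    simpa using h)
  simpa using this

section
variable {V : Type} [Finite V] {E : V → V → V → V → V → Prop}

/-- The links of `x` and `y` share many 4-tuples. -/
def Near (E : V → V → V → V → V → Prop) (x y : V) : Prop :=
  1 / 20 ≤ Pr (fun F : Fin 4 → V => E (F 0) (F 1) x (F 2) (F 3) ∧ E (F 0) (F 1) y (F 2) (F 3))

lemma Near.symm {x y : V} (h : Near E x y) : Near E y x := h.trans (Pr_mono fun _ h => h.symm)

lemma Near.trP (hE : Sym5 E) {x y : V} (h : Near E x y) : TrP E (1 / 20) 4 {x} {y} := by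
  refine h.trans (Pr_mono fun F hF => ?_)
  have h1 := hE.nodup hF.1
  have h2 := hE.nodup hF.2
  refine Tr.single (p := (F 0, F 1)) (q := (F 2, F 3)) (Conn.edge hF.1) (Conn.edge hF.2)
    (by simp [add_comm]) ?_ ?_ ?_ ?_
  · simp only [verts, List.nodup_cons, List.mem_cons, List.not_mem_nil] at h1 ⊢; grind
  · simp [verts]
  · simp only [verts, List.nodup_cons, List.mem_cons, List.not_mem_nil] at h2 ⊢; grind
  · simp [verts]

lemma Pr_ne [Nonempty V] (hn : 20 ≤ Nat.card V) (x : V) : 19 / 20 ≤ Pr (fun y => y ≠ x) := by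
  have := Fintype.ofFinite V
  rw [Pr_not, Pr_eq_single, ← Nat.card_eq_fintype_card]
  have : (20:ℝ) ≤ Nat.card V := by exact_mod_cast hn
  have : (1:ℝ) / Nat.card V ≤ 1 / 20 := by gcongr
  linarith

lemma vertex_degree [Nonempty V]
    (hdeg : ∀ x y, x ≠ y → 91 / 216 ≤ Pr (fun t : V × V × V => E x y t.1 t.2.1 t.2.2))
    (hn : 20 ≤ Nat.card V) (x : V) :
    23 / 60 ≤ Pr (fun t : V × V × V × V => E x t.1 t.2.1 t.2.2.1 t.2.2.2) := by
  have := Pr_prod_ge (Q := fun y (t : V × V × V) => E x y t.1 t.2.1 t.2.2) (by norm_num)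
    (Pr_ne hn x) (fun y hy => hdeg x y hy.symm)
  refine le_trans (by norm_num) (this.trans (Pr_mono fun t ht => ht.2))

lemma near_or_near [Nonempty V] (hE : Sym5 E)
    (hdeg : ∀ x y, x ≠ y → 91 / 216 ≤ Pr (fun t : V × V × V => E x y t.1 t.2.1 t.2.2))
    (hn : 20 ≤ Nat.card V) (x y z : V) :
    Near E x y ∨ Near E x z ∨ Near E y z := by
  have key : ∀ v, 23 / 60 ≤ Pr (fun F : Fin 4 → V => E (F 0) (F 1) v (F 2) (F 3)) := fun v => by
    let e : V × V × V × V ≃ (Fin 4 → V) :=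
      { toFun := fun t => ![t.1, t.2.1, t.2.2.1, t.2.2.2]
        invFun := fun F => (F 0, F 1, F 2, F 3)
        left_inv := fun t => rfl
        right_inv := fun F => by ext i; fin_cases i <;> rfl }
    rw [← Pr_equiv e]
    refine (vertex_degree hdeg hn v).trans (Pr_mono fun t ht => ?_)
    exact hE.s2 (hE.s1 ht)
  have hx := key x
  have hy := key y
  have hz := key z
  have hb : ∀ X Y Z : (Fin 4 → V) → Prop, Pr X + Pr Y + Pr Z ≤
      1 + (Pr fun a => X a ∧ Y a) + (Pr fun a => X a ∧ Z a) + Pr fun a => Y a ∧ Z a := by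
    intro X Y Z
    unfold Pr
    rw [← av_const (α := Fin 4 → V) 1, ← av_add, ← av_add, ← av_add, ← av_add, ← av_add]
    refine av_mono fun a => ?_
    by_cases h1 : X a <;> by_cases h2 : Y a <;> by_cases h3 : Z a <;> simp [h1, h2, h3, av_const]
  have := hb (fun F => E (F 0) (F 1) x (F 2) (F 3)) (fun F => E (F 0) (F 1) y (F 2) (F 3))
    (fun F => E (F 0) (F 1) z (F 2) (F 3))
  unfold Near
  by_contra! hc
  linarith [hc.1, hc.2.1, hc.2.2]

end

end

section

section
variable {V : Type} [Finite V] [Nonempty V] {E : V → V → V → V → V → Prop}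

/-- The configurations attaching an arbitrary vertex `x` to an almost arbitrary one. -/
def Attach (E : V → V → V → V → V → Prop) (x : V) (v : Fin 7 → V) (w : Fin 4 → V) : Prop :=
  E (w 0) (w 1) (v 0) (v 1) (v 2) ∧ E (v 1) (v 2) x (w 2) (w 3) ∧
    E (w 0) (w 1) (v 3) (v 4) (v 5) ∧ E (v 4) (v 5) (v 6) (w 2) (w 3)

lemma Attach.tr (hE : Sym5 E) {x : V} {v : Fin 7 → V} {w : Fin 4 → V} (h : Attach E x v w)
    (hi : Function.Injective (Sum.elim v w)) (hv : ∀ i, v i ≠ x) (hw : ∀ i, w i ≠ x) :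
    Tr E (Set.range w) ({x} + ({0, 1, 2} : Multiset (Fin 7)).map v)
      (0 + ({3, 4, 5, 6} : Multiset (Fin 7)).map v) := by
  have h1 : ([Sum.inr 0, Sum.inr 1, Sum.inr 2, Sum.inr 3, Sum.inl 0, Sum.inl 1, Sum.inl 2].map
      (Sum.elim v w)).Nodup := List.Nodup.map hi (by decide)
  have h2 : ([Sum.inr 0, Sum.inr 1, Sum.inr 2, Sum.inr 3, Sum.inl 3, Sum.inl 4, Sum.inl 5,
      Sum.inl 6].map (Sum.elim v w)).Nodup := List.Nodup.map hi (by decide)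
  refine Tr.single (p := (w 0, w 1)) (q := (w 2, w 3))
    (Conn.step (s := v 0) (r := (v 1, v 2)) h.1 (Conn.edge (s := x) h.2.1))
    (Conn.step (s := v 3) (r := (v 4, v 5)) h.2.2.1 (Conn.edge (s := v 6) h.2.2.2)) ?_ ?_ ?_ h2 ?_
  · simp only [← Multiset.cons_coe, Multiset.coe_nil, Multiset.map_cons, Multiset.insert_eq_cons,
      Multiset.map_singleton]
    simp only [← Multiset.singleton_add]
    abel
  · refine List.Nodup.append h1 (List.nodup_singleton x) ?_
    simp [hv, hw, eq_comm]
    grind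
  · intro a ha
    simp only [verts, List.mem_cons, List.not_mem_nil, or_false] at ha
    rcases ha with rfl | rfl | rfl | rfl | rfl | rfl | rfl | rfl <;> simp
  · intro a ha
    simp only [verts, List.mem_cons, List.not_mem_nil, or_false] at ha
    rcases ha with rfl | rfl | rfl | rfl | rfl | rfl | rfl | rfl <;> simp

lemma Attach.many (hE : Sym5 E)
    (hdeg : ∀ x y, x ≠ y → 91 / 216 ≤ Pr (fun t : V × V × V => E x y t.1 t.2.1 t.2.2))
    (hn : 20 ≤ Nat.card V) (x : V) :
    12 / 100000000 ≤ Pr (fun y : (Fin 7 → V) × (Fin 4 → V) => Attach E x y.1 y.2) := by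
  have h1 := Pr_prod_ge (Q := fun (a : V × V × V × V) (t : V × V × V) =>
      E a.1 a.2.1 t.1 t.2.1 t.2.2) (d := 91 / 216) (by norm_num) (vertex_degree hdeg hn x)
      (fun a ha => hdeg _ _ (hE.ne (hE.s2 (hE.s1 ha))))
  have h2 := Pr_prod_ge (Q := fun (a : (V × V × V × V) × (V × V × V)) (z : (V × V) × V × V) =>
      E a.2.1 a.2.2.1 z.2.1 z.1.1 z.1.2 ∧ E z.1.1 z.1.2 z.2.2 a.1.2.2.1 a.1.2.2.2)
      (d := 1 / 625000) (by norm_num) h1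
      (fun a ha => connecting hE hdeg (p := (a.2.1, a.2.2.1)) (q := (a.1.2.2.1, a.1.2.2.2))
        (hE.ne (hE.s2 (hE.s1 (hE.s3 (hE.s2 ha.2)))))
        (hE.ne (hE.rev ha.1)))
  let e : ((V × V × V × V) × (V × V × V)) × ((V × V) × V × V) ≃ (Fin 7 → V) × (Fin 4 → V) :=
    { toFun := fun t => (![t.1.2.2.2, t.1.1.1, t.1.1.2.1, t.2.2.1, t.2.1.1, t.2.1.2, t.2.2.2],
        ![t.1.2.1, t.1.2.2.1, t.1.1.2.2.1, t.1.1.2.2.2])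
      invFun := fun F => (((F.1 1, F.1 2, F.2 2, F.2 3), (F.2 0, F.2 1, F.1 0)),
        ((F.1 4, F.1 5), F.1 3, F.1 6))
      left_inv := fun t => rfl
      right_inv := fun F => by
        refine Prod.ext ?_ ?_ <;> ext i <;> fin_cases i <;> rfl }
  rw [← Pr_equiv e]
  refine le_trans (by norm_num) (h2.trans (Pr_mono fun t ht => ?_))
  obtain ⟨⟨h3, h4⟩, h5, h6⟩ := ht
  refine ⟨?_, ?_, h5, h6⟩
  · exact hE.s3 (hE.s4 (hE.s2 (hE.s3 (hE.s1 (hE.s2 h4)))))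
  · exact hE.s2 (hE.s1 h3)

end

/-- If almost all vertices are mutually exchangeable then all are. -/
theorem TrP.extend {β : ℝ} (hβ : 0 < β) (c : ℕ) : ∃ (β' : ℝ) (c' n₀ : ℕ), 0 < β' ∧
    ∀ (V : Type) [Finite V], n₀ ≤ Nat.card V → ∀ (E : V → V → V → V → V → Prop), Sym5 E →
      (∀ x y, x ≠ y → 91 / 216 ≤ Pr (fun t : V × V × V => E x y t.1 t.2.1 t.2.2)) →
      ∀ U : V → Prop, Pr (fun v => ¬ U v) ≤ 1 / 100000000 →
      (∀ x y, U x → U y → TrP E β c {x} {y}) → ∀ x y, TrP E β' c' {x} {y} := by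
  obtain ⟨β₁, c₁, n₁, hβ₁, H₁⟩ := TrP.swaps hβ c 4
  obtain ⟨δ, hδ, hδ'⟩ : ∃ δ : ℝ, 0 < δ ∧ δ = 5 / 100000000 := ⟨_, by norm_num, rfl⟩
  obtain ⟨n₂, H₂⟩ := gadget hδ 7 4 2
  obtain ⟨n₃, H₃⟩ := TrP.comp (δ := δ / 4) (by positivity) (lt_min hβ₁ (show 0 < δ / 4 by positivity))
    (max c₁ 4) 7 2
  have hβ₃ : 0 < δ / 4 * min β₁ (δ / 4) ^ 2 / 2 := by
    have := lt_min hβ₁ (show 0 < δ / 4 by positivity); positivity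
  obtain ⟨β₄, c₄, n₄, hβ₄, H₄⟩ := TrP.through (δ := 1 / 2) (by norm_num) hβ₃ (7 + (max c₁ 4 + max c₁ 4))
  refine ⟨β₄, c₄, n₁ + n₂ + n₃ + n₄ + 20, hβ₄, fun V _ hn E hE hdeg U hU hcl => ?_⟩
  have hV : Nonempty V := (Nat.card_pos_iff.1 (by omega)).1
  have key : ∀ x y, U y → TrP E (δ / 4 * min β₁ (δ / 4) ^ 2 / 2) (7 + (max c₁ 4 + max c₁ 4)) {x} {y} := by
    intro x y hy
    have hU7 : Pr (fun z : (Fin 7 → V) × (Fin 4 → V) => ¬ ∀ i, U (z.1 i)) ≤ 7 / 100000000 := by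
      rw [Pr_fst (fun v : Fin 7 → V => ¬ ∀ i, U (v i))]
      have := Pr_exists_le (α := Fin 7 → V) (fun (i : Fin 7) v => ¬ U (v i))
      refine (Pr_mono fun v hv => not_forall.1 hv).trans (this.trans ?_)
      refine (Finset.sum_le_sum (g := fun _ => (1 / 100000000 : ℝ)) fun i _ => ?_).trans (by simp; norm_num)
      rw [Pr_apply i (fun v => ¬ U v)]; exact hU
    have h1 := Pr_and_ge (Attach.many hE hdeg (by omega) x) hU7
    have h2 := H₂ V (by omega) E {x, y} {x} 0 {0, 1, 2} {3, 4, 5, 6}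
      (fun v w => Attach E x v w ∧ ∀ i, U (v i)) Finset.card_le_two (le_trans (by rw [hδ']; norm_num) h1)
      (fun v w h hi hv hw => h.1.tr hE hi (fun i hi => hv i (by simp [hi])) (fun i hi => hw i (by simp [hi])))
    have h3 := H₃ V (by omega) E {x} 0 0 {y} {0, 1, 2} {3, 4, 5, 6} (by simp) (by simp) (by simp)
      (Multiset.disjoint_left.2 (by decide)) (h2.trans (Pr_mono fun v hv => ?_))
    · simpa using h3
    · obtain ⟨ht, hi, hS, w, -, hUv⟩ := hv
      refine ⟨ht.mono (min_le_right _ _) (le_max_right _ _), ?_⟩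
      have := H₁ V (by omega) E [v 3, v 4, v 5, v 6] [y, v 0, v 1, v 2] rfl
        (by simp [hcl, hUv, hy]) (List.Nodup.map (l := [3, 4, 5, 6]) hi (by decide))
        (List.nodup_cons.2 ⟨?_, List.Nodup.map (l := [0, 1, 2]) hi (by decide)⟩)
      · exact this.mono (min_le_left _ (δ / 4)) (le_max_left _ 4)
      · have : ∀ i, y ≠ v i := fun i h => hS i (by simp [h])
        simp [this]
  intro x y
  refine H₄ V (by omega) E x y ?_
  have : 1 / 2 ≤ Pr U := by
    have h := Pr_not (α := V) U
    linarith
  exact this.trans (Pr_mono fun z hz => ⟨key x z hz, (key y z hz).symm⟩)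

end

section

/-- Dense families of bipartite graphs contain many paths with three edges. -/
lemma three_path {Z X Y : Type*} [Finite Z] [Finite X] [Finite Y] [Nonempty Z] [Nonempty X]
    [Nonempty Y] (K : Z → X → Y → Prop) {h : ℝ} (h0 : 0 ≤ h)
    (hK : h ≤ Pr (fun t : Z × X × Y => K t.1 t.2.1 t.2.2)) :
    h / 2 * (h / 4 * (h / 4)) ≤ Pr (fun t : (Z × X × Y) × X × Y =>
      K t.1.1 t.1.2.1 t.1.2.2 ∧ K t.1.1 t.2.1 t.1.2.2 ∧ K t.1.1 t.1.2.1 t.2.2) := by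
  have h1 : Pr (fun t : Z × X × Y => K t.1 t.2.1 t.2.2 ∧ ¬ h / 4 ≤ Pr (fun y => K t.1 t.2.1 y)) ≤
      h / 4 := by
    rw [← Pr_equiv (Equiv.prodAssoc Z X Y)]
    exact Pr_del (P := fun t : (Z × X) × Y => K t.1.1 t.1.2 t.2) (by positivity)
  have h2 : Pr (fun t : Z × X × Y => K t.1 t.2.1 t.2.2 ∧ ¬ h / 4 ≤ Pr (fun x => K t.1 x t.2.2)) ≤
      h / 4 := by
    let e : (Z × Y) × X ≃ Z × X × Y :=
      { toFun := fun t => (t.1.1, t.2, t.1.2)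
        invFun := fun t => ((t.1, t.2.2), t.2.1)
        left_inv := fun t => rfl
        right_inv := fun t => rfl }
    rw [← Pr_equiv e]
    exact Pr_del (P := fun t : (Z × Y) × X => K t.1.1 t.2 t.1.2) (by positivity)
  have h3 : h / 2 ≤ Pr (fun t : Z × X × Y => K t.1 t.2.1 t.2.2 ∧
      h / 4 ≤ Pr (fun y => K t.1 t.2.1 y) ∧ h / 4 ≤ Pr (fun x => K t.1 x t.2.2)) := by
    have h4 : Pr (fun t : Z × X × Y => K t.1 t.2.1 t.2.2) ≤ _ :=
      Pr_le_add (Q := fun t : Z × X × Y => K t.1 t.2.1 t.2.2 ∧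
        h / 4 ≤ Pr (fun y => K t.1 t.2.1 y) ∧ h / 4 ≤ Pr (fun x => K t.1 x t.2.2))
        (R := fun t => (K t.1 t.2.1 t.2.2 ∧ ¬ h / 4 ≤ Pr (fun y => K t.1 t.2.1 y)) ∨
          (K t.1 t.2.1 t.2.2 ∧ ¬ h / 4 ≤ Pr (fun x => K t.1 x t.2.2))) (fun t ht => by tauto)
    have h5 := Pr_le_add (P := fun t : Z × X × Y =>
      (K t.1 t.2.1 t.2.2 ∧ ¬ h / 4 ≤ Pr (fun y => K t.1 t.2.1 y)) ∨
          (K t.1 t.2.1 t.2.2 ∧ ¬ h / 4 ≤ Pr (fun x => K t.1 x t.2.2))) (fun t ht => ht)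
    linarith
  refine (Pr_prod_ge (Q := fun (t : Z × X × Y) (s : X × Y) => K t.1 s.1 t.2.2 ∧ K t.1 t.2.1 s.2)
    (by positivity) h3 (fun t ht => ?_)).trans (Pr_mono fun t ht => ⟨ht.1.1, ht.2⟩)
  rw [Pr_indep (fun x => K t.1 x t.2.2) (fun y => K t.1 t.2.1 y)]
  exact mul_le_mul ht.2.2 ht.2.1 (by positivity) (Pr_nonneg _)

section
variable {V : Type} [Finite V] [Nonempty V] {E : V → V → V → V → V → Prop}

/-- The configurations exchanging vertices of two classes. -/
def Cross (E : V → V → V → V → V → Prop) (U W : V → Prop) (v : Fin 2 → V) (w : Fin 7 → V) : Prop :=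
  E (w 0) (w 1) (w 4) (w 5) (w 6) ∧ E (w 5) (w 6) (v 0) (w 2) (w 3) ∧
    E (w 4) (w 5) (v 1) (w 2) (w 3) ∧ U (v 0) ∧ W (v 1)

lemma Cross.tr (hE : Sym5 E) {U W : V → Prop} {v : Fin 2 → V} {w : Fin 7 → V} (h : Cross E U W v w)
    (hi : Function.Injective (Sum.elim v w)) :
    Tr E (Set.range w) (0 + ({0} : Multiset (Fin 2)).map v) (0 + ({1} : Multiset (Fin 2)).map v) := by
  have h1 : ([Sum.inr 0, Sum.inr 1, Sum.inr 2, Sum.inr 3, Sum.inr 4, Sum.inr 5, Sum.inr 6, Sum.inl 0].map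
      (Sum.elim v w)).Nodup := List.Nodup.map hi (by decide)
  have h2 : ([Sum.inr 0, Sum.inr 1, Sum.inr 2, Sum.inr 3, Sum.inr 6, Sum.inr 4, Sum.inr 5, Sum.inl 1].map
      (Sum.elim v w)).Nodup := List.Nodup.map hi (by decide)
  refine Tr.single (p := (w 0, w 1)) (q := (w 2, w 3))
    (Conn.step (s := w 4) (r := (w 5, w 6)) h.1 (Conn.edge (s := v 0) h.2.1))
    (Conn.step (s := w 6) (r := (w 4, w 5)) (hE.s3 (hE.s4 h.1)) (Conn.edge (s := v 1) h.2.2.1)) ?_ h1 ?_ h2 ?_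
  · simp only [← Multiset.cons_coe, Multiset.coe_nil, Multiset.map_singleton]
    simp only [← Multiset.singleton_add]
    abel
  · intro a ha
    simp only [verts, List.mem_cons, List.not_mem_nil, or_false] at ha
    rcases ha with rfl | rfl | rfl | rfl | rfl | rfl | rfl | rfl <;> simp
  · intro a ha
    simp only [verts, List.mem_cons, List.not_mem_nil, or_false] at ha
    rcases ha with rfl | rfl | rfl | rfl | rfl | rfl | rfl | rfl <;> simp

lemma Cross.many (hE : Sym5 E)
    (hdeg : ∀ x y, x ≠ y → 91 / 216 ≤ Pr (fun t : V × V × V => E x y t.1 t.2.1 t.2.2))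
    {U W : V → Prop} (hUW : ∀ v, U v → ¬ W v) {δ h : ℝ} (hδ : 0 < δ) (hU : δ ≤ Pr U) (hW : δ ≤ Pr W)
    (hh : h = δ * δ * (91 / 216)) :
    h / 4 * (h / 8 * (h / 8)) * (h / 2) ≤
      Pr (fun y : (Fin 2 → V) × (Fin 7 → V) => Cross E U W y.1 y.2) := by
  have hpos : 0 < h := by rw [hh]; positivity
  let P : (V × V × V) × (V × V) → Prop := fun t =>
    U t.1.2.1 ∧ W t.1.2.2 ∧ E t.1.1 t.1.2.1 t.1.2.2 t.2.1 t.2.2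
  have h1 : h ≤ Pr P := by
    have h2 := Pr_prod_ge (P := fun a : V × V => U a.1 ∧ W a.2)
      (Q := fun (a : V × V) (t : V × V × V) => E a.1 a.2 t.1 t.2.1 t.2.2) (c := δ * δ) (d := 91 / 216)
      (by norm_num) (by
        rw [Pr_indep]
        exact mul_le_mul hU hW hδ.le (Pr_nonneg _)) (fun a ha => hdeg _ _ fun e => hUW _ ha.1 (e ▸ ha.2))
    let e : (V × V) × V × V × V ≃ (V × V × V) × (V × V) :=
      { toFun := fun t => ((t.2.1, t.1.1, t.1.2), t.2.2)
        invFun := fun t => ((t.1.2.1, t.1.2.2), t.1.1, t.2)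
        left_inv := fun t => rfl
        right_inv := fun t => rfl }
    rw [← Pr_equiv e, hh]
    exact h2.trans (Pr_mono fun t ht => ⟨ht.1.1, ht.1.2, hE.s1 (hE.s2 ht.2)⟩)
  have h3 : h / 2 ≤ Pr (fun t => P t ∧ h / 2 ≤ Pr fun q => P (t.1, q)) := by
    have h4 := Pr_del (P := P) (θ := h / 2) (by positivity)
    have h5 := Pr_le_add (P := P) (Q := fun t => P t ∧ h / 2 ≤ Pr fun q => P (t.1, q))
      (R := fun t => P t ∧ ¬ h / 2 ≤ Pr fun q => P (t.1, q)) fun t ht => by tauto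
    linarith
  let e' : (V × V × V) × (V × V) ≃ (V × V × V) × (V × V) :=
    { toFun := fun t => ((t.1.1, t.2.1, t.2.2), (t.1.2.1, t.1.2.2))
      invFun := fun t => ((t.1.1, t.2), (t.1.2.1, t.1.2.2))
      left_inv := fun t => rfl
      right_inv := fun t => rfl }
  rw [← Pr_equiv e'] at h3
  have h6 := three_path (fun (z : V × V × V) u w => P ((z.1, u, w), z.2) ∧
    h / 2 ≤ Pr fun q => P ((z.1, u, w), q)) (h := h / 2) (by positivity) h3
  have h7 := Pr_prod_ge (Q := fun (t : ((V × V × V) × V × V) × V × V) (p : V × V) =>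
    P ((t.1.1.1, t.1.2.1, t.1.2.2), p)) (d := h / 2) (by positivity) h6 (fun t ht => ht.1.2)
  let e : (((V × V × V) × V × V) × V × V) × V × V ≃ (Fin 2 → V) × (Fin 7 → V) :=
    { toFun := fun t => (![t.1.2.1, t.1.2.2],
        ![t.2.1, t.2.2, t.1.1.1.2.1, t.1.1.1.2.2, t.1.1.2.1, t.1.1.1.1, t.1.1.2.2])
      invFun := fun F => ((((F.2 5, F.2 2, F.2 3), F.2 4, F.2 6), F.1 0, F.1 1), F.2 0, F.2 1)
      left_inv := fun t => rfl
      right_inv := fun F => by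
        refine Prod.ext ?_ ?_ <;> ext i <;> fin_cases i <;> rfl }
  rw [← Pr_equiv e]
  refine le_trans (le_of_eq (by ring)) (h7.trans (Pr_mono fun t ht => ?_))
  obtain ⟨⟨⟨h1, -⟩, ⟨h2, -⟩, ⟨h3, -⟩⟩, h4⟩ := ht
  refine ⟨?_, ?_, ?_, h2.1, h3.2.1⟩
  · exact hE.s3 (hE.s4 (hE.s3 (hE.rev h4.2.2)))
  · exact hE.s2 h2.2.2
  · exact hE.s1 h3.2.2

end

theorem exists_closed : ∃ (β : ℝ) (c n₀ : ℕ), 0 < β ∧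
    ∀ (V : Type) [Finite V], n₀ ≤ Nat.card V → ∀ (E : V → V → V → V → V → Prop), Sym5 E →
      (∀ x y, x ≠ y → 91 / 216 ≤ Pr (fun t : V × V × V => E x y t.1 t.2.1 t.2.2)) →
      ∃ U : V → Prop, Pr (fun v => ¬ U v) ≤ 1 / 100000000 ∧
        ∀ x y, U x → U y → TrP E β c {x} {y} := by
  obtain ⟨δ, hδ, hδ'⟩ : ∃ δ : ℝ, 0 < δ ∧ δ = 1 / 1000000000 := ⟨_, by norm_num, rfl⟩
  obtain ⟨β₁, c₁, n₁, hβ₁, H₁⟩ := TrP.through hδ (show (0:ℝ) < 1 / 20 by norm_num) 4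
  obtain ⟨τ, hτ, hτ'⟩ : ∃ τ : ℝ, 0 < τ ∧ τ = (δ * δ * (91 / 216)) / 4 * ((δ * δ * (91 / 216)) / 8 *
    ((δ * δ * (91 / 216)) / 8)) * ((δ * δ * (91 / 216)) / 2) := ⟨_, by positivity, rfl⟩
  obtain ⟨n₂, H₂⟩ := gadget hτ 2 7 0
  obtain ⟨β₃, c₃, n₃, hβ₃, H₃⟩ := TrP.swaps (show (0:ℝ) < 1 / 20 by norm_num) 4 2
  have hm := lt_min hβ₃ (show 0 < τ / 4 by positivity)
  obtain ⟨n₄, H₄⟩ := TrP.comp (δ := τ / 4) (by positivity) hm (max c₃ 7) 2 2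
  refine ⟨min (1 / 20) (min β₁ (τ / 4 * min β₃ (τ / 4) ^ 2 / 2)),
    max 4 (max c₁ (2 + (max c₃ 7 + max c₃ 7))), n₁ + n₂ + n₃ + n₄ + 20, by positivity,
    fun V _ hn E hE hdeg => ?_⟩
  have hV : Nonempty V := (Nat.card_pos_iff.1 (by omega)).1
  have near := near_or_near hE hdeg (by omega)
  have hnear : ∀ x y, Near E x y → TrP E (min (1 / 20) (min β₁ (τ / 4 * min β₃ (τ / 4) ^ 2 / 2)))
      (max 4 (max c₁ (2 + (max c₃ 7 + max c₃ 7)))) {x} {y} := fun x y h =>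
    (h.trP hE).mono (min_le_left _ _) (le_max_left _ _)
  by_cases hA : ∀ x y, ¬ Near E x y → δ ≤ Pr (fun z => Near E x z ∧ Near E z y)
  · refine ⟨fun _ => True, ?_, fun x y _ _ => ?_⟩
    · rw [Pr_not, Pr_true (fun _ => trivial)]; norm_num
    · by_cases h : Near E x y
      · exact hnear x y h
      · refine (H₁ V (by omega) E x y ((hA x y h).trans (Pr_mono fun z hz => ?_))).mono
          ((min_le_right _ _).trans (min_le_left _ _)) ((le_max_left _ _).trans (le_max_right _ _))
        exact ⟨hz.1.trP hE, hz.2.trP hE⟩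
  push Not at hA
  obtain ⟨x₀, y₀, hxy, hfew⟩ := hA
  set U : V → Prop := fun v => ¬ Near E v y₀ with hU
  set W : V → Prop := fun v => ¬ Near E v x₀ with hW
  have hUU : ∀ a b, U a → U b → Near E a b := fun a b ha hb => by
    rcases near a b y₀ with h | h | h
    · exact h
    · exact absurd h ha
    · exact absurd h hb
  have hWW : ∀ a b, W a → W b → Near E a b := fun a b ha hb => by
    rcases near a b x₀ with h | h | h
    · exact h
    · exact absurd h ha
    · exact absurd h hb
  have hUW : ∀ v, U v → ¬ W v := fun v hu hw => by
    rcases near v x₀ y₀ with h | h | h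
    · exact hw h
    · exact hu h
    · exact hxy h
  have hrest : Pr (fun v => ¬ U v ∧ ¬ W v) ≤ δ := (Pr_mono fun v hv => by
    simp only [hU, hW, not_not] at hv
    exact ⟨hv.2.symm, hv.1⟩).trans hfew.le
  by_cases hU' : δ ≤ Pr U
  swap
  · refine ⟨W, ?_, fun x y hx hy => hnear x y (hWW x y hx hy)⟩
    have := Pr_le_add (P := fun v => ¬ W v) (Q := U) (R := fun v => ¬ U v ∧ ¬ W v) fun v hv => by tauto
    rw [hδ'] at *
    linarith
  by_cases hW' : δ ≤ Pr W
  swap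
  · refine ⟨U, ?_, fun x y hx hy => hnear x y (hUU x y hx hy)⟩
    have := Pr_le_add (P := fun v => ¬ U v) (Q := W) (R := fun v => ¬ U v ∧ ¬ W v) fun v hv => by tauto
    rw [hδ'] at *
    linarith
  have hcross := H₂ V (by omega) E ∅ 0 0 {0} {1} (Cross E U W) (by simp)
    ((le_of_eq hτ').trans (Cross.many hE hdeg hUW hδ hU' hW' rfl)) (fun v w h hi _ _ => h.tr hE hi)
  have hcr : ∀ a b, U a → W b → TrP E (min (1 / 20) (min β₁ (τ / 4 * min β₃ (τ / 4) ^ 2 / 2)))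
      (max 4 (max c₁ (2 + (max c₃ 7 + max c₃ 7)))) {a} {b} := by
    intro a b ha hb
    have h := H₄ V (by omega) E 0 {a} 0 {b} {0} {1} (by simp) (by simp) (by simp)
      (Multiset.disjoint_left.2 (by decide)) (hcross.trans (Pr_mono fun v hv => ?_))
    · simpa [-one_div] using h.mono ((min_le_right (1 / 20) _).trans (min_le_right β₁ _))
        ((le_max_right c₁ _).trans (le_max_right 4 _))
    · obtain ⟨ht, -, -, w, hw⟩ := hv
      refine ⟨ht.mono (min_le_right _ _) (le_max_right _ _), ?_⟩
      have h3 := H₃ V (by omega) E [a, v 1] [v 0, b] rfl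
        (.cons ((hUU a _ ha hw.2.2.2.1).trP hE) (.cons ((hWW _ b hw.2.2.2.2 hb).trP hE) .nil))
        (by
          simp only [List.nodup_cons, List.mem_singleton, List.not_mem_nil, not_false_eq_true,
            List.nodup_nil, and_true]
          exact fun e => hUW a ha (e ▸ hw.2.2.2.2))
        (by
          simp only [List.nodup_cons, List.mem_singleton, List.not_mem_nil, not_false_eq_true,
            List.nodup_nil, and_true]
          exact fun e => hUW (v 0) hw.2.2.2.1 (e ▸ hb))
      rw [add_comm ({b} : Multiset V)]
      exact h3.mono (min_le_left _ (τ / 4)) (le_max_left _ 7)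
  refine ⟨fun v => U v ∨ W v, ?_, ?_⟩
  · refine (Pr_mono fun v hv => by tauto).trans (hrest.trans ?_)
    rw [hδ']; norm_num
  · rintro x y (hx | hx) (hy | hy)
    · exact hnear x y (hUU x y hx hy)
    · exact hcr x y hx hy
    · exact (hcr y x hy hx).symm
    · exact hnear x y (hWW x y hx hy)

end

section

/-- All vertices are exchangeable. -/
theorem TrP.all : ∃ (β : ℝ) (c n₀ : ℕ), 0 < β ∧
    ∀ (V : Type) [Finite V], n₀ ≤ Nat.card V → ∀ (E : V → V → V → V → V → Prop), Sym5 E →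
      (∀ x y, x ≠ y → 91 / 216 ≤ Pr (fun t : V × V × V => E x y t.1 t.2.1 t.2.2)) →
      ∀ x y, TrP E β c {x} {y} := by
  obtain ⟨β₁, c₁, n₁, hβ₁, H₁⟩ := exists_closed
  obtain ⟨β₂, c₂, n₂, hβ₂, H₂⟩ := TrP.extend hβ₁ c₁
  refine ⟨β₂, c₂, n₁ + n₂, hβ₂, fun V _ hn E hE hdeg => ?_⟩
  obtain ⟨U, hU, hc⟩ := H₁ V (by omega) E hE hdeg
  exact H₂ V (by omega) E hE hdeg U hU hc

section
variable {V : Type} [Finite V] [Nonempty V] {E : V → V → V → V → V → Prop}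

/-- A path with two edges and a path with three edges having the same ends. -/
def Stretch (E : V → V → V → V → V → Prop) (v : Fin 11 → V) (w : Fin 4 → V) : Prop :=
  E (w 0) (w 1) (v 0) (v 1) (v 2) ∧ E (v 1) (v 2) (v 3) (w 2) (w 3) ∧
    E (w 0) (w 1) (v 4) (v 5) (v 6) ∧ E (v 5) (v 6) (v 7) (v 8) (v 9) ∧
    E (v 8) (v 9) (v 10) (w 2) (w 3)

lemma Stretch.tr {v : Fin 11 → V} {w : Fin 4 → V} (h : Stretch E v w)
    (hi : Function.Injective (Sum.elim v w)) :
    Tr E (Set.range w) (0 + ({0, 1, 2, 3} : Multiset (Fin 11)).map v)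
      (0 + ({4, 5, 6, 7, 8, 9, 10} : Multiset (Fin 11)).map v) := by
  have h1 : ([Sum.inr 0, Sum.inr 1, Sum.inr 2, Sum.inr 3, Sum.inl 0, Sum.inl 1, Sum.inl 2,
      Sum.inl 3].map (Sum.elim v w)).Nodup := List.Nodup.map hi (by decide)
  have h2 : ([Sum.inr 0, Sum.inr 1, Sum.inr 2, Sum.inr 3, Sum.inl 4, Sum.inl 5, Sum.inl 6,
      Sum.inl 7, Sum.inl 8, Sum.inl 9, Sum.inl 10].map (Sum.elim v w)).Nodup :=
    List.Nodup.map hi (by decide)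
  refine Tr.single (p := (w 0, w 1)) (q := (w 2, w 3))
    (Conn.step (s := v 0) (r := (v 1, v 2)) h.1 (Conn.edge (s := v 3) h.2.1))
    (Conn.step (s := v 4) (r := (v 5, v 6)) h.2.2.1
      (Conn.step (s := v 7) (r := (v 8, v 9)) h.2.2.2.1 (Conn.edge (s := v 10) h.2.2.2.2)))
    ?_ h1 ?_ h2 ?_
  · simp only [← Multiset.cons_coe, Multiset.coe_nil, Multiset.map_cons, Multiset.insert_eq_cons,
      Multiset.map_singleton]
    simp only [← Multiset.singleton_add]
    abel
  · intro a ha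
    simp only [verts, List.mem_cons, List.not_mem_nil, or_false] at ha
    rcases ha with rfl | rfl | rfl | rfl | rfl | rfl | rfl | rfl <;> simp
  · intro a ha
    simp only [verts, List.mem_cons, List.not_mem_nil, or_false] at ha
    rcases ha with rfl | rfl | rfl | rfl | rfl | rfl | rfl | rfl | rfl | rfl | rfl <;> simp

lemma Stretch.many (hE : Sym5 E)
    (hdeg : ∀ x y, x ≠ y → 91 / 216 ≤ Pr (fun t : V × V × V => E x y t.1 t.2.1 t.2.2))
    (hn : 20 ≤ Nat.card V) :
    5 / 10000000000000 ≤ Pr (fun y : (Fin 11 → V) × (Fin 4 → V) => Stretch E y.1 y.2) := by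
  have h0 := Pr_prod_ge (P := fun _ : V => True) (Q := fun x y : V => y ≠ x) (d := 19 / 20)
    (by norm_num) (Pr_true fun _ => trivial).ge fun x _ => Pr_ne hn x
  have h1 := Pr_prod_ge (Q := fun (_ q : V × V) => True ∧ q.2 ≠ q.1) (by norm_num) h0 fun _ _ => h0
  have h2 := Pr_prod_ge (Q := fun (a : (V × V) × V × V) (z : (V × V) × V × V) =>
      E a.1.1 a.1.2 z.2.1 z.1.1 z.1.2 ∧ E z.1.1 z.1.2 z.2.2 a.2.1 a.2.2)
      (d := 1 / 625000) (by norm_num) h1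
      (fun a ha => connecting hE hdeg (p := a.1) (q := a.2) ha.1.2.symm ha.2.2.symm)
  have h3 := Pr_prod_ge (Q := fun (a : ((V × V) × V × V) × (V × V) × V × V) (t : V × V × V) =>
      E a.1.1.1 a.1.1.2 t.1 t.2.1 t.2.2) (d := 91 / 216) (by norm_num) h2
      (fun a ha => hdeg _ _ ha.1.1.2.symm)
  have h4 := Pr_prod_ge (Q := fun (a : (((V × V) × V × V) × (V × V) × V × V) × V × V × V)
      (z : (V × V) × V × V) =>
      E a.2.2.1 a.2.2.2 z.2.1 z.1.1 z.1.2 ∧ E z.1.1 z.1.2 z.2.2 a.1.1.2.1 a.1.1.2.2)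
      (d := 1 / 625000) (by norm_num) h3
      (fun a ha => connecting hE hdeg (p := (a.2.2.1, a.2.2.2)) (q := a.1.1.2)
        (hE.ne (hE.rev ha.2)) ha.1.1.2.2.symm)
  let e : ((((V × V) × V × V) × (V × V) × V × V) × V × V × V) × ((V × V) × V × V) ≃
      (Fin 11 → V) × (Fin 4 → V) :=
    { toFun := fun t => (![t.1.1.2.2.1, t.1.1.2.1.1, t.1.1.2.1.2, t.1.1.2.2.2, t.1.2.1, t.1.2.2.1,
          t.1.2.2.2, t.2.2.1, t.2.1.1, t.2.1.2, t.2.2.2],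
        ![t.1.1.1.1.1, t.1.1.1.1.2, t.1.1.1.2.1, t.1.1.1.2.2])
      invFun := fun F => (((((F.2 0, F.2 1), (F.2 2, F.2 3)), ((F.1 1, F.1 2), F.1 0, F.1 3)),
        (F.1 4, F.1 5, F.1 6)), ((F.1 8, F.1 9), F.1 7, F.1 10))
      left_inv := fun t => rfl
      right_inv := fun F => by
        refine Prod.ext ?_ ?_ <;> ext i <;> fin_cases i <;> rfl }
  rw [← Pr_equiv e]
  refine le_trans (by norm_num) (h4.trans (Pr_mono fun t ht => ?_))
  obtain ⟨⟨⟨-, h5, h6⟩, h7⟩, h8, h9⟩ := ht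
  exact ⟨h5, h6, h7, h8, h9⟩

end

/-- All triples can be absorbed. -/
theorem TrP.absorb : ∃ (β : ℝ) (c n₀ : ℕ), 0 < β ∧
    ∀ (V : Type) [Finite V], n₀ ≤ Nat.card V → ∀ (E : V → V → V → V → V → Prop), Sym5 E →
      (∀ x y, x ≠ y → 91 / 216 ≤ Pr (fun t : V × V × V => E x y t.1 t.2.1 t.2.2)) →
      ∀ x y z, x ≠ y → x ≠ z → y ≠ z → TrP E β c 0 {x, y, z} := by
  obtain ⟨β, c, n₀, hβ, H⟩ := TrP.all
  obtain ⟨β₁, c₁, n₁, hβ₁, H₁⟩ := TrP.swaps hβ c 7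
  obtain ⟨δ, hδ, hδ'⟩ : ∃ δ : ℝ, 0 < δ ∧ δ = 5 / 10000000000000 := ⟨_, by norm_num, rfl⟩
  obtain ⟨n₂, H₂⟩ := gadget hδ 11 4 3
  obtain ⟨n₃, H₃⟩ := TrP.comp (δ := δ / 4) (by positivity)
    (lt_min hβ₁ (show 0 < δ / 4 by positivity)) (max c₁ 4) 11 3
  have hβ₃ : 0 < δ / 4 * min β₁ (δ / 4) ^ 2 / 2 := by
    have := lt_min hβ₁ (show 0 < δ / 4 by positivity); positivity
  refine ⟨_, 11 + (max c₁ 4 + max c₁ 4), n₀ + n₁ + n₂ + n₃ + 20, hβ₃,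
    fun V _ hn E hE hdeg x y z hxy hxz hyz => ?_⟩
  have hV : Nonempty V := (Nat.card_pos_iff.1 (by omega)).1
  have h2 := H₂ V (by omega) E {x, y, z} 0 0 {0, 1, 2, 3} {4, 5, 6, 7, 8, 9, 10}
      (fun v w => Stretch E v w) Finset.card_le_three
      ((le_of_eq hδ').trans (Stretch.many hE hdeg (by omega)))
      (fun v w h hi hv hw => h.tr hi)
  have h3 := H₃ V (by omega) E 0 0 0 {x, y, z} {0, 1, 2, 3} {4, 5, 6, 7, 8, 9, 10} (by simp)
    (by simp) (by simp) (Multiset.disjoint_left.2 (by decide)) (h2.trans (Pr_mono fun v hv => ?_))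
  · simpa using h3
  · obtain ⟨ht, hi, hS, -⟩ := hv
    refine ⟨ht.mono (min_le_right _ _) (le_max_right _ _), ?_⟩
    have := H₁ V (by omega) E [v 4, v 5, v 6, v 7, v 8, v 9, v 10] [x, y, z, v 0, v 1, v 2, v 3] rfl
      (by simp [H V (by omega) E hE hdeg]) (List.Nodup.map (l := [4, 5, 6, 7, 8, 9, 10]) hi (by decide))
      (List.Nodup.append (l₁ := [x, y, z]) (l₂ := [v 0, v 1, v 2, v 3]) (by simp [hxy, hxz, hyz])
        (List.Nodup.map (l := [0, 1, 2, 3]) hi (by decide)) ?_)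
    · rw [zero_add]
      exact this.mono (min_le_left _ (δ / 4)) (le_max_left _ 4)
    · have : ∀ i, v i ≠ x ∧ v i ≠ y ∧ v i ≠ z := fun i =>
        ⟨fun h => hS i (by simp [h]), fun h => hS i (by simp [h]), fun h => hS i (by simp [h])⟩
      simp [this]

end

section

section
variable {Ω : Type*} [Finite Ω] [Nonempty Ω]

lemma av_prod_pow (f : Ω → ℝ) (m : ℕ) : av (fun x : Fin m → Ω => ∏ i, f (x i)) = av f ^ m := by
  cases nonempty_fintype Ω
  rw [av_eq, av_eq, div_pow, Fintype.sum_pow]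
  simp

lemma av_finset_sum {ι : Type*} (s : Finset ι) (f : ι → Ω → ℝ) :
    av (fun a => ∑ i ∈ s, f i a) = ∑ i ∈ s, av (f i) := by
  cases nonempty_fintype Ω
  simp only [av_eq]
  rw [sum_comm, sum_div]

/-- Few of the samples satisfying `Q` is unlikely. -/
lemma lower_tail {Q : Ω → Prop} {β : ℝ} (hβ : 0 ≤ β) (hQ : β ≤ Pr Q) (m : ℕ) :
    Pr (fun x : Fin m → Ω => ((univ.filter fun i => Q (x i)).card : ℝ) < β * m / 4) ≤
      Real.exp (-(β / 4) * m) := by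
  let f : Ω → ℝ := fun a => if Q a then 1 / 2 else 1
  have hf : av f = 1 - Pr Q / 2 := by
    have h1 : f = fun a => 1 - (1 / 2) * (if Q a then 1 else 0) := by
      funext a; simp only [f]; split_ifs <;> norm_num
    rw [h1, av_sub, av_const, av_mul_left]
    unfold Pr; ring
  have hpos : ∀ a, 0 ≤ f a := fun a => by simp only [f]; split_ifs <;> norm_num
  have h2 := markov (f := fun x : Fin m → Ω => ∏ i, f (x i)) (fun x => prod_nonneg fun i _ => hpos _)
    (Real.exp (-(β / 4 * m)))
  rw [av_prod_pow, hf] at h2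
  have h3 : (1 - Pr Q / 2) ^ m ≤ Real.exp (-(β / 2) * m) := by
    rw [mul_comm, Real.exp_nat_mul]
    have h0 : Pr Q ≤ 1 := Pr_le_one _
    refine pow_le_pow_left₀ (by linarith) ?_ m
    have := Real.add_one_le_exp (-(β / 2))
    linarith
  have h4 : Pr (fun x : Fin m → Ω => ((univ.filter fun i => Q (x i)).card : ℝ) < β * m / 4) ≤
      Pr (fun x : Fin m → Ω => Real.exp (-(β / 4 * m)) ≤ ∏ i, f (x i)) := by
    refine Pr_mono fun x hx => ?_
    have h5 : ∏ i, f (x i) = (1 / 2) ^ (univ.filter fun i => Q (x i)).card := by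
      simp only [f]
      rw [prod_ite]; simp
    have h6 : Real.exp (-1) ≤ 1 / 2 := by
      rw [Real.exp_neg, inv_eq_one_div]
      exact one_div_le_one_div_of_le (by norm_num) (by have := Real.add_one_le_exp (1:ℝ); linarith)
    rw [h5]
    refine le_trans ?_ (pow_le_pow_left₀ (Real.exp_pos _).le h6 _)
    rw [← Real.exp_nat_mul]
    exact Real.exp_le_exp.2 (by linarith)
  refine h4.trans ?_
  have h7 : Real.exp (-(β / 2) * m) = Real.exp (-(β / 4 * m)) * Real.exp (-(β / 4) * m) := by
    rw [← Real.exp_add]; congr 1; ring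
  have h8 := h2.trans h3
  rw [h7] at h8
  exact le_of_mul_le_mul_left h8 (Real.exp_pos _)

end

/-- A random selection has few conflicts and many members with each of the properties `Q j`. -/
theorem selection {β ε : ℝ} (hβ : 0 < β) (hε : 0 < ε) (d : ℕ) : ∃ n₀ : ℕ, ∀ n, n₀ ≤ n →
    ∀ (Ω J V : Type) [Finite Ω] [Nonempty Ω] [Fintype J] (supp : Ω → Finset V) (Q : J → Ω → Prop)
      (κ : ℝ) (m : ℕ), Fintype.card J ≤ n ^ d → ε * n ≤ m → κ * m ≤ β / 32 →
      (∀ j, β ≤ Pr (Q j)) → (∀ ω, Pr (fun ω' => ¬ Disjoint (supp ω) (supp ω')) ≤ κ) →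
      ∃ (x : Fin m → Ω) (I : Finset (Fin m)),
        (∀ i ∈ I, ∀ i' ∈ I, i ≠ i' → Disjoint (supp (x i)) (supp (x i'))) ∧
        ∀ j, β * m / 8 ≤ ((I.filter fun i => Q j (x i)).card : ℝ) := by
  have hr : |Real.exp (-(β / 4 * ε))| < 1 := by
    rw [abs_of_pos (Real.exp_pos _)]
    rw [← Real.exp_zero]
    exact Real.exp_lt_exp.2 (by have := mul_pos hβ hε; linarith)
  have ht := tendsto_pow_const_mul_const_pow_of_abs_lt_one d hr
  obtain ⟨n₀, hn₀⟩ := Filter.eventually_atTop.1 (ht.eventually (gt_mem_nhds (show (0:ℝ) < 1 / 4 by norm_num)))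
  refine ⟨n₀ + 1, fun n hn Ω J V _ _ _ supp Q κ m hJ hm hκ hQ hc => ?_⟩
  have hmpos : (0:ℝ) < m := lt_of_lt_of_le (mul_pos hε (by exact_mod_cast (by omega))) hm
  let conf : (Fin m → Ω) → Fin m → Fin m → Prop := fun x i i' =>
    i ≠ i' ∧ ¬ Disjoint (supp (x i)) (supp (x i'))
  let C : (Fin m → Ω) → ℝ := fun x => ∑ i, ∑ i', if conf x i i' then (1:ℝ) else 0
  have hC : av C ≤ m * (m * κ) := by
    simp only [C]
    rw [av_finset_sum]
    have h1 : ∀ i ∈ (univ : Finset (Fin m)),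
        av (fun x => ∑ i', if conf x i i' then (1:ℝ) else 0) ≤ m * κ := fun i _ => by
      rw [av_finset_sum]
      have h2 : ∀ i' ∈ (univ : Finset (Fin m)),
          av (fun x => if conf x i i' then (1:ℝ) else 0) ≤ κ := fun i' _ => by
        refine le_trans (le_of_eq (show _ = Pr (fun x => conf x i i') by unfold Pr; congr 1; funext x; congr)) ?_
        by_cases h : i = i'
        · have hk : 0 ≤ κ := (Pr_nonneg _).trans (hc (Classical.arbitrary Ω))
          refine le_trans (le_of_eq ?_) hk
          unfold Pr; simp [conf, h, av]
        · refine (Pr_mono fun x (hx : conf x i i') => hx.2).trans ?_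
          rw [Pr_pair h (fun a b => ¬ Disjoint (supp a) (supp b)), Pr_prod]
          exact av_le_of_le hc
      exact (sum_le_sum h2).trans (by simp)
    exact (sum_le_sum h1).trans (by simp)
  have hP1 : Pr (fun x => β * m / 8 ≤ C x) ≤ 1 / 4 := by
    have h1 := markov (f := C) (fun x => sum_nonneg fun i _ => sum_nonneg fun i' _ => by positivity)
      (β * m / 8)
    have h2 : β * m / 8 * Pr (fun x => β * m / 8 ≤ C x) ≤ β * m / 8 * (1 / 4) := by
      refine h1.trans (hC.trans ?_)
      have := mul_le_mul_of_nonneg_left hκ hmpos.le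
      linarith
    exact le_of_mul_le_mul_left h2 (by positivity)
  have hP2 : Pr (fun x : Fin m → Ω =>
      ∃ j, ((univ.filter fun i => Q j (x i)).card : ℝ) < β * m / 4) ≤ 1 / 4 := by
    refine (Pr_exists_le _).trans ((sum_le_sum fun j _ => lower_tail hβ.le (hQ j) m).trans ?_)
    rw [sum_const, card_univ, nsmul_eq_mul]
    refine le_trans ?_ (hn₀ n (by omega)).le
    refine mul_le_mul (by exact_mod_cast hJ) ?_ (Real.exp_pos _).le (by positivity)
    rw [← Real.exp_nat_mul]
    refine Real.exp_le_exp.2 ?_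
    nlinarith
  have hgood : 0 < Pr (fun x : Fin m → Ω => ¬ (β * m / 8 ≤ C x ∨
      ∃ j, ((univ.filter fun i => Q j (x i)).card : ℝ) < β * m / 4)) := by
    rw [Pr_not]
    have := Pr_le_add (α := Fin m → Ω) (P := fun x => β * m / 8 ≤ C x ∨
      ∃ j, ((univ.filter fun i => Q j (x i)).card : ℝ) < β * m / 4) (fun x h => h)
    linarith
  obtain ⟨x, hx⟩ := exists_of_Pr_pos hgood
  push Not at hx
  obtain ⟨hx1, hx2⟩ := hx
  refine ⟨x, univ.filter fun i => ∀ i', ¬ conf x i i', ?_, fun j => ?_⟩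
  · intro i hi i' hi' hne
    by_contra h
    exact (mem_filter.1 hi).2 i' ⟨hne, h⟩
  · have h1 : (univ.filter fun i => Q j (x i)) ⊆
        ((univ.filter fun i => ∀ i', ¬ conf x i i').filter fun i => Q j (x i)) ∪
          univ.filter fun i => ∃ i', conf x i i' := by
      intro i hi
      by_cases h : ∃ i', conf x i i'
      · exact mem_union_right _ (by simpa using h)
      · push Not at h
        exact mem_union_left _ (mem_filter.2 ⟨mem_filter.2 ⟨mem_univ _, h⟩, (mem_filter.1 hi).2⟩)
    have h2 : ((univ.filter fun i => ∃ i', conf x i i').card : ℝ) ≤ C x := by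
      rw [card_filter]
      push_cast
      refine sum_le_sum fun i _ => ?_
      split_ifs with h
      · obtain ⟨i', hi'⟩ := h
        refine le_trans (by simp [hi']) (single_le_sum (f := fun i' => if conf x i i' then (1:ℝ) else 0)
          (fun _ _ => by positivity) (mem_univ i'))
      · exact sum_nonneg fun _ _ => by positivity
    have h3 : ((univ.filter fun i => Q j (x i)).card : ℝ) ≤ _ :=
      Nat.cast_le.2 ((card_le_card h1).trans (card_union_le _ _))
    push_cast at h3
    have := hx2 j
    linarith

end

section

/-- A path given by its ends and the list of its internal vertices. -/
abbrev Piece (V : Type*) := (V × V) × (V × V) × List V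

section
variable {V : Type*}

def pieceEnds (l : List (Piece V)) : List ((V × V) × (V × V)) := l.map fun d => (d.1, d.2.1)

def tot (l : List (Piece V)) : Multiset V :=
  (l.map fun d => (verts d.1 d.2.1 d.2.2 : Multiset V)).sum

/-- All members of `l` are paths. -/
def Valid (E : V → V → V → V → V → Prop) (l : List (Piece V)) : Prop :=
  ∀ d ∈ l, Conn E d.1 d.2.1 d.2.2

/-- The paths in `l` can be replaced by paths with the same ends covering `T` in addition. -/
def Absorbs (E : V → V → V → V → V → Prop) (l : List (Piece V)) (T : Multiset V) : Prop :=
  ∃ l', pieceEnds l' = pieceEnds l ∧ Valid E l' ∧ tot l' = tot l + T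

/-- Any two pairs can be connected using vertices in `Y` and avoiding any `N` vertices. -/
def Connects (E : V → V → V → V → V → Prop) (Y : Finset V) (N : ℕ) : Prop :=
  ∀ p q : V × V, p.1 ≠ p.2 → q.1 ≠ q.2 → ∀ W : Finset V, W.card ≤ N → ∃ (r : V × V) (s t : V),
    E p.1 p.2 s r.1 r.2 ∧ E r.1 r.2 t q.1 q.2 ∧ [s, t, r.1, r.2].Nodup ∧
      ∀ v ∈ [s, t, r.1, r.2], v ∈ Y ∧ v ∉ W

variable {E : V → V → V → V → V → Prop}

lemma tot_cons (d : Piece V) (l : List (Piece V)) :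
    tot (d :: l) = (verts d.1 d.2.1 d.2.2 : Multiset V) + tot l := by simp [tot]

lemma length_le_tot (l : List (Piece V)) : 4 * l.length ≤ (tot l).card := by
  induction l with
  | nil => simp
  | cons d l ih =>
    rw [tot_cons, Multiset.card_add, Multiset.coe_card]
    simp only [verts, List.length_cons]
    omega

lemma Conn.ne (hE : Sym5 E) {p q : V × V} {L : List V} (h : Conn E p q L) :
    p.1 ≠ p.2 ∧ q.1 ≠ q.2 := by
  induction h with
  | edge h => exact ⟨hE.ne h, hE.ne (hE.s2 (hE.s1 (hE.s3 (hE.s2 (hE.s4 (hE.s3 h))))))⟩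
  | step h _ ih => exact ⟨hE.ne h, ih.2⟩

lemma join {Y : Finset V} {N : ℕ} (hconn : Connects E Y (4 * N)) (es : List ((V × V) × (V × V))) :
    ∀ e : (V × V) × (V × V), (∀ f ∈ e :: es, f.1.1 ≠ f.1.2 ∧ f.2.1 ≠ f.2.2) → es.length ≤ N →
      ∃ (K : Multiset V) (q : V × V), K.Nodup ∧ (∀ v ∈ K, v ∈ Y) ∧ K.card = 4 * es.length ∧
        q.1 ≠ q.2 ∧ ∀ l, pieceEnds l = e :: es → Valid E l →
          ∃ M, Conn E e.1 q M ∧ (verts e.1 q M : Multiset V) = tot l + K := by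
  induction es with
  | nil =>
    intro e he _
    refine ⟨0, e.2, by simp, by simp, by simp, (he e (by simp)).2, fun l hl hv => ?_⟩
    obtain ⟨d, l', rfl, hd, hl'⟩ := List.map_eq_cons_iff.1 hl
    rw [List.map_eq_nil_iff] at hl'
    subst hl' hd
    exact ⟨d.2.2, hv d (by simp), by simp [tot]⟩
  | cons e' es ih =>
    intro e he hN
    simp only [List.length_cons] at hN
    obtain ⟨K, q, hK, hKY, hKc, hq, hl⟩ := ih e' (fun f hf => he f (List.mem_cons_of_mem _ hf)) (by omega)
    obtain ⟨r, s, t, h1, h2, h3, h4⟩ := hconn e.2 e'.1 (he e (by simp)).2 (he e' (by simp)).1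
      K.toFinset ((Multiset.toFinset_card_le K).trans (by omega))
    refine ⟨([s, t, r.1, r.2] : Multiset V) + K, q, ?_, ?_, ?_, hq, fun l hends hv => ?_⟩
    · rw [Multiset.nodup_add]
      exact ⟨by simpa using h3, hK, Multiset.disjoint_left.2 fun {v} hv hv' =>
        (h4 v (by simpa using hv)).2 (by simpa using hv')⟩
    · intro v hv
      rcases Multiset.mem_add.1 hv with hv | hv
      · exact (h4 v (by simpa using hv)).1
      · exact hKY v hv
    · rw [Multiset.card_add, hKc]; simp; ring
    · obtain ⟨d, l', rfl, hd, hl'⟩ := List.map_eq_cons_iff.1 hends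
      obtain ⟨M, hM, hMt⟩ := hl l' hl' (fun d hd => hv d (List.mem_cons_of_mem _ hd))
      subst hd
      refine ⟨_, ((hv d (by simp)).append (Conn.step (r := r) (s := s) h1 (Conn.edge (s := t) h2))).append hM, ?_⟩
      rw [tot_cons, add_assoc, add_left_comm (tot l'), ← hMt]
      simp only [verts, ← Multiset.cons_coe, ← Multiset.coe_add, ← Multiset.singleton_add,
        Multiset.coe_nil]
      abel

lemma join_cycle {Y : Finset V} {N : ℕ} (hconn : Connects E Y (4 * N))
    (es : List ((V × V) × (V × V))) (e : (V × V) × (V × V))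
    (he : ∀ f ∈ e :: es, f.1.1 ≠ f.1.2 ∧ f.2.1 ≠ f.2.2) (hN : es.length ≤ N) :
    ∃ K : Multiset V, K.Nodup ∧ (∀ v ∈ K, v ∈ Y) ∧ ∀ l, pieceEnds l = e :: es → Valid E l →
      ∃ M, Conn E e.1 e.1 M ∧ ((e.1.1 :: e.1.2 :: M : List V) : Multiset V) = tot l + K := by
  obtain ⟨K, q, hK, hKY, hKc, hq, hl⟩ := join hconn es e he hN
  obtain ⟨r, s, t, h1, h2, h3, h4⟩ := hconn q e.1 hq (he e (by simp)).1
    K.toFinset ((Multiset.toFinset_card_le K).trans (by omega))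
  refine ⟨([s, t, r.1, r.2] : Multiset V) + K, ?_, ?_, fun l hends hv => ?_⟩
  · rw [Multiset.nodup_add]
    exact ⟨by simpa using h3, hK, Multiset.disjoint_left.2 fun {v} hv hv' =>
      (h4 v (by simpa using hv)).2 (by simpa using hv')⟩
  · intro v hv
    rcases Multiset.mem_add.1 hv with hv | hv
    · exact (h4 v (by simpa using hv)).1
    · exact hKY v hv
  · obtain ⟨M, hM, hMt⟩ := hl l hends hv
    refine ⟨_, hM.append (Conn.step (r := r) (s := s) h1 (Conn.edge (s := t) h2)), ?_⟩
    rw [add_left_comm, ← hMt]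
    simp only [verts, ← Multiset.cons_coe, ← Multiset.coe_add, ← Multiset.singleton_add,
      Multiset.coe_nil]
    abel

lemma absorb_many {m N : ℕ} (a : Fin m → List (Piece V)) (ha : ∀ i, Valid E (a i))
    (Ts : List (Multiset V)) (hTs : Ts.length ≤ N)
    (h : ∀ T ∈ Ts, N ≤ (univ.filter fun i => Absorbs E (a i) T).card) :
    ∃ g : Fin m → List (Piece V), (∀ i, pieceEnds (g i) = pieceEnds (a i) ∧ Valid E (g i)) ∧
      ∑ i, tot (g i) = ∑ i, tot (a i) + Ts.sum ∧
      (univ.filter fun i => g i ≠ a i).card ≤ Ts.length := by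
  induction Ts with
  | nil => exact ⟨a, fun i => ⟨rfl, ha i⟩, by simp, by simp⟩
  | cons T Ts ih =>
    simp only [List.length_cons] at hTs
    obtain ⟨g, hg, hs, hc⟩ := ih (by omega) fun T hT => h T (List.mem_cons_of_mem _ hT)
    obtain ⟨i, hi, hi'⟩ := exists_mem_notMem_of_card_lt_card
      (lt_of_le_of_lt hc (lt_of_lt_of_le (by omega) (h T (by simp))))
    obtain ⟨l', h1, h2, h3⟩ := (mem_filter.1 hi).2
    have hgi : g i = a i := by simpa using hi'
    refine ⟨Function.update g i l', fun j => ?_, ?_, ?_⟩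
    · by_cases hj : j = i
      · subst hj; simpa using ⟨h1, h2⟩
      · simpa [hj] using hg j
    · have e1 := add_sum_erase univ (fun j => tot (g j)) (mem_univ i)
      have e2 := add_sum_erase univ (fun j => tot (Function.update g i l' j)) (mem_univ i)
      have e3 : ∑ j ∈ univ.erase i, tot (Function.update g i l' j) = ∑ j ∈ univ.erase i, tot (g j) :=
        sum_congr rfl fun j hj => by rw [Function.update_of_ne (ne_of_mem_erase hj)]
      rw [e3] at e2
      simp only [Function.update_self] at e2
      rw [← e2, h3, List.sum_cons, add_left_comm, ← hs, ← e1, hgi]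
      abel
    · refine (card_le_card (t := insert i (univ.filter fun j => g j ≠ a j)) fun j hj => ?_).trans
        ((card_insert_le _ _).trans (by simpa using hc))
      by_cases hji : j = i
      · simp [hji]
      · simpa [hji] using hj

end

end

section

lemma nodup_sum {ι V : Type*} (s : Finset ι) (f : ι → Multiset V) (h : ∀ i ∈ s, (f i).Nodup)
    (hd : ∀ i ∈ s, ∀ j ∈ s, i ≠ j → ∀ v ∈ f i, v ∉ f j) : (∑ i ∈ s, f i).Nodup := by
  induction s using Finset.induction_on with
  | empty => simp
  | insert i s hi ih =>
    rw [sum_insert hi, Multiset.nodup_add]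
    refine ⟨h i (by simp), ih (fun j hj => h j (by simp [hj]))
      (fun j hj k hk => hd j (by simp [hj]) k (by simp [hk])), Multiset.disjoint_left.2 fun {v} hv hv' => ?_⟩
    obtain ⟨j, hj, hvj⟩ := Multiset.mem_sum.1 hv'
    exact hd i (by simp) j (by simp [hj]) (by rintro rfl; exact hi hj) v hv hvj

lemma Pr_conflict {V : Type*} [Finite V] [Nonempty V] {c : ℕ} (g : Fin c → V) :
    Pr (fun g' : Fin c → V => ¬ Disjoint (univ.image g) (univ.image g')) ≤ (c : ℝ) * c / Nat.card V := by
  refine (Pr_mono fun g' h => ?_).trans ((Pr_hit (κ := Fin c) (univ.image g)).trans ?_)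
  · rw [Finset.not_disjoint_iff] at h
    obtain ⟨v, hv, hv'⟩ := h
    obtain ⟨k, -, rfl⟩ := mem_image.1 hv'
    exact ⟨k, hv⟩
  · rw [Fintype.card_fin]
    have : (univ.image g).card ≤ c := card_image_le.trans (by simp)
    gcongr

section
variable {V : Type*} {E : V → V → V → V → V → Prop}

/-- The patterns of at most `c` paths on `c` vertices. -/
abbrev Pattern (c : ℕ) :=
  {s : List (Piece (Fin c)) // s.length ≤ c ∧ ∀ d ∈ s, d.2.2.length ≤ c}

instance (c : ℕ) : Finite (Pattern c) := by
  have h1 : {L : List (Fin c) | L.length ≤ c}.Finite := List.finite_length_le _ _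
  let F : Set (Piece (Fin c)) := Set.univ ×ˢ Set.univ ×ˢ {L | L.length ≤ c}
  have hF : F.Finite := Set.finite_univ.prod (Set.finite_univ.prod h1)
  have : Finite F := hF
  have h2 := (List.finite_length_le F c).image (List.map Subtype.val)
  refine Set.Finite.subset h2 ?_
  rintro s ⟨hs, hs'⟩
  refine ⟨s.pmap (fun d hd => ⟨d, hd⟩) (fun d hd => by simpa [F] using hs' d hd), by simpa using hs, ?_⟩
  rw [List.map_pmap]; simp

def pieceMap {X : Type*} (g : X → V) (d : Piece X) : Piece V :=
  ((g d.1.1, g d.1.2), (g d.2.1.1, g d.2.1.2), d.2.2.map g)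

lemma tot_old (D : List (Seg V)) :
    tot (D.map fun d => (d.1, d.2.1, d.2.2.1)) = segEnds D + segOld D := by
  induction D with
  | nil => simp [tot, segEnds, segOld]
  | cons d D ih =>
    rw [List.map_cons, tot_cons, ih]
    simp only [segEnds, segOld, List.map_cons, List.sum_cons, verts, ← Multiset.cons_coe,
      Multiset.insert_eq_cons, ← Multiset.singleton_add]
    abel

lemma tot_new (D : List (Seg V)) :
    tot (D.map fun d => (d.1, d.2.1, d.2.2.2)) = segEnds D + segNew D := by
  induction D with
  | nil => simp [tot, segEnds, segNew]
  | cons d D ih =>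
    rw [List.map_cons, tot_cons, ih]
    simp only [segEnds, segNew, List.map_cons, List.sum_cons, verts, ← Multiset.cons_coe,
      Multiset.insert_eq_cons, ← Multiset.singleton_add]
    abel

lemma tot_mem {l : List (Piece V)} {d : Piece V} (hd : d ∈ l) {v : V}
    (hv : v ∈ verts d.1 d.2.1 d.2.2) : v ∈ tot l := by
  induction l with
  | nil => simp at hd
  | cons d' l ih =>
    rw [tot_cons, Multiset.mem_add]
    rcases List.mem_cons.1 hd with rfl | hd
    · exact Or.inl hv
    · exact Or.inr (ih hd)

lemma length_le_of_mem {l : List (Piece V)} {d : Piece V} (hd : d ∈ l) :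
    d.2.2.length ≤ (tot l).card := by
  induction l with
  | nil => simp at hd
  | cons d' l ih =>
    rw [tot_cons, Multiset.card_add]
    rcases List.mem_cons.1 hd with rfl | hd
    · simp [verts]; omega
    · have := ih hd; omega

/-- The paths in the pattern `x.2` placed on the vertices `x.1` are disjoint paths. -/
def Good (E : V → V → V → V → V → Prop) {c : ℕ} (x : (Fin c → V) × Pattern c) : Prop :=
  Valid E (x.2.1.map (pieceMap x.1)) ∧ (tot (x.2.1.map (pieceMap x.1))).Nodup ∧
    ∀ v ∈ tot (x.2.1.map (pieceMap x.1)), v ∈ univ.image x.1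

lemma Tr.pattern {c : ℕ} (hc : 0 < c) {g : Fin c → V} {T : Multiset V} (h : Tr E (Set.range g) 0 T) :
    ∃ s : Pattern c, Good E (g, s) ∧ Absorbs E (s.1.map (pieceMap g)) T := by
  obtain ⟨D, h1, h2, ⟨h3, h4⟩, -⟩ := h
  rw [← tot_old] at h3 h4
  set l : List (Piece V) := D.map fun d => (d.1, d.2.1, d.2.2.1) with hl
  have hr : ∀ v ∈ tot l, v ∈ Set.range g := fun v hv => by simpa using h4 v hv
  have hsub : (tot l).toFinset ⊆ univ.image g := fun v hv => by
    simpa using hr v (by simpa using hv)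
  have hcard : (tot l).card ≤ c := by
    rw [← Multiset.toFinset_card_of_nodup h3]
    exact (card_le_card hsub).trans (card_image_le.trans (by simp))
  have : Nonempty (Fin c) := ⟨⟨0, hc⟩⟩
  let σ := Function.invFun g
  have hσ : ∀ v ∈ tot l, g (σ v) = v := fun v hv => Function.invFun_eq (hr v hv)
  have hid : (l.map (pieceMap σ)).map (pieceMap g) = l := by
    rw [List.map_map]
    conv_rhs => rw [← List.map_id l]
    refine List.map_congr_left fun d hd => ?_
    have hv : ∀ v ∈ verts d.1 d.2.1 d.2.2, g (σ v) = v := fun v hv => hσ v (tot_mem hd hv)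
    have e : d.2.2.map (g ∘ σ) = d.2.2 := by
      conv_rhs => rw [← List.map_id d.2.2]
      exact List.map_congr_left fun v hv' => hv v (by simp [verts, hv'])
    refine Prod.ext (Prod.ext ?_ ?_) (Prod.ext (Prod.ext ?_ ?_) ?_)
    · exact hv _ (by simp [verts])
    · exact hv _ (by simp [verts])
    · exact hv _ (by simp [verts])
    · exact hv _ (by simp [verts])
    · simpa [pieceMap] using e
  refine ⟨⟨l.map (pieceMap σ), ?_, ?_⟩, ?_, ?_⟩
  · have := length_le_tot l
    rw [List.length_map]; omega
  · intro d hd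
    obtain ⟨d', hd', rfl⟩ := List.mem_map.1 hd
    have := length_le_of_mem hd'
    simp only [pieceMap, List.length_map]; omega
  · simp only [Good, hid]
    refine ⟨fun d hd => ?_, h3, fun v hv => by simpa using hr v hv⟩
    obtain ⟨d', hd', rfl⟩ := List.mem_map.1 hd
    exact (h1 d' hd').1
  · simp only [hid]
    refine ⟨D.map fun d => (d.1, d.2.1, d.2.2.2), by simp [hl, pieceEnds], fun d hd => ?_, ?_⟩
    · obtain ⟨d', hd', rfl⟩ := List.mem_map.1 hd
      exact (h1 d' hd').2
    · rw [tot_new, hl, tot_old, add_assoc, ← h2, add_zero]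

end

/-- There is a small family of disjoint absorbers such that every triple can be absorbed by many of
them. -/
theorem exists_absorbers {ε : ℝ} (hε : 0 < ε) : ∃ (β : ℝ) (n₀ : ℕ), 0 < β ∧
    ∀ (V : Type) [Finite V], n₀ ≤ Nat.card V → ∀ (E : V → V → V → V → V → Prop), Sym5 E →
      (∀ x y, x ≠ y → 91 / 216 ≤ Pr (fun t : V × V × V => E x y t.1 t.2.1 t.2.2)) →
      ∃ (m : ℕ) (a : Fin m → List (Piece V)), (∀ i, Valid E (a i)) ∧ (∑ i, tot (a i)).Nodup ∧
        ((∑ i, tot (a i)).card : ℝ) ≤ ε * Nat.card V ∧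
        ∀ x y z, x ≠ y → x ≠ z → y ≠ z →
          β * Nat.card V ≤ ((univ.filter fun i => Absorbs E (a i) {x, y, z}).card : ℝ) := by
  obtain ⟨β, c₀, n₁, hβ, H₁⟩ := TrP.absorb
  set c := c₀ + 1 with hcdef
  have hc : (0:ℝ) < c := by positivity
  have hne : Nonempty (Pattern c) := ⟨⟨[], by simp⟩⟩
  have hpat : (0:ℝ) < Nat.card (Pattern c) := by exact_mod_cast Nat.card_pos
  set β₂ := β * (1 / Nat.card (Pattern c)) with hβ₂
  have hβ₂pos : 0 < β₂ := by positivity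
  set ε' := min (β₂ / (64 * c ^ 2)) (ε / (2 * c)) with hε'
  have hε'pos : 0 < ε' := lt_min (by positivity) (by positivity)
  obtain ⟨n₂, H₂⟩ := selection hβ₂pos hε'pos 3
  obtain ⟨n₃, hn₃⟩ := exists_nat_gt (1 / ε')
  refine ⟨β₂ * ε' / 8, n₁ + n₂ + n₃ + 1, by positivity, fun V _ hn E hE hdeg => ?_⟩
  have hV : Nonempty V := (Nat.card_pos_iff.1 (by omega)).1
  have hVpos : (0:ℝ) < Nat.card V := by exact_mod_cast (by omega)
  cases nonempty_fintype V
  let J := {t : V × V × V // t.1 ≠ t.2.1 ∧ t.1 ≠ t.2.2 ∧ t.2.1 ≠ t.2.2}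
  set m := ⌈ε' * Nat.card V⌉₊ with hm
  have hm1 : ε' * Nat.card V ≤ m := Nat.le_ceil _
  have hm2 : (m : ℝ) ≤ 2 * ε' * Nat.card V := by
    have h1 := Nat.ceil_lt_add_one (show 0 ≤ ε' * Nat.card V by positivity)
    have h2 : (n₃ : ℝ) ≤ Nat.card V := by exact_mod_cast (by omega)
    have h3 : 1 < ε' * Nat.card V := by
      rw [div_lt_iff₀ hε'pos] at hn₃
      have := mul_le_mul_of_nonneg_right h2 hε'pos.le
      linarith
    linarith
  obtain ⟨x, I, hI, hQ⟩ := H₂ (Nat.card V) (by omega) ((Fin c → V) × Pattern c) J V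
    (fun ω => univ.image ω.1)
    (fun j ω => Good E ω ∧ Absorbs E (ω.2.1.map (pieceMap ω.1)) {j.1.1, j.1.2.1, j.1.2.2})
    ((c : ℝ) * c / Nat.card V) m
    (by
      refine (Fintype.card_subtype_le _).trans ?_
      simp [Nat.card_eq_fintype_card]; ring_nf; rfl)
    hm1
    (by
      have h1 : ε' ≤ β₂ / (64 * c ^ 2) := min_le_left _ _
      rw [le_div_iff₀ (by positivity)] at h1
      have h2 := mul_le_mul_of_nonneg_left hm2 (show 0 ≤ (c : ℝ) * c / Nat.card V by positivity)
      refine h2.trans ?_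
      have h3 : (c : ℝ) * c / Nat.card V * (2 * ε' * Nat.card V) = 2 * (ε' * c ^ 2) := by
        field_simp
      rw [h3]; linarith)
    (fun j => by
      have h1 := (H₁ V (by omega) E hE hdeg _ _ _ j.2.1 j.2.2.1 j.2.2.2).mono le_rfl (Nat.le_succ c₀)
      refine (Pr_prod_ge (Q := fun g s => Good E (g, s) ∧
        Absorbs E (s.1.map (pieceMap g)) {j.1.1, j.1.2.1, j.1.2.2}) (by positivity) h1 fun g hg => ?_).trans
        (Pr_mono fun ω h => h.2)
      obtain ⟨s, hs⟩ := Tr.pattern (Nat.succ_pos c₀) hg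
      refine le_trans ?_ (Pr_mono (P := fun s' => s' = s) fun s' h => by rw [h]; exact hs)
      cases nonempty_fintype (Pattern c)
      rw [Pr_eq_single, Nat.card_eq_fintype_card])
    (fun ω => (Pr_fst _).trans_le (Pr_conflict ω.1))
  let a : Fin m → List (Piece V) := fun i =>
    if i ∈ I ∧ Good E (x i) then (x i).2.1.map (pieceMap (x i).1) else []
  have ha : ∀ i, Valid E (a i) ∧ (tot (a i)).Nodup ∧ ∀ v ∈ tot (a i), i ∈ I ∧ v ∈ univ.image (x i).1 := by
    intro i
    by_cases h : i ∈ I ∧ Good E (x i)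
    · simp only [a, if_pos h]
      exact ⟨h.2.1, h.2.2.1, fun v hv => ⟨h.1, h.2.2.2 v hv⟩⟩
    · simp only [a, if_neg h]
      simp [Valid, tot]
  refine ⟨m, a, fun i => (ha i).1, ?_, ?_, ?_⟩
  · refine nodup_sum _ _ (fun i _ => (ha i).2.1) fun i _ j _ hij v hv hv' => ?_
    have h1 := (ha i).2.2 v hv
    have h2 := (ha j).2.2 v hv'
    exact Finset.disjoint_left.1 (hI i h1.1 j h2.1 hij) h1.2 h2.2
  · rw [Multiset.card_sum]
    have h1 : ∀ i ∈ (univ : Finset (Fin m)), (tot (a i)).card ≤ c := fun i _ => by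
      rw [← Multiset.toFinset_card_of_nodup (ha i).2.1]
      refine (card_le_card (t := univ.image (x i).1) fun v hv => ?_).trans (card_image_le.trans (by simp))
      exact ((ha i).2.2 v (by simpa using hv)).2
    have h2 : ((∑ i, (tot (a i)).card : ℕ) : ℝ) ≤ m * c := by
      have := sum_le_sum h1
      simp only [sum_const, card_univ, Fintype.card_fin, smul_eq_mul] at this
      exact_mod_cast this
    have h3 : ε' ≤ ε / (2 * c) := min_le_right _ _
    rw [le_div_iff₀ (by positivity)] at h3
    refine h2.trans ((mul_le_mul_of_nonneg_right hm2 hc.le).trans ?_)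
    have := mul_le_mul_of_nonneg_right h3 hVpos.le
    linarith
  · intro u v w h1 h2 h3
    have h4 := hQ ⟨(u, v, w), h1, h2, h3⟩
    refine le_trans ?_ (h4.trans (Nat.cast_le.2 (card_le_card fun i hi => ?_)))
    · have := mul_le_mul_of_nonneg_left hm1 hβ₂pos.le
      linarith
    · simp only [mem_filter, mem_univ, true_and] at hi ⊢
      obtain ⟨hi1, hi2, hi3⟩ := hi
      simp only [a, if_pos (And.intro hi1 hi2)]
      exact hi3

end

/-- A small set of vertices, avoiding a given small set, which contains many connections between
any two pairs of vertices. -/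
theorem exists_reservoir {ρ : ℝ} (hρ : 0 < ρ) : ∃ (τ : ℝ) (n₀ : ℕ), 0 < τ ∧
    ∀ (V : Type) [Finite V], n₀ ≤ Nat.card V → ∀ (E : V → V → V → V → V → Prop), Sym5 E →
      (∀ x y, x ≠ y → 91 / 216 ≤ Pr (fun t : V × V × V => E x y t.1 t.2.1 t.2.2)) →
      ∀ X : Finset V, (10 ^ 7 * X.card : ℝ) ≤ Nat.card V →
        ∃ Y : Finset V, Disjoint Y X ∧ (Y.card : ℝ) ≤ ρ * Nat.card V ∧
          ∀ N : ℕ, (N : ℝ) ≤ τ * Nat.card V → Connects E Y N := by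
  set ε := min (1 / 10 ^ 10) (ρ / 8) with hε'
  have hε : 0 < ε := lt_min (by positivity) (by positivity)
  obtain ⟨n₂, H₂⟩ := selection (show (0:ℝ) < 1 / 10 ^ 6 by positivity) hε 4
  obtain ⟨n₃, hn₃⟩ := exists_nat_gt (1 / ε)
  refine ⟨1 / 10 ^ 6 * ε / 16, n₂ + n₃ + 10 ^ 9, by positivity, fun V _ hn E hE hdeg X hX => ?_⟩
  have hV : Nonempty V := (Nat.card_pos_iff.1 (by omega)).1
  have hVbig : (10 ^ 9 : ℝ) ≤ Nat.card V := by exact_mod_cast (by omega)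
  have hVpos : (0:ℝ) < Nat.card V := by linarith
  cases nonempty_fintype V
  set m := ⌈ε * Nat.card V⌉₊ with hm
  have hm1 : ε * Nat.card V ≤ m := Nat.le_ceil _
  have hm2 : (m : ℝ) ≤ 2 * ε * Nat.card V := by
    have h1 := Nat.ceil_lt_add_one (show 0 ≤ ε * Nat.card V by positivity)
    have h2 : (n₃ : ℝ) ≤ Nat.card V := by exact_mod_cast (by omega)
    have h3 : 1 < ε * Nat.card V := by
      rw [div_lt_iff₀ hε] at hn₃
      have := mul_le_mul_of_nonneg_right h2 hε.le
      linarith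
    linarith
  let J := {t : (V × V) × V × V // t.1.1 ≠ t.1.2 ∧ t.2.1 ≠ t.2.2}
  obtain ⟨Link, hLink⟩ : ∃ Q : J → (Fin 4 → V) → Prop, ∀ j w, Q j w ↔
      ((E j.1.1.1 j.1.1.2 (w 2) (w 0) (w 1) ∧ E (w 0) (w 1) (w 3) j.1.2.1 j.1.2.2) ∧
        Function.Injective w) ∧ ∀ k, w k ∉ X := ⟨_, fun _ _ => Iff.rfl⟩
  obtain ⟨x, I, hI, hQ⟩ := H₂ (Nat.card V) (by omega) (Fin 4 → V) J V
    (fun w => univ.image w) Link (((4 : ℕ) : ℝ) * (4 : ℕ) / Nat.card V) m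
    (by
      refine (Fintype.card_subtype_le _).trans ?_
      simp [Nat.card_eq_fintype_card]; ring_nf; rfl)
    hm1
    (by
      have h1 : ε ≤ 1 / 10 ^ 10 := min_le_left _ _
      have h2 := mul_le_mul_of_nonneg_left hm2
        (show 0 ≤ ((4 : ℕ) : ℝ) * (4 : ℕ) / Nat.card V by positivity)
      refine h2.trans ?_
      have h3 : ((4 : ℕ) : ℝ) * (4 : ℕ) / Nat.card V * (2 * ε * Nat.card V) = 32 * ε := by
        field_simp; norm_num
      rw [h3]; norm_num at h1 ⊢; linarith)
    (fun j => by
      let e : (V × V) × V × V ≃ (Fin 4 → V) :=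
        { toFun := fun x => ![x.1.1, x.1.2, x.2.1, x.2.2]
          invFun := fun g => ((g 0, g 1), g 2, g 3)
          left_inv := fun x => rfl
          right_inv := fun g => by ext i; fin_cases i <;> rfl }
      have h1 := connecting hE hdeg j.2.1 j.2.2
      have h2 := Pr_equiv e (fun w : Fin 4 → V =>
        E j.1.1.1 j.1.1.2 (w 2) (w 0) (w 1) ∧ E (w 0) (w 1) (w 3) j.1.2.1 j.1.2.2)
      rw [show (fun x : (V × V) × V × V => E j.1.1.1 j.1.1.2 x.2.1 x.1.1 x.1.2 ∧
        E x.1.1 x.1.2 x.2.2 j.1.2.1 j.1.2.2) = fun x => E j.1.1.1 j.1.1.2 (e x 2) (e x 0) (e x 1) ∧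
        E (e x 0) (e x 1) (e x 3) j.1.2.1 j.1.2.2 from rfl, h2] at h1
      have h3 := Pr_and_ge h1 (Pr_not_injective (X := V) (κ := Fin 4))
      have h4 := Pr_and_ge h3 (Q := fun w : Fin 4 → V => ∀ k, w k ∉ X)
        ((Pr_mono fun w h => by simpa using h).trans (Pr_hit (κ := Fin 4) X))
      rw [show Link j = fun w => ((E j.1.1.1 j.1.1.2 (w 2) (w 0) (w 1) ∧
        E (w 0) (w 1) (w 3) j.1.2.1 j.1.2.2) ∧ Function.Injective w) ∧ ∀ k, w k ∉ X from
        funext fun w => propext (hLink j w)]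
      refine le_trans ?_ h4
      rw [Fintype.card_fin]
      have h5 : ((4 : ℕ) : ℝ) ^ 2 / Nat.card V ≤ 16 / 10 ^ 9 := by
        rw [div_le_div_iff₀ hVpos (by positivity)]; push_cast; linarith
      have h6 : ((4 : ℕ) : ℝ) * X.card / Nat.card V ≤ 4 / 10 ^ 7 := by
        rw [div_le_div_iff₀ hVpos (by positivity)]; push_cast; linarith
      norm_num at h5 h6 ⊢; linarith)
    (fun ω => Pr_conflict ω)
  refine ⟨(I.filter fun i => ∀ k, x i k ∉ X).biUnion fun i => univ.image (x i), ?_, ?_, ?_⟩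
  · rw [Finset.disjoint_left]
    intro v hv
    simp only [mem_biUnion, mem_filter, mem_image] at hv
    obtain ⟨i, ⟨-, hi⟩, k, -, rfl⟩ := hv
    exact hi k
  · have h1 : ((I.filter fun i => ∀ k, x i k ∉ X).biUnion fun i => univ.image (x i)).card ≤ m * 4 := by
      refine card_biUnion_le_card_mul _ _ 4 (fun i _ => card_image_le.trans (by simp)) |>.trans ?_
      exact Nat.mul_le_mul_right _ ((card_le_univ _).trans (by simp))
    have h2 : ε ≤ ρ / 8 := min_le_right _ _
    have h3 : (((I.filter fun i => ∀ k, x i k ∉ X).biUnion fun i => univ.image (x i)).card : ℝ)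
        ≤ m * 4 := by exact_mod_cast h1
    have := mul_le_mul_of_nonneg_right h2 hVpos.le
    linarith
  · intro N hN p q hp hq W hW
    have h1 := hQ ⟨(p, q), hp, hq⟩
    have h2 : W.card < (I.filter fun i => Link ⟨(p, q), hp, hq⟩ (x i)).card := by
      have h3 : (W.card : ℝ) ≤ N := by exact_mod_cast hW
      have h5 : 0 < ε * Nat.card V := by positivity
      have : (W.card : ℝ) < (I.filter fun i => Link ⟨(p, q), hp, hq⟩ (x i)).card := by
        refine lt_of_lt_of_le ?_ h1
        linarith
      exact_mod_cast this
    by_contra hcon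
    have h3 : ∀ i ∈ I.filter fun i => Link ⟨(p, q), hp, hq⟩ (x i), ∃ k, x i k ∈ W := by
      intro i hi
      by_contra! hk
      simp only [mem_filter, hLink] at hi
      obtain ⟨hi, ⟨⟨h4, h5⟩, h6⟩, h7⟩ := hi
      refine hcon ⟨(x i 0, x i 1), x i 2, x i 3, h4, h5, ?_, ?_⟩
      · simp [h6.eq_iff]
      · intro v hv
        have : ∃ k, v = x i k := by
          simp only [List.mem_cons, List.not_mem_nil, or_false] at hv
          rcases hv with h | h | h | h <;> exact ⟨_, h⟩
        obtain ⟨k, rfl⟩ := this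
        exact ⟨mem_biUnion.2 ⟨i, mem_filter.2 ⟨hi, h7⟩, mem_image_of_mem _ (mem_univ _)⟩, hk k⟩
    choose! k hk using h3
    refine absurd (card_le_card_of_injOn (fun i => x i (k i)) hk fun i hi j hj hij => ?_) (not_le.2 h2)
    by_contra hne
    have hi' := (mem_filter.1 hi).1
    have hj' := (mem_filter.1 hj).1
    refine Finset.disjoint_left.1 (hI i hi' j hj' hne) (mem_image_of_mem _ (mem_univ (k i))) ?_
    rw [show x i (k i) = x j (k j) from hij]
    exact mem_image_of_mem _ (mem_univ _)

section

lemma exists_triples {V : Type*} (k : ℕ) : ∀ R : Finset V, R.card = 3 * k →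
    ∃ Ts : List (Multiset V), Ts.length = k ∧ Ts.sum = R.val ∧
      ∀ T ∈ Ts, ∃ x y z, x ≠ y ∧ x ≠ z ∧ y ≠ z ∧ T = {x, y, z} := by
  induction k with
  | zero => intro R hR; exact ⟨[], rfl, by rw [card_eq_zero.1 hR]; rfl, by simp⟩
  | succ k ih =>
    intro R hR
    obtain ⟨S, hSR, hS⟩ := exists_subset_card_eq (show 3 ≤ R.card by omega)
    obtain ⟨Ts, h1, h2, h3⟩ := ih (R \ S) (by rw [card_sdiff_of_subset hSR]; omega)
    obtain ⟨x, y, z, hxy, hxz, hyz, rfl⟩ := card_eq_three.1 hS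
    refine ⟨({x, y, z} : Multiset V) :: Ts, by simp [h1], ?_, ?_⟩
    · have hv : ({x, y, z} : Finset V).val = ({x, y, z} : Multiset V) := by
        rw [Finset.insert_val_of_notMem (by simp [hxy, hxz]), Finset.insert_val_of_notMem (by simp [hyz])]
        rfl
      rw [List.sum_cons, h2, ← hv, sdiff_val]
      exact add_tsub_cancel_of_le (val_le_iff.2 hSR)
    · intro T hT
      rcases List.mem_cons.1 hT with rfl | hT
      · exact ⟨x, y, z, hxy, hxz, hyz, rfl⟩
      · exact h3 T hT

section
variable {V : Type*} {E : V → V → V → V → V → Prop}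

lemma tot_flatten {m : ℕ} (a : Fin m → List (Piece V)) :
    tot (List.ofFn a).flatten = ∑ i, tot (a i) := by
  unfold tot
  rw [List.map_flatten, List.sum_flatten, List.map_map, List.map_ofFn, List.sum_ofFn]
  rfl

lemma pieceEnds_flatten {m : ℕ} (a : Fin m → List (Piece V)) :
    pieceEnds (List.ofFn a).flatten = (List.ofFn fun i => pieceEnds (a i)).flatten := by
  unfold pieceEnds
  rw [List.map_flatten, List.map_ofFn]
  rfl

lemma Valid.flatten {m : ℕ} {a : Fin m → List (Piece V)} (ha : ∀ i, Valid E (a i)) :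
    Valid E (List.ofFn a).flatten := by
  intro d hd
  obtain ⟨s, hs, hd⟩ := List.mem_flatten.1 hd
  obtain ⟨i, rfl⟩ := (List.mem_ofFn' _ _).1 hs
  exact ha i d hd

lemma Valid.ne (hE : Sym5 E) {l : List (Piece V)} (hl : Valid E l) :
    ∀ f ∈ pieceEnds l, f.1.1 ≠ f.1.2 ∧ f.2.1 ≠ f.2.2 := by
  intro f hf
  obtain ⟨d, hd, rfl⟩ := List.mem_map.1 hf
  exact (hl d hd).ne hE

end

lemma IsPathSet.exists_val {V : Type*} {E : V → V → V → V → V → Prop} {S : Finset V}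
    (h : IsPathSet E S) : ∃ p q L, Conn E p q L ∧ S.val = (verts p q L : Multiset V) := by
  obtain ⟨p, q, L, h1, h2, rfl⟩ := h
  exact ⟨p, q, L, h1, by rw [List.toFinset_val, List.Nodup.dedup h2]⟩

/-- There is a short path which can absorb every small set whose size is divisible by 3. -/
theorem exists_absorbing_path {ε : ℝ} (hε : 0 < ε) : ∃ (β : ℝ) (n₀ : ℕ), 0 < β ∧
    ∀ (V : Type) [Finite V], n₀ ≤ Nat.card V → ∀ (E : V → V → V → V → V → Prop), Sym5 E →
      (∀ x y, x ≠ y → 91 / 216 ≤ Pr (fun t : V × V × V => E x y t.1 t.2.1 t.2.2)) →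
      ∃ (X : Finset V) (p q : V × V), (X.card : ℝ) ≤ ε * Nat.card V ∧ p.1 ≠ p.2 ∧ q.1 ≠ q.2 ∧
        ∀ R : Finset V, Disjoint R X → 3 ∣ R.card → (R.card : ℝ) ≤ β * Nat.card V →
          ∃ M, Conn E p q M ∧ (verts p q M : Multiset V) = X.val + R.val := by
  obtain ⟨τ, n₁, hτ, H₁⟩ := exists_reservoir (half_pos hε)
  obtain ⟨β, n₂, hβ, H₂⟩ := exists_absorbers (ε := min (min (ε / 2) (1 / 10 ^ 7)) τ)
    (lt_min (lt_min (half_pos hε) (by positivity)) hτ)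
  refine ⟨β, n₁ + n₂ + 3, hβ, fun V _ hn E hE hdeg => ?_⟩
  obtain ⟨m, a, ha, hnd, hcard, habs⟩ := H₂ V (by omega) E hE hdeg
  have hVpos : (0:ℝ) < Nat.card V := by exact_mod_cast (by omega)
  cases nonempty_fintype V
  set l₀ := (List.ofFn a).flatten with hl₀
  rw [← tot_flatten, ← hl₀] at hnd hcard
  have hmul : ∀ {c : ℝ}, min (min (ε / 2) (1 / 10 ^ 7)) τ ≤ c → ((tot l₀).card : ℝ) ≤ c * Nat.card V :=
    fun h => hcard.trans (mul_le_mul_of_nonneg_right h hVpos.le)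
  have hX₁ := hmul ((min_le_left _ _).trans (min_le_left _ _))
  have hX₂ := hmul ((min_le_left _ _).trans (min_le_right _ _))
  have hX₃ := hmul (min_le_right _ _)
  have hcf : ((tot l₀).toFinset.card : ℝ) = (tot l₀).card := by
    rw [Multiset.toFinset_card_of_nodup hnd]
  obtain ⟨Y, hYX, hYc, hYN⟩ := H₁ V (by omega) E hE hdeg (tot l₀).toFinset (by
    rw [hcf]; norm_num at hX₂ ⊢; linarith)
  have hne : l₀ ≠ [] := by
    obtain ⟨S, -, hS⟩ := exists_subset_card_eq (s := (univ : Finset V)) (n := 3)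
      (by rw [card_univ, ← Nat.card_eq_fintype_card]; omega)
    obtain ⟨x, y, z, hxy, hxz, hyz, rfl⟩ := card_eq_three.1 hS
    have h1 := habs x y z hxy hxz hyz
    have h2 : 0 < (univ.filter fun i => Absorbs E (a i) {x, y, z}).card := by
      have : 0 < β * Nat.card V := by positivity
      exact_mod_cast this.trans_le h1
    obtain ⟨i, hi⟩ := card_pos.1 h2
    obtain ⟨l', h3, -, h5⟩ := (mem_filter.1 hi).2
    intro h0
    have h6 : a i = [] := by
      rw [hl₀, List.flatten_eq_nil_iff] at h0
      exact h0 _ ((List.mem_ofFn' _ _).2 ⟨i, rfl⟩)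
    rw [h6] at h3 h5
    have h7 : l' = [] := by simpa [pieceEnds] using h3
    rw [h7] at h5
    simp [tot] at h5
  obtain ⟨d, ds, hds⟩ := List.exists_cons_of_ne_nil hne
  have hends : pieceEnds l₀ = (d.1, d.2.1) :: pieceEnds ds := by rw [hds]; rfl
  have hlen : 4 * (pieceEnds ds).length ≤ (tot l₀).card := by
    have := length_le_tot l₀
    rw [hds] at this ⊢
    simp only [List.length_cons, pieceEnds, List.length_map] at this ⊢
    omega
  obtain ⟨K, q, hK, hKY, -, hq, hl⟩ := join (N := (pieceEnds ds).length)
    (hYN _ (le_trans (by exact_mod_cast hlen) hX₃)) (pieceEnds ds) (d.1, d.2.1)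
    (by rw [← hends]; exact Valid.ne hE (Valid.flatten ha)) le_rfl
  have hXK : (tot l₀ + K).Nodup := by
    refine Multiset.nodup_add.2 ⟨hnd, hK, Multiset.disjoint_left.2 fun {v} hv hv' => ?_⟩
    exact Finset.disjoint_left.1 hYX (hKY v hv') (by simpa using hv)
  refine ⟨⟨tot l₀ + K, hXK⟩, d.1, q, ?_, ?_, hq, ?_⟩
  · have h1 : K.card ≤ Y.card := by
      rw [← Multiset.toFinset_card_of_nodup hK]
      exact card_le_card fun v hv => hKY v (by simpa using hv)
    have h2 : (K.card : ℝ) ≤ Y.card := by exact_mod_cast h1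
    rw [Finset.card_mk, Multiset.card_add]
    push_cast
    linarith
  · exact (Valid.ne hE (Valid.flatten ha) (d.1, d.2.1) (by rw [← hl₀, hends]; simp)).1
  · rintro R hRX ⟨k, hk⟩ hRc
    obtain ⟨Ts, hTl, hTs, hT⟩ := exists_triples k R hk
    obtain ⟨g, hg, hgs, -⟩ := absorb_many (N := k) a ha Ts hTl.le fun T hT' => by
      obtain ⟨x, y, z, hxy, hxz, hyz, rfl⟩ := hT T hT'
      have h1 : k ≤ R.card := by omega
      have h2 : (k : ℝ) ≤ R.card := by exact_mod_cast h1
      exact_mod_cast (h2.trans hRc).trans (habs x y z hxy hxz hyz)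
    obtain ⟨M, hM, hM'⟩ := hl (List.ofFn g).flatten (by
      rw [← hends, hl₀, pieceEnds_flatten, pieceEnds_flatten]
      simp only [(hg _).1]) (Valid.flatten fun i => (hg i).2)
    refine ⟨M, hM, ?_⟩
    change _ = tot l₀ + K + R.val
    rw [hM', tot_flatten, hgs, hTs, hl₀, tot_flatten]
    abel

/-- The minimum degree condition forces a Hamilton cycle, written as a closed path. -/
theorem exists_closed_path {η : ℝ} (hη : 0 < η) : ∃ n₀ : ℕ, ∀ (V : Type) [Fintype V],
    n₀ ≤ Fintype.card V → 3 ∣ Fintype.card V → ∀ (E : V → V → V → V → V → Prop), Sym5 E →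
      (∀ x y, x ≠ y → 91 / 216 + η ≤ Pr (fun t : V × V × V => E x y t.1 t.2.1 t.2.2)) →
      ∃ p M, Conn E p p M ∧ ((p.1 :: p.2 :: M : List V) : Multiset V) = univ.val := by
  set ε := min (1 / 10 ^ 7) (η / 24) with hεd
  have hε : 0 < ε := lt_min (by positivity) (by positivity)
  obtain ⟨β, n₁, hβ, H₁⟩ := exists_absorbing_path hε
  set ρ := min (1 / 4) (min (β / 4) (η / 24)) with hρd
  have hρ : 0 < ρ := lt_min (by positivity) (lt_min (by positivity) (by positivity))
  obtain ⟨τ, n₂, hτ, H₂⟩ := exists_reservoir hρ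
  set γ := min (1 / 4) (min (β / 4) (τ / 4)) with hγd
  have hγ : 0 < γ := lt_min (by positivity) (lt_min (by positivity) (by positivity))
  have hγ1 : γ < 1 := (min_le_left _ _).trans_lt (by norm_num)
  obtain ⟨b, n₃, hb, hbγ, H₃⟩ := exists_path_cover (half_pos hη) hγ hγ1
  refine ⟨n₁ + n₂ + 2 * n₃ + 1, fun V _ hn h3 E hE hdeg => ?_⟩
  have hVe : Nat.card V = Fintype.card V := Nat.card_eq_fintype_card
  have hdeg' : ∀ x y, x ≠ y → 91 / 216 ≤ Pr (fun t : V × V × V => E x y t.1 t.2.1 t.2.2) :=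
    fun x y h => by linarith [hdeg x y h]
  have hne : Nonempty V := Fintype.card_pos_iff.1 (by omega)
  obtain ⟨n, hnd⟩ : ∃ n : ℝ, n = Fintype.card V := ⟨_, rfl⟩
  have hnpos : 0 < n := by rw [hnd]; exact_mod_cast Fintype.card_pos
  have le₁ : ∀ {c d : ℝ}, c ≤ d → c * n ≤ d * n := fun h => mul_le_mul_of_nonneg_right h hnpos.le
  have hε₁ : ε * n ≤ 1 / 10 ^ 7 * n := le₁ (min_le_left _ _)
  have hε₂ : ε * n ≤ η / 24 * n := le₁ (min_le_right _ _)
  have hρ₁ : ρ * n ≤ 1 / 4 * n := le₁ (min_le_left _ _)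
  have hρ₂ : ρ * n ≤ β / 4 * n := le₁ ((min_le_right _ _).trans (min_le_left _ _))
  have hρ₃ : ρ * n ≤ η / 24 * n := le₁ ((min_le_right _ _).trans (min_le_right _ _))
  have hγ₂ : γ * n ≤ β / 4 * n := le₁ ((min_le_right _ _).trans (min_le_left _ _))
  have hγ₃ : γ * n ≤ τ / 4 * n := le₁ ((min_le_right _ _).trans (min_le_right _ _))
  obtain ⟨X, p, q, hXc, hp, hq, hX⟩ := H₁ V (by omega) E hE hdeg'
  rw [hVe, ← hnd] at hXc hX
  obtain ⟨Y, hYX, hYc, hYN⟩ := H₂ V (by omega) E hE hdeg' X (by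
    rw [hVe, ← hnd]; norm_num at hε₁ ⊢; linarith)
  rw [hVe, ← hnd] at hYc hYN
  let V' := {v : V // v ∉ X ∪ Y}
  have hV'c : Fintype.card V' + (X.card + Y.card) = Fintype.card V := by
    have h1 := Fintype.card_subtype_compl (fun v => v ∈ X ∪ Y)
    have h2 : Fintype.card {v // v ∈ X ∪ Y} = X.card + Y.card := by
      rw [Fintype.card_coe, card_union_of_disjoint hYX.symm]
    have h4 := card_le_univ (X ∪ Y)
    rw [card_union_of_disjoint hYX.symm] at h4
    rw [h2] at h1
    have h5 : Fintype.card V' = Fintype.card {v // ¬ v ∈ X ∪ Y} := Fintype.card_congr (Equiv.refl _)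
    omega
  have hV'r : (Fintype.card V' : ℝ) + (X.card + Y.card) = n := by rw [hnd]; exact_mod_cast hV'c
  let E' : V' → V' → V' → V' → V' → Prop := fun a b c d e => E a b c d e
  have hE' : Sym5 E' := ⟨fun h => hE.s1 h, fun h => hE.s2 h, fun h => hE.s3 h, fun h => hE.s4 h,
    fun h h' => hE.ne h (congrArg Subtype.val h')⟩
  obtain ⟨P, hP, hPd, hPc⟩ := H₃ V' (by
      have : (n₃ : ℝ) ≤ Fintype.card V' := by
        have h1 : ((2 * n₃ : ℕ) : ℝ) ≤ n := by rw [hnd]; exact_mod_cast (by omega)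
        push_cast at h1
        norm_num at hε₁
        linarith
      exact_mod_cast this) E' hE' fun x y hxy => by
    have h1 := Pr_le_cube (Subtype.val_injective (p := fun v => v ∉ X ∪ Y))
      (fun t : V × V × V => E x y t.1 t.2.1 t.2.2)
    have h2 := hdeg x y (fun h => hxy (Subtype.ext h))
    rw [Pr_not_range Subtype.val_injective, hVe, ← hnd] at h1
    have h4 : 1 - (Nat.card V' : ℝ) / n ≤ η / 12 := by
      rw [Nat.card_eq_fintype_card, sub_le_iff_le_add, ← sub_le_iff_le_add', le_div_iff₀ hnpos]
      linarith
    have h5 : Pr (fun t : V' × V' × V' => E' x y t.1 t.2.1 t.2.2) =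
      Pr (fun t : V' × V' × V' => E x y t.1 t.2.1 t.2.2) := rfl
    rw [h5]
    linarith
  -- the members of the cover as paths of `E`
  have hpc : ∀ S ∈ P, ∃ d : Piece V, Conn E d.1 d.2.1 d.2.2 ∧
      (verts d.1 d.2.1 d.2.2 : Multiset V) = (S.map (Function.Embedding.subtype _)).val := by
    intro S hS
    obtain ⟨p', q', L, h1, h5⟩ := (hP S hS).1.exists_val
    refine ⟨((p'.1, p'.2), (q'.1, q'.2), L.map Subtype.val), h1.map Subtype.val fun _ _ _ _ _ h => h, ?_⟩
    rw [map_val, h5]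
    simp [verts]
  choose! f hf hf' using hpc
  set lc : List (Piece V) := P.toList.map f with hlc
  have hlcV : Valid E lc := by
    intro d hd
    obtain ⟨S, hS, rfl⟩ := List.mem_map.1 hd
    exact hf S (by simpa using hS)
  have hlct : tot lc = ∑ S ∈ P, (S.map (Function.Embedding.subtype _)).val := by
    unfold tot
    rw [hlc, List.map_map, ← sum_map_toList P]
    refine congrArg List.sum (List.map_congr_left fun S hS => hf' S (by simpa using hS))
  have hlcn : (tot lc).Nodup := by
    rw [hlct]
    refine nodup_sum _ _ (fun S _ => Finset.nodup _) fun S hS T hT hST v hv hv' => ?_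
    obtain ⟨u, hu, rfl⟩ := Finset.mem_map.1 hv
    obtain ⟨u', hu', h⟩ := Finset.mem_map.1 hv'
    have h' : u' = u := Subtype.ext h
    exact Finset.disjoint_left.1 (hPd S hS T hT hST) hu (h' ▸ hu')
  have hlcm : ∀ v ∈ tot lc, v ∉ X ∪ Y := by
    intro v hv
    rw [hlct] at hv
    obtain ⟨S, -, hv⟩ := Multiset.mem_sum.1 hv
    obtain ⟨u, -, rfl⟩ := Finset.mem_map.1 hv
    exact u.2
  have hlcc : (tot lc).card = b * P.card := by
    rw [hlct, Multiset.card_sum, sum_congr rfl (fun S hS => by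
      rw [← Finset.card_def, card_map, (hP S hS).2]), sum_const, smul_eq_mul, mul_comm]
  have hlcle : b * P.card ≤ Fintype.card V := by
    rw [← hlcc, ← Multiset.toFinset_card_of_nodup hlcn]
    exact card_le_univ _
  have hPn : (P.card : ℝ) ≤ γ * n := by
    have h1 : (b * P.card : ℝ) ≤ n := by rw [hnd]; exact_mod_cast hlcle
    have h2 := mul_le_mul_of_nonneg_left h1 hγ.le
    have h4 : (P.card : ℝ) * 1 ≤ P.card * (γ * b) := mul_le_mul_of_nonneg_left hbγ (by positivity)
    linarith
  obtain ⟨K, hK, hKY, hl⟩ := join_cycle (E := E) (Y := Y) (N := (pieceEnds lc).length)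
    (hYN _ (by
      simp only [pieceEnds, hlc, List.length_map, length_toList]
      push_cast; linarith)) (pieceEnds lc) (p, q) (by
      intro e he
      rcases List.mem_cons.1 he with rfl | he
      · exact ⟨hp, hq⟩
      · exact hlcV.ne hE e he) le_rfl
  have hfin : ∀ R : Finset V, Disjoint R X → 3 ∣ R.card → (R.card : ℝ) ≤ β * n →
      ∃ M, Conn E p p M ∧ ((p.1 :: p.2 :: M : List V) : Multiset V) = X.val + R.val + tot lc + K := by
    intro R hRX hR3 hRc
    obtain ⟨M, hM, hM'⟩ := hX R hRX hR3 hRc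
    obtain ⟨M', h1, h2⟩ := hl ((p, q, M) :: lc) rfl (by
      intro d hd
      rcases List.mem_cons.1 hd with rfl | hd
      · exact hM
      · exact hlcV d hd)
    exact ⟨M', h1, by rw [h2, tot_cons, hM']⟩
  have hZ : (X.val + (tot lc + K)).Nodup := by
    refine Multiset.nodup_add.2 ⟨X.nodup, Multiset.nodup_add.2 ⟨hlcn, hK, ?_⟩, ?_⟩
    · exact Multiset.disjoint_left.2 fun {v} hv hv' => hlcm v hv (mem_union_right _ (hKY v hv'))
    · refine Multiset.disjoint_left.2 fun {v} hv hv' => ?_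
      rcases Multiset.mem_add.1 hv' with h | h
      · exact hlcm v h (mem_union_left _ hv)
      · exact Finset.disjoint_left.1 hYX (hKY v h) hv
  let Z : Finset V := ⟨X.val + (tot lc + K), hZ⟩
  have hZc : Z.card = X.card + (b * P.card + K.card) := by
    simp only [Z, Finset.card_mk, Multiset.card_add, hlcc, Finset.card_def]
  have hRZ : Zᶜ.card + Z.card = Fintype.card V := by rw [add_comm, card_add_card_compl]
  obtain ⟨M₀, hM₀, hM₀'⟩ := hfin ∅ (by simp) (by simp) (by simp; positivity)
  have hZ3 : 3 ∣ Z.card := by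
    have h1 := congrArg Multiset.card hM₀'
    have h2 := hM₀.length
    simp only [Multiset.coe_card, List.length_cons, empty_val, add_zero, Multiset.card_add, hlcc,
      ← Finset.card_def] at h1
    omega
  have hXZ : X ⊆ Z := fun v hv => Multiset.mem_add.2 (Or.inl hv)
  obtain ⟨M, hM, hM'⟩ := hfin Zᶜ
    (Finset.disjoint_left.2 fun v hv hv' => (mem_compl.1 hv) (hXZ hv'))
    (by omega) (by
      have h1 : (Zᶜ.card : ℝ) + (X.card + (b * P.card + K.card)) = n := by
        rw [hnd, ← hRZ, hZc]; push_cast; ring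
      have h2 : γ * Fintype.card V' ≤ γ * n := by
        refine mul_le_mul_of_nonneg_left ?_ hγ.le
        linarith [Nat.cast_nonneg (α := ℝ) X.card, Nat.cast_nonneg (α := ℝ) Y.card]
      have h4 : (0:ℝ) ≤ β * n := by positivity
      linarith [Nat.cast_nonneg (α := ℝ) K.card])
  refine ⟨p, M, hM, ?_⟩
  rw [hM', ← union_compl Z, ← Finset.disjUnion_eq_union _ _ disjoint_compl_right]
  change _ = (X.val + (tot lc + K)) + Zᶜ.val
  abel

end

lemma Conn.getD {V : Type*} {E : V → V → V → V → V → Prop} (d : V) {p q : V × V} {L : List V}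
    (h : Conn E p q L) : ∀ j, 3 * j < L.length → ∀ w : ℕ → V,
      (∀ i, w i = (p.1 :: p.2 :: (L ++ [q.1, q.2])).getD i d) →
      E (w (3 * j)) (w (3 * j + 1)) (w (3 * j + 2)) (w (3 * j + 3)) (w (3 * j + 4)) := by
  induction h with
  | edge h =>
    intro j hj w hw
    obtain rfl : j = 0 := by simp only [List.length_singleton] at hj; omega
    simpa [hw] using h
  | step h _ ih =>
    intro j hj w hw
    rcases j with _ | j
    · simpa [hw] using h
    · have := ih j (by simp only [List.length_cons] at hj; omega) (fun i => w (i + 3))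
        (fun i => by rw [hw]; simp)
      exact this

lemma hasHamiltonCycle_of_closed {n : ℕ} {H : Finset (Finset (Fin n))} {p : Fin n × Fin n}
    {M : List (Fin n)} (h : Conn (fun a b c d e => ({a, b, c, d, e} : Finset (Fin n)) ∈ H) p p M)
    (hM : ((p.1 :: p.2 :: M : List (Fin n)) : Multiset (Fin n)) = (univ : Finset (Fin n)).val) :
    HasHamiltonCycle n 5 2 H := by
  have hn : M.length + 2 = n := by
    have := congrArg Multiset.card hM
    simpa using this
  have hmod := h.length
  have hnd : (p.1 :: p.2 :: M).Nodup := by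
    rw [← Multiset.coe_nodup, hM]; exact univ.nodup
  have : NeZero n := ⟨by omega⟩
  let w : ℕ → Fin n := fun i => (p.1 :: p.2 :: (M ++ [p.1, p.2])).getD i p.1
  have hw : ∀ i, i < n → ∃ hi : i < (p.1 :: p.2 :: M).length, w i = (p.1 :: p.2 :: M)[i] := by
    intro i hi
    have hi' : i < (p.1 :: p.2 :: M).length := by simp only [List.length_cons]; omega
    refine ⟨hi', ?_⟩
    change ((p.1 :: p.2 :: M) ++ [p.1, p.2]).getD i p.1 = _
    rw [List.getD_append _ _ _ _ hi', List.getD_eq_getElem _ _ hi']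
  have hwn : w n = w 0 := by
    change ((p.1 :: p.2 :: M) ++ [p.1, p.2]).getD n p.1 = p.1
    rw [List.getD_append_right _ _ _ _ (by simp only [List.length_cons]; omega)]
    simp [← hn]
  have hwn1 : w (n + 1) = w 1 := by
    change ((p.1 :: p.2 :: M) ++ [p.1, p.2]).getD (n + 1) p.1 = p.2
    rw [List.getD_append_right _ _ _ _ (by simp only [List.length_cons]; omega)]
    simp [← hn]
  have hcast : ∀ i, i < n + 2 → w ((i : ZMod n)).val = w i := by
    intro i hi
    rw [ZMod.val_natCast]
    by_cases h1 : i < n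
    · rw [Nat.mod_eq_of_lt h1]
    · rw [Nat.mod_eq_sub_mod (by omega), Nat.mod_eq_of_lt (by omega)]
      obtain h2 | h2 : i = n ∨ i = n + 1 := by omega
      · rw [h2, Nat.sub_self, hwn]
      · rw [h2, hwn1]; congr 1; omega
  refine ⟨fun x => w x.val, ?_, fun j hj => ?_⟩
  · refine (Fintype.bijective_iff_injective_and_card _).2 ⟨fun x y hxy => ?_, by simp [ZMod.card]⟩
    obtain ⟨hx, hx'⟩ := hw x.val (ZMod.val_lt x)
    obtain ⟨hy, hy'⟩ := hw y.val (ZMod.val_lt y)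
    simp only [hx', hy'] at hxy
    exact ZMod.val_injective n ((List.Nodup.getElem_inj_iff hnd).1 hxy)
  · have := h.getD p.1 j (by omega) w (fun _ => rfl)
    have hr : range 5 = {0, 1, 2, 3, 4} := rfl
    norm_num only at hj ⊢
    rw [hr]
    simp only [image_insert, image_singleton]
    rw [hcast _ (by omega), hcast _ (by omega), hcast _ (by omega), hcast _ (by omega),
      hcast _ (by omega), mul_comm j 3]
    exact this

lemma six_mul_hDeg_le {n : ℕ} (H : Finset (Finset (Fin n))) {x y : Fin n} (hxy : x ≠ y) :
    6 * hDeg n 5 H {x, y} ≤ Nat.card {g : Fin 3 → Fin n // ({x, y, g 0, g 1, g 2} : Finset _) ∈ H} := by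
  unfold hDeg
  rw [card_pair hxy]
  have h6 : Nat.card (Equiv.Perm (Fin 3)) = 6 := by
    rw [Nat.card_eq_fintype_card, Fintype.card_perm, Fintype.card_fin]; rfl
  rw [← h6, ← Nat.card_prod]
  have him : ∀ (T : Finset (Fin n)) (hT : T.card = 3) (σ : Equiv.Perm (Fin 3)),
      univ.image (fun i => T.orderEmbOfFin hT (σ i)) = T := by
    intro T hT σ
    have h1 : (univ.image fun i => T.orderEmbOfFin hT (σ i)) =
        (univ.image σ).image (T.orderEmbOfFin hT) := by rw [image_image]; rfl
    rw [h1, image_univ_of_surjective σ.surjective, image_orderEmbOfFin_univ]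
  refine Nat.card_le_card_of_injective
    (fun z : Equiv.Perm (Fin 3) × {T : Finset (Fin n) // T.card = 5 - 2 ∧ Disjoint {x, y} T ∧
      {x, y} ∪ T ∈ H} => ⟨fun i => z.2.1.orderEmbOfFin z.2.2.1 (z.1 i), ?_⟩) ?_
  · have h1 := him z.2.1 z.2.2.1 z.1
    have h2 : (univ : Finset (Fin 3)) = {0, 1, 2} := rfl
    rw [h2] at h1
    simp only [image_insert, image_singleton] at h1
    have h3 := z.2.2.2.2
    rw [← h1] at h3
    simpa only [insert_union, singleton_union] using h3
  · rintro ⟨σ, T, hT⟩ ⟨σ', T', hT'⟩ h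
    have h0 : (fun i => T.orderEmbOfFin hT.1 (σ i)) = fun i => T'.orderEmbOfFin hT'.1 (σ' i) :=
      congrArg Subtype.val h
    obtain rfl : T = T' := by rw [← him T hT.1 σ, h0, him]
    obtain rfl : σ = σ' := Equiv.ext fun i => (T.orderEmbOfFin hT.1).injective (congrFun h0 i)
    rfl

lemma six_mul_choose_three (n : ℕ) : (6 : ℝ) * n.choose 3 = n * (n - 1) * (n - 2) := by
  induction n with
  | zero => simp
  | succ n ih =>
    rw [Nat.choose_succ_succ' n 2, Nat.cast_add, mul_add, ih, Nat.cast_choose_two]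
    push_cast; ring

lemma Pr_of_minDeg {η : ℝ} (hη : 0 < η) {n : ℕ} {H : Finset (Finset (Fin n))}
    (hn : 6 * (91 / 216 + η) / η + 2 ≤ n)
    (hH : (91 / 216 + η) * (n.choose 3 : ℝ) ≤ minDeg n 5 2 H) (x y : Fin n) (hxy : x ≠ y) :
    91 / 216 + η / 2 ≤ Pr (fun t : Fin n × Fin n × Fin n =>
      ({x, y, t.1, t.2.1, t.2.2} : Finset (Fin n)) ∈ H) := by
  have hn0 : 0 ≤ 6 * (91 / 216 + η) / η := by positivity
  have hnpos : (0:ℝ) < n := by linarith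
  have h1 : minDeg n 5 2 H ≤ hDeg n 5 H {x, y} := Nat.sInf_le ⟨_, card_pair hxy, rfl⟩
  have h2 : (minDeg n 5 2 H : ℝ) ≤ hDeg n 5 H {x, y} := by exact_mod_cast h1
  have h3 := six_mul_hDeg_le H hxy
  let e : (Fin n × Fin n × Fin n) ≃ (Fin 3 → Fin n) :=
    { toFun := fun x => ![x.1, x.2.1, x.2.2]
      invFun := fun g => (g 0, g 1, g 2)
      left_inv := fun x => rfl
      right_inv := fun g => by ext i; fin_cases i <;> rfl }
  have h4 := Pr_equiv e (fun g => ({x, y, g 0, g 1, g 2} : Finset (Fin n)) ∈ H)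
  rw [show (fun t : Fin n × Fin n × Fin n => ({x, y, t.1, t.2.1, t.2.2} : Finset (Fin n)) ∈ H) =
    fun t => ({x, y, e t 0, e t 1, e t 2} : Finset (Fin n)) ∈ H from rfl, h4, Pr_eq]
  rw [Nat.card_eq_fintype_card, Fintype.card_subtype] at h3
  rw [Fintype.card_fun, Fintype.card_fin, Fintype.card_fin, le_div_iff₀ (by push_cast; positivity)]
  have h5 : (6 * hDeg n 5 H {x, y} : ℝ) ≤ ((univ.filter fun g : Fin 3 → Fin n =>
      ({x, y, g 0, g 1, g 2} : Finset (Fin n)) ∈ H).card : ℝ) := by exact_mod_cast h3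
  refine le_trans ?_ h5
  have h6 := six_mul_choose_three n
  have h7 : 6 * (91 / 216 + η) ≤ (n - 2) * η := by
    rw [← div_le_iff₀ hη]; linarith
  have h8 : (n : ℝ) ^ 3 - 3 * n ^ 2 ≤ 6 * n.choose 3 := by rw [h6]; nlinarith
  have h9 := mul_le_mul_of_nonneg_left h8 (show 0 ≤ 91 / 216 + η by positivity)
  have h10 := mul_le_mul_of_nonneg_left h7 (show (0:ℝ) ≤ n ^ 2 by positivity)
  have h11 : (0:ℝ) ≤ n ^ 2 * η := by positivity
  push_cast
  nlinarith

theorem hasHamiltonCycle_of_minDeg {η : ℝ} (hη : 0 < η) : ∃ n₀ : ℕ, ∀ n : ℕ, n₀ ≤ n → 3 ∣ n →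
    ∀ H : Finset (Finset (Fin n)), IsKGraph n 5 H →
      ((91 / 216 : ℝ) + η) * (n.choose 3 : ℝ) ≤ (minDeg n 5 2 H : ℝ) →
      HasHamiltonCycle n 5 2 H := by
  obtain ⟨n₁, h₁⟩ := exists_closed_path (half_pos hη)
  obtain ⟨n₂, h₂⟩ := exists_nat_ge (6 * (91 / 216 + η) / η + 2)
  refine ⟨n₁ + n₂, fun n hn h3 H hK hH => ?_⟩
  have hsym : Sym5 fun a b c d e : Fin n => ({a, b, c, d, e} : Finset (Fin n)) ∈ H := by
    refine ⟨fun {a b c d e} h => ?_, fun {a b c d e} h => ?_, fun {a b c d e} h => ?_,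
      fun {a b c d e} h => ?_, fun {a b c d e} h hab => ?_⟩
    · rwa [Finset.insert_comm]
    · rwa [Finset.insert_comm c b]
    · rwa [Finset.insert_comm d c]
    · rwa [Finset.pair_comm e d]
    · have h5 := hK _ h
      rw [hab, Finset.insert_eq_of_mem (by simp)] at h5
      have := Finset.card_le_four (a := b) (b := c) (c := d) (d := e)
      omega
  obtain ⟨p, M, hM, hM'⟩ := h₁ (Fin n) (by simp; omega) (by simpa using h3) _ hsym
    (Pr_of_minDeg hη (h₂.trans (by exact_mod_cast (by omega))) hH)
  exact hasHamiltonCycle_of_closed hM hM'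

/-- The 5-graph of all 5-sets meeting the first `a` vertices. -/
def meeting (n a : ℕ) : Finset (Finset (Fin n)) :=
  (univ.powersetCard 5).filter fun e => ∃ v ∈ e, (v : ℕ) < a

lemma not_hasHamiltonCycle_meeting {n a : ℕ} (h3 : 3 ∣ n) (ha : 6 * a < n) :
    ¬ HasHamiltonCycle n 5 2 (meeting n a) := by
  rintro ⟨f, hf, hf'⟩
  norm_num only at hf'
  obtain ⟨k, rfl⟩ := h3
  have : NeZero (3 * k) := ⟨by omega⟩
  rw [Nat.mul_div_cancel_left _ (by norm_num)] at hf'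
  let A : Finset (ZMod (3 * k)) := univ.filter fun z => (f z : ℕ) < a
  have hA : A.card ≤ a := by
    rw [← card_range a]
    exact card_le_card_of_injOn (fun z => (f z : ℕ)) (fun z hz => by simpa [A] using hz)
      fun z _ z' _ h => hf.1 (Fin.ext h)
  have hsub : range k ⊆ A.image (fun z => z.val / 3) ∪ A.image (fun z => (z.val / 3 + k - 1) % k) := by
    intro j hj
    rw [mem_range] at hj
    obtain ⟨v, hv, hva⟩ := (mem_filter.1 (hf' j hj)).2
    obtain ⟨i, hi, rfl⟩ := mem_image.1 hv
    rw [mem_range] at hi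
    have hz : ((j * 3 + i : ℕ) : ZMod (3 * k)) ∈ A := by simpa [A] using hva
    by_cases hi3 : i < 3
    · refine mem_union_left _ (mem_image.2 ⟨_, hz, ?_⟩)
      rw [ZMod.val_natCast, Nat.mod_eq_of_lt (by omega)]; omega
    · refine mem_union_right _ (mem_image.2 ⟨_, hz, ?_⟩)
      rw [ZMod.val_natCast]
      by_cases hjk : j + 1 < k
      · have e := Nat.mod_eq_of_lt (show j * 3 + i < 3 * k by omega)
        rw [e, show (j * 3 + i) / 3 + k - 1 = j + k by omega, Nat.add_mod_right, Nat.mod_eq_of_lt hj]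
      · have e := Nat.mod_eq_sub_mod (show 3 * k ≤ j * 3 + i by omega)
        rw [Nat.mod_eq_of_lt (show j * 3 + i - 3 * k < 3 * k by omega)] at e
        rw [e, show (j * 3 + i - 3 * k) / 3 + k - 1 = j by omega, Nat.mod_eq_of_lt hj]
  have h1 := card_le_card hsub
  rw [card_range] at h1
  have h2 := h1.trans (card_union_le _ _)
  have h4 := card_image_le (s := A) (f := fun z => z.val / 3)
  have h5 := card_image_le (s := A) (f := fun z => (z.val / 3 + k - 1) % k)
  omega

lemma hDeg_meeting {n a : ℕ} (han : a ≤ n) {S : Finset (Fin n)} (hS : S.card = 2) :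
    (n - 2).choose 3 ≤ hDeg n 5 (meeting n a) S + (n - a).choose 3 := by
  let A : Finset (Fin n) := univ.filter fun v => (v : ℕ) < a
  have hAc : Aᶜ.card = n - a := by
    have h1 : A.card = a := by
      have : A.map Fin.valEmbedding = range a := by
        ext i
        simp only [A, Finset.mem_map, mem_filter, mem_univ, true_and, mem_range, Fin.valEmbedding_apply]
        exact ⟨by rintro ⟨v, hv, rfl⟩; exact hv, fun h => ⟨⟨i, by omega⟩, h, rfl⟩⟩
      rw [← card_map Fin.valEmbedding, this, card_range]
    rw [card_compl, h1, Fintype.card_fin]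
  have h1 : hDeg n 5 (meeting n a) S = (univ.filter fun T : Finset (Fin n) =>
      T.card = 3 ∧ Disjoint S T ∧ S ∪ T ∈ meeting n a).card := by
    unfold hDeg
    rw [hS, Nat.card_eq_fintype_card, Fintype.card_subtype]
  have h2 : Sᶜ.powersetCard 3 ⊆ (univ.filter fun T : Finset (Fin n) =>
      T.card = 3 ∧ Disjoint S T ∧ S ∪ T ∈ meeting n a) ∪ Aᶜ.powersetCard 3 := by
    intro T hT
    rw [mem_powersetCard] at hT
    have hST : Disjoint S T := by
      rw [← Finset.subset_compl_iff_disjoint_left]; exact hT.1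
    by_cases h : T ⊆ Aᶜ
    · exact mem_union_right _ (mem_powersetCard.2 ⟨h, hT.2⟩)
    · obtain ⟨v, hv, hvA⟩ := Finset.not_subset.1 h
      refine mem_union_left _ (mem_filter.2 ⟨mem_univ _, hT.2, hST, mem_filter.2 ⟨?_, v, mem_union_right _ hv, ?_⟩⟩)
      · rw [mem_powersetCard]
        exact ⟨subset_univ _, by rw [card_union_of_disjoint hST, hS, hT.2]⟩
      · simpa [A] using hvA
  have h3 := (card_le_card h2).trans (card_union_le _ _)
  rwa [card_powersetCard, card_powersetCard, hAc, card_compl, hS, Fintype.card_fin, ← h1] at h3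

theorem exists_not_hasHamiltonCycle {η : ℝ} (hη : 0 < η) : ∃ n₀ : ℕ, ∀ n : ℕ, n₀ ≤ n → 3 ∣ n →
    ∃ H : Finset (Finset (Fin n)), IsKGraph n 5 H ∧
      ((91 / 216 : ℝ) - η) * (n.choose 3 : ℝ) ≤ (minDeg n 5 2 H : ℝ) ∧
      ¬ HasHamiltonCycle n 5 2 H := by
  obtain ⟨n₁, h₁⟩ := exists_nat_ge (18 / η)
  refine ⟨n₁ + 12, fun n hn h3 => ⟨meeting n ((n - 1) / 6), fun e he => ?_, ?_,
    not_hasHamiltonCycle_meeting h3 (by omega)⟩⟩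
  · exact (mem_powersetCard.1 (mem_filter.1 he).1).2
  · by_cases hη' : 91 / 216 ≤ η
    · have : ((91 / 216 : ℝ) - η) * (n.choose 3 : ℝ) ≤ 0 :=
        mul_nonpos_of_nonpos_of_nonneg (by linarith) (by positivity)
      exact this.trans (by positivity)
    set a := (n - 1) / 6 with ha
    obtain ⟨S, hS, hSm⟩ : minDeg n 5 2 (meeting n a) ∈ { m : ℕ | ∃ S : Finset (Fin n), S.card = 2 ∧
        hDeg n 5 (meeting n a) S = m } := by
      refine Nat.sInf_mem ?_
      obtain ⟨S, -, hS⟩ := exists_subset_card_eq (s := (univ : Finset (Fin n))) (n := 2)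
        (by simp; omega)
      exact ⟨_, S, hS, rfl⟩
    rw [← hSm]
    have h4 := hDeg_meeting (n := n) (a := a) (by omega) hS
    have h5 : ((n - 2).choose 3 : ℝ) ≤ hDeg n 5 (meeting n a) S + (n - a).choose 3 := by
      exact_mod_cast h4
    have e1 := six_mul_choose_three (n - 2)
    have e2 := six_mul_choose_three (n - a)
    have e3 := six_mul_choose_three n
    rw [Nat.cast_sub (by omega)] at e1 e2
    have hn12 : (12 : ℝ) ≤ n := by exact_mod_cast (by omega)
    have ha1 : (n : ℝ) ≤ 6 * a + 6 := by exact_mod_cast (by omega)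
    have ha2 : (6 * a : ℝ) ≤ n := by exact_mod_cast (by omega)
    have hηn : 18 ≤ η * n := by
      rw [div_le_iff₀ hη] at h₁
      have : (n₁ : ℝ) ≤ n := by exact_mod_cast (by omega)
      nlinarith
    have hb1 : (6:ℝ) * (n - 2).choose 3 ≥ n ^ 3 - 12 * n ^ 2 := by
      rw [e1]; push_cast; nlinarith
    have hb2 : (6:ℝ) * (n - a).choose 3 ≤ 125 / 216 * n ^ 3 + 6 * n ^ 2 := by
      rw [e2]
      set z : ℝ := n - a with hz
      have hz0 : 2 ≤ z := by linarith
      have hz1 : z ≤ 5 / 6 * n + 1 := by linarith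
      have : z * (z - 1) * (z - 2) ≤ (5 / 6 * n + 1) ^ 3 := by
        calc _ ≤ z * z * z := by gcongr <;> linarith
          _ = z ^ 3 := by ring
          _ ≤ _ := by gcongr
      nlinarith
    have hb3 : (6:ℝ) * n.choose 3 ≤ n ^ 3 := by
      rw [e3]; nlinarith
    have hb4 := mul_le_mul_of_nonneg_left hb3 (show 0 ≤ 91 / 216 - η by linarith)
    have hb5 := mul_le_mul_of_nonneg_right hηn (show (0:ℝ) ≤ n ^ 2 by positivity)
    nlinarith

lemma tendsto_hThreshold : Filter.Tendsto
    (fun n : ℕ => (hThreshold 5 2 2 n : ℝ) / (n.choose (5 - 2) : ℝ))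
    (Filter.atTop ⊓ Filter.principal { m : ℕ | (5 - 2) ∣ m }) (nhds (91 / 216)) := by
  rw [Metric.tendsto_nhds]
  intro δ hδ
  obtain ⟨n₁, h₁⟩ := hasHamiltonCycle_of_minDeg (η := δ / 3) (by positivity)
  obtain ⟨n₂, h₂⟩ := exists_not_hasHamiltonCycle (η := δ / 3) (by positivity)
  obtain ⟨n₃, h₃⟩ := exists_nat_ge (3 / δ + 2)
  rw [Filter.eventually_inf_principal]
  filter_upwards [Filter.eventually_ge_atTop (n₁ + n₂ + n₃ + 3)] with n hn h3
  change 3 ∣ n at h3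
  have hC : (0:ℝ) < n.choose 3 := by exact_mod_cast Nat.choose_pos (by omega)
  have hCn : 3 / δ ≤ n.choose 3 := by
    have h4 : n - 2 ≤ n.choose 3 := by
      obtain ⟨k, rfl⟩ : ∃ k, n = k + 3 := ⟨n - 3, by omega⟩
      rw [Nat.choose_succ_succ' (k + 2) 2]
      have := Nat.choose_le_choose 2 (show k + 1 ≤ k + 2 by omega)
      have h5 : (k + 2).choose 2 = (k + 1).choose 1 + (k + 1).choose 2 := Nat.choose_succ_succ' _ _
      rw [Nat.choose_one_right] at h5
      omega
    have h5 : ((n - 2 : ℕ) : ℝ) ≤ n.choose 3 := by exact_mod_cast h4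
    rw [Nat.cast_sub (by omega)] at h5
    have h6 : (n₃ : ℝ) ≤ n := by exact_mod_cast (by omega)
    push_cast at h5
    linarith
  set U := { h : ℕ | ∀ H : Finset (Finset (Fin n)), IsKGraph n 5 H →
    h ≤ minDeg n 5 2 H → HasHamiltonCycle n 5 2 H } with hU
  have hUm : ⌈(91 / 216 + δ / 3) * (n.choose 3 : ℝ)⌉₊ ∈ U := fun H hK hH =>
    h₁ n (by omega) h3 H hK ((Nat.le_ceil _).trans (by exact_mod_cast hH))
  have hle : (hThreshold 5 2 2 n : ℝ) ≤ (91 / 216 + δ / 3) * (n.choose 3 : ℝ) + 1 := by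
    have h4 : (hThreshold 5 2 2 n : ℝ) ≤ ⌈(91 / 216 + δ / 3) * (n.choose 3 : ℝ)⌉₊ := by
      exact_mod_cast Nat.sInf_le hUm
    exact h4.trans (Nat.ceil_lt_add_one (by positivity)).le
  have hge : (91 / 216 - δ / 3) * (n.choose 3 : ℝ) ≤ hThreshold 5 2 2 n := by
    obtain ⟨H, hK, hH, hno⟩ := h₂ n (by omega) h3
    refine hH.trans ?_
    have hmem : hThreshold 5 2 2 n ∈ U := Nat.sInf_mem ⟨_, hUm⟩
    by_contra hlt
    push Not at hlt
    exact hno (hmem H hK (by exact_mod_cast hlt.le))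
  rw [Real.dist_eq, abs_lt]
  have h8 : 1 ≤ δ / 3 * n.choose 3 := by
    rw [div_le_iff₀ hδ] at hCn; linarith
  have h9 : 0 < δ * n.choose 3 := by positivity
  norm_num only
  constructor
  · rw [lt_sub_iff_add_lt, lt_div_iff₀ hC]; linarith
  · rw [sub_lt_iff_lt_add, div_lt_iff₀ hC]; linarith

lemma hVal_eq : hVal 5 2 2 = 91 / 216 := by
  have : (Filter.atTop ⊓ Filter.principal { m : ℕ | (5 - 2) ∣ m }).NeBot := by
    rw [Filter.inf_principal_neBot_iff]
    intro U hU
    obtain ⟨N, hN⟩ := Filter.mem_atTop_sets.1 hU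
    exact ⟨3 * N, hN _ (by omega), Dvd.intro _ rfl⟩
  exact tendsto_hThreshold.limsup_eq

end Dirac

end

/-- `h₂²(5) = 91/216`: (i) for every `η > 0`, every sufficiently large
5-graph `H` on `n` vertices with `3 ∣ n` and `δ₂(H) ≥ (91/216 + η) C(n,3)` contains a
Hamilton 2-cycle; (ii) for every `η > 0` and all sufficiently large `n` with `3 ∣ n`
there is a 5-graph on `n` vertices with `δ₂(H) ≥ (91/216 - η) C(n,3)` and no Hamilton
2-cycle. -/
theorem dirac_value_5_2_2 :
    hVal 5 2 2 = 91 / 216 ∧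
    (∀ η : ℝ, 0 < η → ∃ n₀ : ℕ, ∀ n : ℕ, n₀ ≤ n → 3 ∣ n →
      ∀ H : Finset (Finset (Fin n)), IsKGraph n 5 H →
        ((91 / 216 : ℝ) + η) * (n.choose 3 : ℝ) ≤ (minDeg n 5 2 H : ℝ) →
        HasHamiltonCycle n 5 2 H) ∧
    (∀ η : ℝ, 0 < η → ∃ n₀ : ℕ, ∀ n : ℕ, n₀ ≤ n → 3 ∣ n →
      ∃ H : Finset (Finset (Fin n)), IsKGraph n 5 H ∧
        ((91 / 216 : ℝ) - η) * (n.choose 3 : ℝ) ≤ (minDeg n 5 2 H : ℝ) ∧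
        ¬ HasHamiltonCycle n 5 2 H) := by
  exact ⟨Dirac.hVal_eq, fun _ hη => Dirac.hasHamiltonCycle_of_minDeg hη,
    fun _ hη => Dirac.exists_not_hasHamiltonCycle hη⟩
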